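/- Let ρ satisfy condition (3) with S identically zero. Suppose there exist f, g ∈ H^{1,2}(Δ)ⁿ which are C⁴ on Γ, such that ρ(z,f(z)) = 1 for all z ∈ Γ, Σⱼ₌₁ⁿ fⱼ(z)gⱼ(z) = 1, and the affine complex tangent plane to K¹_z at (z,f(z)) is {(w₁,…,wₙ) ∈ ℂⁿ : Σⱼ₌₁ⁿ gⱼ(z)wⱼ = 1}. Then there exist a neighborhood N(f(0)) in ℂⁿ and C¹ maps F, G: N(f(0)) → H^{1,2}(Δ)ⁿ such that for each fixed w ∈ N(f(0)): ρ(z,F(w)(z)) is constant in z ∈ Γ, F(w)(0) = w, Σⱼ₌₁ⁿ Fⱼ(w)(z)Gⱼ(w)(z) = 1, and the affine complex tangent plane to K^{ρ(z,F(w)(z))}_z at F(w)(z) is {(w₁,…,wₙ) ∈ ℂⁿ : Σⱼ₌₁ⁿ Gⱼ(w)(z)wⱼ = 1}. -/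

import Mathlib

open Complex Metric MeasureTheory Filter Set

noncomputable section

/-- The unit circle `Γ` in `ℂ`. -/
def Circ : Set ℂ := Metric.sphere (0 : ℂ) 1

/-- The closed unit disk `Δ` in `ℂ`. -/
def Disk : Set ℂ := Metric.closedBall (0 : ℂ) 1

/-- The Euclidean norm on `ℂⁿ`. -/
def euclNorm {n : ℕ} (w : Fin n → ℂ) : ℝ := Real.sqrt (∑ j, Complex.normSq (w j))

/-- The complex partial derivative `∂g/∂wⱼ` of a real-valued function `g` on `ℂⁿ`. -/
def wderiv {n : ℕ} (g : (Fin n → ℂ) → ℝ) (w : Fin n → ℂ) (j : Fin n) : ℂ :=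
  (((fderiv ℝ g w) (Pi.single j 1) : ℝ) - Complex.I * ((fderiv ℝ g w) (Pi.single j Complex.I) : ℝ)) / 2

/-- The affine complex tangent plane at `p` to the level set of `g` through `p`. -/
def TangentPlane {n : ℕ} (g : (Fin n → ℂ) → ℝ) (p : Fin n → ℂ) : Set (Fin n → ℂ) :=
  {w | ∑ j, (w j - p j) * wderiv g p j = 0}

/-- `ρ` is strictly hypoconvex on a subset `U` of `Γ × ℂⁿ`: on every compact subset
there is `𝒦 > 0` such that the real Hessian in `w` is `≥ 𝒦‖u‖²` on complex tangent
vectors `u` of the fibers. -/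
def StrictHypoconvexOn {n : ℕ} (ρ : ℂ → (Fin n → ℂ) → ℝ) (U : Set (ℂ × (Fin n → ℂ))) : Prop :=
  ∀ C : Set (ℂ × (Fin n → ℂ)), C ⊆ U → IsCompact C →
    ∃ K0 > (0:ℝ), ∀ p ∈ C, ∀ u : Fin n → ℂ,
      (∑ j, u j * wderiv (ρ p.1) p.2 j) = 0 →
      K0 * (euclNorm u)^2 ≤ iteratedFDeriv ℝ 2 (ρ p.1) p.2 ![u, u]

/-- Two subsets of real normed spaces are (C⁶-)diffeomorphic: there are C⁶ maps on
open neighborhoods carrying one onto the other, inverse to each other on the sets. -/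
def DiffeomorphicSets {E F : Type*} [NormedAddCommGroup E] [NormedSpace ℝ E]
    [NormedAddCommGroup F] [NormedSpace ℝ F] (A : Set E) (B : Set F) : Prop :=
  ∃ (U : Set E) (V : Set F) (f : E → F) (g : F → E),
    IsOpen U ∧ IsOpen V ∧ A ⊆ U ∧ B ⊆ V ∧
    ContDiffOn ℝ 6 f U ∧ ContDiffOn ℝ 6 g V ∧
    Set.MapsTo f A B ∧ Set.MapsTo g B A ∧
    (∀ x ∈ A, g (f x) = x) ∧ (∀ y ∈ B, f (g y) = y)

/-- Condition (3) of the paper, for `ρ` with respect to `R` and `S`. -/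
structure Cond3 (n : ℕ) (ρ : ℂ → (Fin n → ℂ) → ℝ) (R : ℝ) (S : ℂ → Fin n → ℂ) : Prop where
  hn : 2 ≤ n
  nonneg : ∀ z ∈ Circ, ∀ w, 0 ≤ ρ z w
  cont : ContinuousOn (fun p : ℂ × (Fin n → ℂ) => ρ p.1 p.2) {p | p.1 ∈ Circ}
  smooth : ContDiffOn ℝ 6 (fun p : ℂ × (Fin n → ℂ) => ρ p.1 p.2)
      {p | p.1 ∈ Circ ∧ ρ p.1 p.2 ≠ 0}
  hR : 1 < R
  grad_ne : ∀ z ∈ Circ, ∀ w, 0 < ρ z w → ρ z w ≤ R → fderiv ℝ (ρ z) w ≠ 0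
  hypo : StrictHypoconvexOn ρ {p | p.1 ∈ Circ ∧ ρ p.1 p.2 ≠ 0}
  levelCompact : ∀ t : ℝ, 0 < t → t ≤ R →
      IsCompact {p : ℂ × (Fin n → ℂ) | p.1 ∈ Circ ∧ ρ p.1 p.2 = t}
  fiberSphere : ∀ t : ℝ, 0 < t → t ≤ R → ∀ z ∈ Circ,
      DiffeomorphicSets {w | ρ z w = t} (Metric.sphere (0 : EuclideanSpace ℂ (Fin n)) 1)
  levelR : ∀ z ∈ Circ, ∀ w, ρ z w = R ↔ euclNorm w = R
  aboveR : ∀ z ∈ Circ, ∀ w, R < euclNorm w → R < ρ z w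
  Scont : ContinuousOn S Circ
  Ssmall : ∀ z ∈ Circ, euclNorm (S z) < R
  Szero : ∀ z ∈ Circ, ∀ w, ρ z w = 0 ↔ w = S z

/-- The `j`-th Fourier coefficient of the boundary values of `f` on the circle. -/
def bCoeff (f : ℂ → ℂ) (j : ℤ) : ℂ :=
  (1 / (2 * Real.pi) : ℂ) * ∫ θ in (0:ℝ)..(2 * Real.pi),
    f (Complex.exp (↑θ * Complex.I)) * Complex.exp (-(j : ℂ) * ↑θ * Complex.I)

/-- The Hilbert space `ℓ²(ℤ)` used to represent `W^{1,2}(Γ)`. -/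
abbrev Seq2 : Type := lp (fun _ : ℤ => ℂ) 2

/-- `a ∈ ℓ²(ℤ)` is the (weighted) Fourier coefficient representation of `f` in the
Sobolev space `W^{1,2}(Γ)`; the weight `√(1+j²)` makes the `ℓ²` norm of `a`
equivalent to the `W^{1,2}` norm of `f`. -/
def RepOf (a : Seq2) (f : ℂ → ℂ) : Prop :=
  ∀ j : ℤ, (a : ∀ _ : ℤ, ℂ) j = (Real.sqrt (1 + (j:ℝ)^2) : ℂ) * bCoeff f j

/-- Membership in `H^{1,2}(Δ) = H²(Δ) ∩ W^{1,2}(Γ)` (whose elements extend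
continuously to the closed disk). -/
def MemH12 (f : ℂ → ℂ) : Prop :=
  ContinuousOn f Disk ∧ DifferentiableOn ℂ f (Metric.ball (0:ℂ) 1) ∧ ∃ a : Seq2, RepOf a f

/-- Membership in the disk algebra `A(Δ)`. -/
def MemA (f : ℂ → ℂ) : Prop :=
  ContinuousOn f Disk ∧ DifferentiableOn ℂ f (Metric.ball (0:ℂ) 1)

/-- Membership in `H^∞(Δ)`. -/
def MemHinf (f : ℂ → ℂ) : Prop :=
  DifferentiableOn ℂ f (Metric.ball (0:ℂ) 1) ∧ ∃ M : ℝ, ∀ z ∈ Metric.ball (0:ℂ) 1, ‖f z‖ ≤ M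

/-- `f` is `C^k`-smooth on the circle `Γ`. -/
def CkCirc (k : ℕ) (f : ℂ → ℂ) : Prop :=
  ContDiff ℝ k (fun θ : ℝ => f (Complex.exp (↑θ * Complex.I)))

/-- `f` is `C⁴`-smooth on the circle `Γ`. -/
def C4Circ (f : ℂ → ℂ) : Prop := CkCirc 4 f

/-- Vector-valued versions. -/
def MemH12V {n : ℕ} (f : ℂ → Fin n → ℂ) : Prop := ∀ j, MemH12 fun z => f z j
def MemAV {n : ℕ} (f : ℂ → Fin n → ℂ) : Prop := ∀ j, MemA fun z => f z j
def MemHinfV {n : ℕ} (f : ℂ → Fin n → ℂ) : Prop := ∀ j, MemHinf fun z => f z j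
def C4CircV {n : ℕ} (f : ℂ → Fin n → ℂ) : Prop := ∀ j, C4Circ fun z => f z j

/-- The coordinates of a point of `ℂ × ℂⁿ` as a point of `ℂ^{n+1}`. -/
def pcoords {n : ℕ} (p : ℂ × (Fin n → ℂ)) : Fin (n+1) → ℂ := Fin.cons p.1 p.2

/-- The polynomial hull of a subset of `ℂ × ℂⁿ ≅ ℂ^{n+1}`. -/
def polyHull {n : ℕ} (Y : Set (ℂ × (Fin n → ℂ))) : Set (ℂ × (Fin n → ℂ)) :=
  {p | ∀ P : MvPolynomial (Fin (n+1)) ℂ, ∀ M : ℝ,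
    (∀ q ∈ Y, ‖MvPolynomial.eval (pcoords q) P‖ ≤ M) → ‖MvPolynomial.eval (pcoords p) P‖ ≤ M}

/-- The polynomial hull of a subset of `ℂⁿ`. -/
def polyHulln {n : ℕ} (Y : Set (Fin n → ℂ)) : Set (Fin n → ℂ) :=
  {w | ∀ P : MvPolynomial (Fin n) ℂ, ∀ M : ℝ,
    (∀ v ∈ Y, ‖MvPolynomial.eval v P‖ ≤ M) → ‖MvPolynomial.eval w P‖ ≤ M}

/-- The coordinates of a point of `ℂ × ℂⁿ × ℂⁿ` as a point of `ℂ^{2n+1}`. -/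
def pcoords2 {n : ℕ} (p : ℂ × ((Fin n → ℂ) × (Fin n → ℂ))) : Fin (n + n + 1) → ℂ :=
  Fin.cons p.1 (Fin.append p.2.1 p.2.2)

/-- The polynomial hull of a subset of `ℂ × ℂⁿ × ℂⁿ ≅ ℂ^{2n+1}`. -/
def polyHull2 {n : ℕ} (Y : Set (ℂ × ((Fin n → ℂ) × (Fin n → ℂ)))) :
    Set (ℂ × ((Fin n → ℂ) × (Fin n → ℂ))) :=
  {p | ∀ P : MvPolynomial (Fin (n + n + 1)) ℂ, ∀ M : ℝ,
    (∀ q ∈ Y, ‖MvPolynomial.eval (pcoords2 q) P‖ ≤ M) → ‖MvPolynomial.eval (pcoords2 p) P‖ ≤ M}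

/-- A subset of `ℂⁿ` is hypoconvex if its complement is a union of complex affine
hyperplanes. -/
def HypoconvexSet {n : ℕ} (A : Set (Fin n → ℂ)) : Prop :=
  ∀ v : Fin n → ℂ, v ∉ A → ∃ (c : Fin n → ℂ) (d : ℂ), c ≠ 0 ∧
    (∑ j, c j * v j) = d ∧ ∀ w ∈ A, (∑ j, c j * w j) ≠ d

/-- `A` has `C^k` boundary: near each boundary point the boundary is the zero set of a
`C^k` function with nonvanishing gradient. -/
def CkBoundary {E : Type*} [NormedAddCommGroup E] [NormedSpace ℝ E] (k : ℕ) (A : Set E) : Prop :=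
  ∀ p ∈ frontier A, ∃ U : Set E, IsOpen U ∧ p ∈ U ∧
    ∃ φ : E → ℝ, ContDiffOn ℝ k φ U ∧ (∀ x ∈ U, fderiv ℝ φ x ≠ 0) ∧
      frontier A ∩ U = {x | φ x = 0} ∩ U

/-- `fb` gives the a.e. radial boundary values on `Γ` of the function `f` on the open disk. -/
def IsBdryVal {n : ℕ} (f fb : ℂ → Fin n → ℂ) : Prop :=
  ∀ᵐ (θ : ℝ) ∂(volume.restrict (Set.Ioc (0:ℝ) (2 * Real.pi))),
    Filter.Tendsto (fun r : ℝ => f ((r : ℂ) * Complex.exp (↑θ * Complex.I)))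
      (nhdsWithin 1 (Set.Iio 1)) (nhds (fb (Complex.exp (↑θ * Complex.I))))

/-- The optimal control `γ_ρ = inf_{f ∈ H^∞(Δ)ⁿ} ess sup_{z ∈ Γ} ρ(z,f(z))`. -/
def gammaRho {n : ℕ} (ρ : ℂ → (Fin n → ℂ) → ℝ) : ℝ :=
  sInf {c : ℝ | ∃ f fb : ℂ → Fin n → ℂ, MemHinfV f ∧ IsBdryVal f fb ∧
    ∀ᵐ (θ : ℝ) ∂(volume.restrict (Set.Ioc (0:ℝ) (2 * Real.pi))),
      ρ (Complex.exp (↑θ * Complex.I)) (fb (Complex.exp (↑θ * Complex.I))) ≤ c}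

/-- `δ_ρ = inf_{f ∈ A(Δ)ⁿ} sup_{z ∈ Γ} ρ(z,f(z))`. -/
def deltaRho {n : ℕ} (ρ : ℂ → (Fin n → ℂ) → ℝ) : ℝ :=
  sInf {c : ℝ | ∃ f : ℂ → Fin n → ℂ, MemAV f ∧ ∀ z ∈ Circ, ρ z (f z) ≤ c}

/-- `ρ_m(z,w) = ρ(z, w/zᵐ)`. -/
def rhoShift {n : ℕ} (ρ : ℂ → (Fin n → ℂ) → ℝ) (m : ℕ) : ℂ → (Fin n → ℂ) → ℝ :=
  fun z w => ρ z (fun j => w j / z ^ m)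

/-- `q` is an `n`-tuple of harmonic polynomials. -/
def HarmPolyTuple {n : ℕ} (q : ℂ → Fin n → ℂ) : Prop :=
  ∃ (d : ℕ) (a b : ℕ → Fin n → ℂ), ∀ z : ℂ, ∀ j,
    q z j = ∑ i ∈ Finset.range (d+1), (a i j * z ^ i + b i j * (starRingEnd ℂ z) ^ i)

/-- `zᵐ q(z)` has analytic polynomial coordinates (as boundary values on `Γ`). -/
def ZmAnalytic {n : ℕ} (m : ℕ) (q : ℂ → Fin n → ℂ) : Prop :=
  ∀ j, ∃ p : Polynomial ℂ, ∀ z ∈ Circ, z ^ m * q z j = Polynomial.eval z p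

/-- The boundary function `q` on `Γ` is analytic, i.e. agrees on `Γ` with an element
of `A(Δ)ⁿ`. -/
def BoundaryAnalytic {n : ℕ} (q : ℂ → Fin n → ℂ) : Prop :=
  ∃ h : ℂ → Fin n → ℂ, MemAV h ∧ ∀ z ∈ Circ, h z = q z


/-! part 1 -/
set_option linter.unusedSectionVars false
open Complex Metric MeasureTheory Filter Set

section Nemytskii
variable {K Y Z : Type*} [TopologicalSpace K] [CompactSpace K]
  [NormedAddCommGroup Y] [NormedSpace ℝ Y] [NormedAddCommGroup Z] [NormedSpace ℝ Z]

/-- Superposition (Nemytskii) operator on continuous functions. -/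
noncomputable def nem (Φ : C(K × Y, Z)) (u : C(K, Y)) : C(K, Z) :=
  Φ.comp ((ContinuousMap.id K).prodMk u)

@[simp] lemma nem_apply (Φ : C(K × Y, Z)) (u : C(K, Y)) (k : K) : nem Φ u k = Φ (k, u k) := rfl

lemma nem_continuous (Φ : C(K × Y, Z)) : Continuous (nem Φ) := by
  unfold nem
  refine (ContinuousMap.continuous_postcomp Φ).comp ?_
  exact ContinuousMap.continuous_of_continuous_uncurry _ (by
    change Continuous fun p : C(K, Y) × K => (p.2, p.1 p.2)
    fun_prop)

/-- Pointwise application of operator valued continuous functions. -/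
noncomputable def mulC : C(K, Y →L[ℝ] Z) →L[ℝ] C(K, Y) →L[ℝ] C(K, Z) :=
  LinearMap.mkContinuous₂
    (LinearMap.mk₂ ℝ (fun (m : C(K, Y →L[ℝ] Z)) (u : C(K, Y)) =>
      (⟨fun k => m k (u k), by fun_prop⟩ : C(K, Z)))
      (by intros; ext; simp) (by intros; ext; simp) (by intros; ext; simp) (by intros; ext; simp))
    1 (by
      intro m u
      rw [ContinuousMap.norm_le _ (by positivity)]
      intro k
      simp only [LinearMap.mk₂_apply, ContinuousMap.coe_mk, one_mul]
      exact (m k).le_of_opNorm_le_of_le (m.norm_coe_le_norm k) (u.norm_coe_le_norm k))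

@[simp] lemma mulC_apply (m : C(K, Y →L[ℝ] Z)) (u : C(K, Y)) (k : K) :
    mulC m u k = m k (u k) := rfl

lemma nem_hasFDerivAt (Φ : C(K × Y, Z)) (Φ' : C(K × Y, Y →L[ℝ] Z))
    (h : ∀ k y, HasFDerivAt (fun y => Φ (k, y)) (Φ' (k, y)) y) (u : C(K, Y)) :
    HasFDerivAt (nem Φ) (mulC (nem Φ' u)) u := by
  rw [hasFDerivAt_iff_isLittleO_nhds_zero, Asymptotics.isLittleO_iff]
  intro c hc
  have hcont := (nem_continuous Φ').continuousAt (x := u)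
  rw [Metric.continuousAt_iff] at hcont
  obtain ⟨δ, hδ, hd⟩ := hcont c hc
  have key : ∀ k : K, ∀ y ∈ ball (u k) δ, ‖Φ' (k, y) - Φ' (k, u k)‖ ≤ c := by
    intro k y hy
    have h1 : dist (u + ContinuousMap.const K (y - u k)) u < δ := by
      rw [dist_eq_norm, add_sub_cancel_left]
      refine lt_of_le_of_lt ((ContinuousMap.norm_le _ (norm_nonneg (y - u k))).2 (by intro; simp)) ?_
      rwa [← dist_eq_norm]
    have h2 := hd h1
    have h3 := (ContinuousMap.dist_apply_le_dist (f := nem Φ' (u + ContinuousMap.const K (y - u k)))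
      (g := nem Φ' u) k).trans h2.le
    simpa [dist_eq_norm] using h3
  filter_upwards [Metric.ball_mem_nhds (0 : C(K, Y)) hδ] with v hv
  rw [ContinuousMap.norm_le _ (by positivity)]
  intro k
  have hvk : ‖v k‖ ≤ ‖v‖ := v.norm_coe_le_norm k
  have hv' : ‖v‖ < δ := by simpa using hv
  have := (convex_ball (u k) δ).norm_image_sub_le_of_norm_hasFDerivWithin_le'
    (f := fun y => Φ (k, y)) (f' := fun y => Φ' (k, y)) (φ := Φ' (k, u k)) (C := c)
    (fun y hy => (h k y).hasFDerivWithinAt) (key k) (mem_ball_self hδ)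
    (y := u k + v k) (by simpa using hvk.trans_lt hv')
  simp only [add_sub_cancel_left] at this
  simp only [ContinuousMap.sub_apply, nem_apply, ContinuousMap.add_apply, mulC_apply]
  exact this.trans (by gcongr)

lemma nem_contDiff (Φ : C(K × Y, Z)) (Φ' : C(K × Y, Y →L[ℝ] Z))
    (h : ∀ k y, HasFDerivAt (fun y => Φ (k, y)) (Φ' (k, y)) y) :
    ContDiff ℝ 1 (nem Φ) := by
  rw [contDiff_one_iff_hasFDerivAt]
  exact ⟨fun u => mulC (nem Φ' u), mulC.continuous.comp (nem_continuous Φ'), nem_hasFDerivAt Φ Φ' h⟩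

end Nemytskii

/-! part 2 -/
set_option linter.unusedSectionVars false
open Complex Metric MeasureTheory Filter Set

section CircleSpaces

instance twoPiFact : Fact (0 < 2 * Real.pi) := ⟨Real.two_pi_pos⟩

/-- The circle as an additive group. -/
abbrev TT : Type := AddCircle (2 * Real.pi)

/-- Normalised measure on the circle. -/
noncomputable abbrev muT : Measure TT := AddCircle.haarAddCircle

variable {A : Type*} [NormedAddCommGroup A] [InnerProductSpace ℂ A]

/-- The function `e_j • a`. -/
noncomputable def fA (j : ℤ) (a : A) : C(TT, A) := ⟨fun t => fourier j t • a, by fun_prop⟩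

@[simp] lemma fA_apply (j : ℤ) (a : A) (t : TT) : fA j a t = fourier j t • a := rfl

lemma norm_fourier_apply (j : ℤ) (t : TT) : ‖(fourier j t : ℂ)‖ = 1 := by
  rw [fourier_apply]; exact Circle.norm_coe _

lemma norm_fA (j : ℤ) (a : A) : ‖fA j a‖ ≤ ‖a‖ := by
  rw [ContinuousMap.norm_le _ (norm_nonneg _)]
  intro t
  rw [fA_apply, norm_smul, norm_fourier_apply, one_mul]

lemma integral_fourier (j : ℤ) : ∫ t, (fourier j t : ℂ) ∂muT = if j = 0 then 1 else 0 := by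
  have h := fourierCoeff_fourier (T := 2 * Real.pi) j
  have h0 := congrFun h 0
  simp only [fourierCoeff, neg_zero, fourier_zero, one_smul] at h0
  rw [h0, Pi.single_apply]
  simp [eq_comm]

/-- Continuous functions as elements of `L²`. -/
noncomputable abbrev toL2 (u : C(TT, A)) : Lp A 2 muT := ContinuousMap.toLp (E := A) 2 muT ℂ u

lemma inner_toL2 (u v : C(TT, A)) :
    inner ℂ (toL2 u) (toL2 v) = ∫ t, inner ℂ (u t) (v t) ∂muT := by
  rw [L2.inner_def]
  apply integral_congr_ae
  filter_upwards [ContinuousMap.coeFn_toLp (p := 2) (𝕜 := ℂ) muT u,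
    ContinuousMap.coeFn_toLp (p := 2) (𝕜 := ℂ) muT v] with t h1 h2
  rw [h1, h2]

lemma inner_fA (j k : ℤ) (a b : A) :
    inner ℂ (toL2 (fA j a)) (toL2 (fA k b)) = if j = k then inner ℂ a b else 0 := by
  rw [inner_toL2]
  have : ∀ t : TT, inner ℂ (fA j a t) (fA k b t) = fourier (k - j) t * inner ℂ a b := by
    intro t
    simp only [fA_apply, inner_smul_left, inner_smul_right]
    rw [sub_eq_add_neg, fourier_add, fourier_neg]
    ring
  simp_rw [this]
  rw [integral_mul_const, integral_fourier]
  by_cases h : j = k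
  · simp [h]
  · simp [h, sub_eq_zero, Ne.symm h, eq_comm]

/-- isometric embedding on one frequency. -/
noncomputable def VA (k : ℕ) : A →ₗᵢ[ℂ] Lp A 2 muT where
  toFun a := toL2 (fA ((k : ℤ) + 1) a)
  map_add' a b := by
    rw [← map_add]; congr 1; ext t; simp
  map_smul' c a := by
    simp only [RingHom.id_apply]
    rw [← map_smul]; congr 1; ext t
    simp only [fA_apply, ContinuousMap.smul_apply]; exact smul_comm _ _ _
  norm_map' a := by
    have h := inner_fA ((k : ℤ) + 1) ((k : ℤ) + 1) a a
    simp only [if_true] at h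
    have h1 := congrArg RCLike.re h
    rw [inner_self_eq_norm_sq, inner_self_eq_norm_sq] at h1
    exact (pow_left_inj₀ (norm_nonneg _) (norm_nonneg _) two_ne_zero).1 h1

lemma VA_apply (k : ℕ) (a : A) : VA k a = toL2 (fA ((k : ℤ) + 1) a) := rfl

lemma VA_orth : OrthogonalFamily ℂ (fun _ : ℕ => A) (fun k => VA (A := A) k) := by
  intro i j hij a b
  have hne : ((i : ℤ) + 1) ≠ ((j : ℤ) + 1) := by
    intro h; apply hij; omega
  change inner ℂ (toL2 (fA ((i : ℤ) + 1) a)) (toL2 (fA ((j : ℤ) + 1) b)) = 0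
  rw [inner_fA, if_neg hne]

/-- The Hilbert space of (derivatives of) `H^{1,2}` functions vanishing at the origin. -/
def XSp (A : Type*) [NormedAddCommGroup A] [InnerProductSpace ℂ A] : Type _ :=
  lp (fun _ : ℕ => A) 2

noncomputable instance : NormedAddCommGroup (XSp A) :=
  inferInstanceAs (NormedAddCommGroup (lp (fun _ : ℕ => A) 2))
noncomputable instance : InnerProductSpace ℂ (XSp A) :=
  inferInstanceAs (InnerProductSpace ℂ (lp (fun _ : ℕ => A) 2))
noncomputable instance : InnerProductSpace ℝ (XSp A) := InnerProductSpace.complexToReal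
instance [CompleteSpace A] : CompleteSpace (XSp A) :=
  inferInstanceAs (CompleteSpace (lp (fun _ : ℕ => A) 2))

/-- coefficients -/
def XSp.co (x : XSp A) (k : ℕ) : A := (show lp (fun _ : ℕ => A) 2 from x) k

/-- single coefficient elements -/
noncomputable def XSp.sg (k : ℕ) (a : A) : XSp A := (lp.single 2 k a : lp (fun _ : ℕ => A) 2)

lemma XSp.co_add (x y : XSp A) (k : ℕ) : (x + y).co k = x.co k + y.co k := rfl
lemma XSp.co_smul (c : ℂ) (x : XSp A) (k : ℕ) : (c • x).co k = c • x.co k := rfl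
lemma XSp.co_sg (k : ℕ) (a : A) (j : ℕ) : (XSp.sg k a).co j = if j = k then a else 0 := by
  unfold XSp.sg XSp.co
  simp only [lp.single_apply]
  by_cases h : j = k
  · subst h; simp
  · simp [h]

lemma XSp.hasSum_sg (x : XSp A) : HasSum (fun k => XSp.sg k (x.co k)) x :=
  lp.hasSum_single (p := 2) (by simp) (show lp (fun _ : ℕ => A) 2 from x)

lemma XSp.hasSum_sq (x : XSp A) : HasSum (fun k => ‖x.co k‖ ^ 2) (‖x‖ ^ 2) := by
  have := lp.hasSum_norm (p := 2) (by simp) (show lp (fun _ : ℕ => A) 2 from x)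
  simp at this
  exact this

variable [CompleteSpace A]

/-- The isometry to `L²`. -/
noncomputable def UXl : XSp A →ₗᵢ[ℂ] Lp A 2 muT := VA_orth.linearIsometry

lemma UXl_sg (k : ℕ) (a : A) : UXl (XSp.sg k a) = toL2 (fA ((k : ℤ) + 1) a) := by
  unfold UXl XSp.sg
  erw [OrthogonalFamily.linearIsometry_apply_single]
  rfl

/-- multiplier -/
noncomputable def mk1 (k : ℕ) : ℂ := (Complex.I * ((k : ℂ) + 1))⁻¹

lemma norm_mk1 (k : ℕ) : ‖mk1 k‖ = ((k : ℝ) + 1)⁻¹ := by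
  unfold mk1
  rw [norm_inv, norm_mul, Complex.norm_I, one_mul]
  congr 1
  have : ((k : ℂ) + 1) = ((k + 1 : ℕ) : ℂ) := by push_cast; ring
  rw [this, Complex.norm_natCast]; push_cast; ring

lemma summable_mk1_sq : Summable (fun k => ‖mk1 k‖ ^ 2) := by
  simp_rw [norm_mk1, inv_pow]
  have := (summable_nat_add_iff 1).2 (Real.summable_nat_pow_inv.2 (one_lt_two))
  simpa using this

lemma XSp.hol (x : XSp A) : Summable (fun k => ‖mk1 k‖ * ‖x.co k‖) ∧
    ∑' k : ℕ, ‖mk1 k‖ * ‖x.co k‖ ≤ Real.sqrt (∑' k : ℕ, ‖mk1 k‖ ^ 2) * ‖x‖ := by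
  have h := Real.inner_le_Lp_mul_Lq_tsum_of_nonneg (p := 2) (q := 2) Real.HolderConjugate.two_two
    (f := fun k => ‖mk1 k‖) (g := fun k => ‖x.co k‖) (fun _ => norm_nonneg _) (fun _ => norm_nonneg _)
    (by simpa using summable_mk1_sq) (by simpa using x.hasSum_sq.summable)
  have h' := Real.summable_mul_of_Lp_Lq_of_nonneg (p := 2) (q := 2) Real.HolderConjugate.two_two
    (f := fun k => ‖mk1 k‖) (g := fun k => ‖x.co k‖) (fun _ => norm_nonneg _) (fun _ => norm_nonneg _)
    (by simpa using summable_mk1_sq) (by simpa using x.hasSum_sq.summable)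
  refine ⟨h', h.trans ?_⟩
  have h2 : ∑' k, ‖x.co k‖ ^ 2 = ‖x‖ ^ 2 := x.hasSum_sq.tsum_eq
  simp only [Real.rpow_ofNat]
  rw [h2, ← Real.sqrt_eq_rpow, ← Real.sqrt_eq_rpow, Real.sqrt_sq (norm_nonneg _)]

lemma XSp.summ (x : XSp A) : Summable (fun k : ℕ => fA ((k : ℤ) + 1) (mk1 k • x.co k)) := by
  refine Summable.of_norm_bounded x.hol.1 (fun k => ?_)
  exact (norm_fA _ _).trans (norm_smul _ _).le

/-- The primitive, as continuous function. -/
noncomputable def iotal : XSp A →L[ℂ] C(TT, A) :=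
  LinearMap.mkContinuous
    { toFun := fun x => ∑' k : ℕ, fA ((k : ℤ) + 1) (mk1 k • x.co k)
      map_add' := by
        intro x y
        rw [← x.summ.tsum_add y.summ]
        congr 1; ext k t; simp [XSp.co_add]
      map_smul' := by
        intro c x
        simp only [RingHom.id_apply]
        rw [← x.summ.tsum_const_smul c]
        congr 1; ext k t
        simp only [XSp.co_smul, fA_apply, ContinuousMap.smul_apply]
        rw [smul_comm (mk1 k) c, smul_comm _ c] }
    (Real.sqrt (∑' k : ℕ, ‖mk1 k‖ ^ 2)) (by
      intro x
      refine le_trans ?_ x.hol.2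
      refine tsum_of_norm_bounded x.hol.1.hasSum (fun k => ?_)
      exact (norm_fA _ _).trans (norm_smul _ _).le)

lemma iotal_def (x : XSp A) : iotal x = ∑' k : ℕ, fA ((k : ℤ) + 1) (mk1 k • x.co k) := rfl

lemma iotal_apply (x : XSp A) (t : TT) :
    HasSum (fun k : ℕ => (fourier ((k : ℤ) + 1) t : ℂ) • mk1 k • x.co k) (iotal x t) := by
  have := x.summ.hasSum
  rw [← iotal_def] at this
  have h2 := this.map (ContinuousMap.evalCLM ℂ t : C(TT, A) →L[ℂ] A) (ContinuousLinearMap.continuous _)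
  exact h2

lemma iotal_sg (k : ℕ) (a : A) : iotal (XSp.sg k a) = mk1 k • fA ((k : ℤ) + 1) a := by
  rw [iotal_def, tsum_eq_single k]
  · ext t
    simp only [XSp.co_sg, if_true, fA_apply, ContinuousMap.smul_apply]
    exact smul_comm _ _ _
  · intro j hj; ext t; simp [XSp.co_sg, hj]

end CircleSpaces

/-! part 3 -/
set_option linter.unusedSectionVars false
open Complex Metric MeasureTheory Filter Set

section LiftT
variable {Y Z : Type*} [NormedAddCommGroup Y] [NormedSpace ℝ Y] [NormedAddCommGroup Z] [NormedSpace ℝ Z]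

/-- periodicity in the first variable -/
def PerT (Φ : ℝ × Y → Z) : Prop := ∀ y, Function.Periodic (fun θ => Φ (θ, y)) (2 * Real.pi)

/-- Descend a periodic function to the circle. -/
noncomputable def liftT (Φ : ℝ × Y → Z) (hc : Continuous Φ) (hp : PerT Φ) : C(TT × Y, Z) where
  toFun p := (hp p.2).lift p.1
  continuous_toFun := by
    have hq : IsOpenQuotientMap (Prod.map (QuotientAddGroup.mk : ℝ → TT) (id : Y → Y)) :=
      QuotientAddGroup.isOpenQuotientMap_mk.prodMap IsOpenQuotientMap.id
    rw [hq.isQuotientMap.continuous_iff]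
    exact hc

@[simp] lemma liftT_coe (Φ : ℝ × Y → Z) (hc : Continuous Φ) (hp : PerT Φ) (θ : ℝ) (y : Y) :
    liftT Φ hc hp ((θ : TT), y) = Φ (θ, y) := rfl

/-- derivative in y -/
noncomputable def dY (Φ : ℝ × Y → Z) (p : ℝ × Y) : Y →L[ℝ] Z :=
  (fderiv ℝ Φ p).comp (ContinuousLinearMap.inr ℝ ℝ Y)

/-- derivative in theta -/
noncomputable def dTh (Φ : ℝ × Y → Z) (p : ℝ × Y) : Z := fderiv ℝ Φ p (1, 0)

lemma per_fderiv {Φ : ℝ × Y → Z} (hp : PerT Φ) (θ : ℝ) (y : Y) :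
    fderiv ℝ Φ (θ + 2 * Real.pi, y) = fderiv ℝ Φ (θ, y) := by
  have h1 : (fun p : ℝ × Y => Φ (p + (2 * Real.pi, 0))) = Φ := by
    funext p
    have e : p + (2 * Real.pi, (0 : Y)) = (p.1 + 2 * Real.pi, p.2) := by ext <;> simp
    rw [e]; exact hp p.2 p.1
  have h2 := fderiv_comp_add_right (𝕜 := ℝ) (f := Φ) (x := (θ, y)) (2 * Real.pi, (0 : Y))
  rw [h1] at h2
  rw [h2]; simp

lemma per_dY {Φ : ℝ × Y → Z} (hp : PerT Φ) : PerT (dY Φ) := by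
  intro y θ; simp only [dY]; rw [per_fderiv hp]

lemma per_dTh {Φ : ℝ × Y → Z} (hp : PerT Φ) : PerT (dTh Φ) := by
  intro y θ; simp only [dTh]; rw [per_fderiv hp]

lemma cd_dY {Φ : ℝ × Y → Z} (h : ContDiff ℝ 2 Φ) : ContDiff ℝ 1 (dY Φ) := by
  have := h.fderiv_right (m := 1) (by norm_num)
  unfold dY; fun_prop

lemma cd_dTh {Φ : ℝ × Y → Z} (h : ContDiff ℝ 2 Φ) : ContDiff ℝ 1 (dTh Φ) := by
  have := h.fderiv_right (m := 1) (by norm_num)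
  unfold dTh; fun_prop

lemma c_dY {Φ : ℝ × Y → Z} (h : ContDiff ℝ 1 Φ) : Continuous (dY Φ) := by
  have := h.continuous_fderiv (by norm_num)
  unfold dY; fun_prop

lemma hasFDeriv_dY {Φ : ℝ × Y → Z} (h : ContDiff ℝ 1 Φ) (θ : ℝ) (y : Y) :
    HasFDerivAt (fun y => Φ (θ, y)) (dY Φ (θ, y)) y := by
  have h1 := (h.differentiable (by norm_num) (θ, y)).hasFDerivAt
  exact h1.comp y (hasFDerivAt_prodMk_right θ y)

lemma liftT_hasFDerivAt {Φ : ℝ × Y → Z} (h : ContDiff ℝ 1 Φ) (hp : PerT Φ) (t : TT) (y : Y) :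
    HasFDerivAt (fun y => liftT Φ h.continuous hp (t, y))
      (liftT (dY Φ) (c_dY h) (per_dY hp) (t, y)) y := by
  induction t using QuotientAddGroup.induction_on with
  | H θ => exact hasFDeriv_dY h θ y

lemma nemT_hasFDerivAt {Φ : ℝ × Y → Z} (h : ContDiff ℝ 1 Φ) (hp : PerT Φ) (u : C(TT, Y)) :
    HasFDerivAt (nem (liftT Φ h.continuous hp))
      (mulC (nem (liftT (dY Φ) (c_dY h) (per_dY hp)) u)) u :=
  nem_hasFDerivAt _ _ (liftT_hasFDerivAt h hp) u

lemma nemT_contDiff {Φ : ℝ × Y → Z} (h : ContDiff ℝ 1 Φ) (hp : PerT Φ) :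
    ContDiff ℝ 1 (nem (liftT Φ h.continuous hp)) :=
  nem_contDiff _ _ (liftT_hasFDerivAt h hp)

end LiftT

section MulL2
variable {A B : Type*} [NormedAddCommGroup A] [InnerProductSpace ℂ A] [NormedSpace ℝ A]
  [IsScalarTower ℝ ℂ A] [FiniteDimensional ℂ A]
  [NormedAddCommGroup B] [InnerProductSpace ℂ B] [NormedSpace ℝ B]
  [IsScalarTower ℝ ℂ B] [FiniteDimensional ℂ B]

/-- multiplication of square integrable functions by continuous operator-valued functions -/
noncomputable def mulL2 : C(TT, A →L[ℝ] B) →L[ℝ] Lp A 2 muT →L[ℝ] Lp B 2 muT :=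
  ((ContinuousLinearMap.id ℝ (A →L[ℝ] B)).holderL muT ⊤ 2 2).comp
    (ContinuousMap.toLp (E := A →L[ℝ] B) ⊤ muT ℝ)

lemma mulL2_ae (m : C(TT, A →L[ℝ] B)) (v : Lp A 2 muT) :
    mulL2 m v =ᵐ[muT] fun t => m t (v t) := by
  have h1 := ContinuousLinearMap.coeFn_holder (μ := muT) (p := ⊤) (q := 2) (r := 2)
    (ContinuousLinearMap.id ℝ (A →L[ℝ] B)) (ContinuousMap.toLp (E := A →L[ℝ] B) ⊤ muT ℝ m) v
  have h2 := ContinuousMap.coeFn_toLp (p := ⊤) (𝕜 := ℝ) muT m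
  filter_upwards [h1, h2] with t h1 h2
  change (((ContinuousLinearMap.id ℝ (A →L[ℝ] B)).holder 2
    (ContinuousMap.toLp (E := A →L[ℝ] B) ⊤ muT ℝ m) v) t) = _
  rw [h1, h2]; rfl

lemma mulL2_toL2 (m : C(TT, A →L[ℝ] B)) (u : C(TT, A)) :
    mulL2 m (toL2 u) = toL2 (mulC m u) := by
  apply Lp.ext
  filter_upwards [mulL2_ae m (toL2 u), ContinuousMap.coeFn_toLp (p := 2) (𝕜 := ℂ) muT u,
    ContinuousMap.coeFn_toLp (p := 2) (𝕜 := ℂ) muT (mulC m u)] with t h1 h2 h3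
  rw [h1, h2, h3]; rfl

/-- real-linear version of toL2 -/
noncomputable def toL2R : C(TT, A) →L[ℝ] Lp A 2 muT := ContinuousMap.toLp (E := A) 2 muT ℝ

lemma toL2R_eq (u : C(TT, A)) : toL2R u = toL2 u := rfl

/-- real version of U -/
noncomputable def UR : XSp A →L[ℝ] Lp A 2 muT :=
  haveI : CompleteSpace A := FiniteDimensional.complete ℂ A
  (UXl (A := A)).toContinuousLinearMap.restrictScalars ℝ

/-- real version of iota -/
noncomputable def iR : XSp A →L[ℝ] C(TT, A) :=
  haveI : CompleteSpace A := FiniteDimensional.complete ℂ A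
  (iotal (A := A)).restrictScalars ℝ

lemma UR_sg (k : ℕ) (a : A) : UR (XSp.sg k a) = toL2 (fA ((k : ℤ) + 1) a) := by
  haveI : CompleteSpace A := FiniteDimensional.complete ℂ A
  exact UXl_sg k a

lemma iR_sg (k : ℕ) (a : A) : iR (XSp.sg k a) = mk1 k • fA ((k : ℤ) + 1) a := by
  haveI : CompleteSpace A := FiniteDimensional.complete ℂ A
  exact iotal_sg k a

lemma norm_UR (x : XSp A) : ‖UR x‖ = ‖x‖ := by
  haveI : CompleteSpace A := FiniteDimensional.complete ℂ A
  exact (UXl (A := A)).norm_map x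

lemma iR_apply (x : XSp A) (t : TT) :
    HasSum (fun k : ℕ => (fourier ((k : ℤ) + 1) t : ℂ) • mk1 k • x.co k) (iR x t) := by
  haveI : CompleteSpace A := FiniteDimensional.complete ℂ A
  exact iotal_apply x t

/-- The real inner product on `L²`. -/
noncomputable def reIn : Lp A 2 muT →L[ℝ] Lp A 2 muT →L[ℝ] ℝ :=
  LinearMap.mkContinuous₂
    (LinearMap.mk₂ ℝ (fun v w : Lp A 2 muT => (inner ℂ v w : ℂ).re)
      (by intros; simp [inner_add_left])
      (by
        intro c v w
        rw [← algebraMap_smul ℂ c v, inner_smul_left]; simp)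
      (by intros; simp [inner_add_right])
      (by
        intro c v w
        rw [← algebraMap_smul ℂ c w, inner_smul_right]; simp))
    1 (by
      intro v w
      simp only [LinearMap.mk₂_apply, one_mul]
      exact (Complex.abs_re_le_norm _).trans (norm_inner_le_norm _ _))

lemma reIn_apply (v w : Lp A 2 muT) : reIn v w = (inner ℂ v w : ℂ).re := rfl

end MulL2

/-! part 4 -/
set_option linter.unusedSectionVars false
open Complex Metric MeasureTheory Filter Set

section CalN
variable {P A B : Type*} [NormedAddCommGroup P] [NormedSpace ℝ P]
  [NormedAddCommGroup A] [InnerProductSpace ℂ A] [NormedSpace ℝ A]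
  [IsScalarTower ℝ ℂ A] [FiniteDimensional ℂ A]
  [NormedAddCommGroup B] [InnerProductSpace ℂ B] [NormedSpace ℝ B]
  [IsScalarTower ℝ ℂ B] [FiniteDimensional ℂ B]

/-- The substituted function `(δ, ι x)`. -/
noncomputable def uu : P × XSp A →L[ℝ] C(TT, P × A) :=
  LinearMap.mkContinuous
    { toFun := fun q => (ContinuousMap.const TT q.1).prodMk (iR q.2)
      map_add' := by intro a b; ext t <;> simp
      map_smul' := by intro a b; ext t <;> simp }
    (1 + ‖iR (A := A)‖) (by
      intro q
      rw [ContinuousMap.norm_le _ (by positivity)]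
      intro t
      have h1 : ‖q.1‖ ≤ ‖q‖ := norm_fst_le q
      have h2 : ‖iR q.2 t‖ ≤ ‖iR (A := A)‖ * ‖q‖ :=
        ((iR q.2).norm_coe_le_norm t).trans ((iR (A := A)).le_of_opNorm_le_of_le le_rfl (norm_snd_le q))
      change ‖(q.1, iR q.2 t)‖ ≤ _
      rw [Prod.norm_def]
      have h3 : 0 ≤ ‖iR (A := A)‖ * ‖q‖ := by positivity
      apply max_le
      · simp only; nlinarith [norm_nonneg q]
      · simp only; nlinarith [norm_nonneg q])

@[simp] lemma uu_apply (q : P × XSp A) (t : TT) : uu q t = (q.1, iR q.2 t) := rfl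

/-- derivative in A -/
noncomputable def dA (Φ : ℝ × (P × A) → B) (p : ℝ × (P × A)) : A →L[ℝ] B :=
  (dY Φ p).comp (ContinuousLinearMap.inr ℝ P A)

lemma per_dA {Φ : ℝ × (P × A) → B} (hp : PerT Φ) : PerT (dA Φ) := by
  intro y θ
  have := per_dY hp y θ
  simp only [dA] at this ⊢; rw [this]

lemma cd_dA {Φ : ℝ × (P × A) → B} (h : ContDiff ℝ 2 Φ) : ContDiff ℝ 1 (dA Φ) := by
  have := cd_dY h
  unfold dA; fun_prop

/-- substitution operator -/
noncomputable def NN0 (Φ : ℝ × (P × A) → B) (h : ContDiff ℝ 2 Φ) (hp : PerT Φ) (q : P × XSp A) :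
    C(TT, B) := nem (liftT Φ h.continuous hp) (uu q)

/-- derivative of substitution operator -/
noncomputable def NN1 (Φ : ℝ × (P × A) → B) (h : ContDiff ℝ 2 Φ) (hp : PerT Φ) (q : P × XSp A) :
    Lp B 2 muT := toL2R (nem (liftT (dTh Φ) (cd_dTh h).continuous (per_dTh hp)) (uu q)) +
      mulL2 (nem (liftT (dA Φ) (cd_dA h).continuous (per_dA hp)) (uu q)) (UR q.2)

lemma NN0_contDiff (Φ : ℝ × (P × A) → B) (h : ContDiff ℝ 2 Φ) (hp : PerT Φ) :
    ContDiff ℝ 1 (NN0 Φ h hp) := by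
  unfold NN0
  have hu : ContDiff ℝ 1 (uu (P := P) (A := A)) := ContinuousLinearMap.contDiff _
  exact (nemT_contDiff (h.of_le (by norm_num)) hp).comp hu

lemma NN1_contDiff (Φ : ℝ × (P × A) → B) (h : ContDiff ℝ 2 Φ) (hp : PerT Φ) :
    ContDiff ℝ 1 (NN1 Φ h hp) := by
  unfold NN1
  refine ContDiff.add ?_ ?_
  · exact toL2R.contDiff.comp ((nemT_contDiff (cd_dTh h) (per_dTh hp)).comp uu.contDiff)
  · refine ContDiff.clm_apply ?_ ?_
    · exact mulL2.contDiff.comp ((nemT_contDiff (cd_dA h) (per_dA hp)).comp uu.contDiff)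
    · exact (UR.comp (ContinuousLinearMap.snd ℝ P (XSp A))).contDiff

@[simp] lemma NN0_coe (Φ : ℝ × (P × A) → B) (h : ContDiff ℝ 2 Φ) (hp : PerT Φ) (q : P × XSp A) (θ : ℝ) :
    NN0 Φ h hp q (θ : TT) = Φ (θ, (q.1, iR q.2 (θ : TT))) := rfl

lemma integral_TT {E : Type*} [NormedAddCommGroup E] [NormedSpace ℝ E] (F : TT → E) :
    ∫ t, F t ∂muT = (1 / (2 * Real.pi)) • ∫ θ in (0 : ℝ)..(2 * Real.pi), F (θ : TT) := by
  have h1 := AddCircle.integral_haarAddCircle (T := 2 * Real.pi) (f := F)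
  rw [h1, ← AddCircle.intervalIntegral_preimage (2 * Real.pi) 0 F]
  simp

/-- integration by parts for periodic functions -/
lemma ibp_coeff (W w : C(TT, B)) (hW : ∀ θ : ℝ, HasDerivAt (fun θ : ℝ => W (θ : TT)) (w (θ : TT)) θ)
    (j : ℤ) (b : B) :
    inner ℂ (toL2 (fA j b)) (toL2 w) = (I * j) * inner ℂ (toL2 (fA j b)) (toL2 W) := by
  rw [inner_toL2, inner_toL2, ← integral_const_mul, ← sub_eq_zero, ← integral_sub]
  rotate_left
  · apply Continuous.integrable_of_hasCompactSupport (by fun_prop) (HasCompactSupport.of_compactSpace _)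
  · apply Continuous.integrable_of_hasCompactSupport (by fun_prop) (HasCompactSupport.of_compactSpace _)
  rw [integral_TT]
  have hd : ∀ θ : ℝ, HasDerivAt (fun θ : ℝ => (inner ℂ (fA j b (θ : TT)) (W (θ : TT)) : ℂ))
      (inner ℂ (fA j b (θ : TT)) (w (θ : TT)) - I * j * inner ℂ (fA j b (θ : TT)) (W (θ : TT))) θ := by
    intro θ
    have h1 : HasDerivAt (fun θ : ℝ => fA j b (θ : TT)) ((I * j) • fA j b (θ : TT)) θ := by
      have := (hasDerivAt_fourier (2 * Real.pi) j θ).smul_const b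
      refine this.congr_deriv ?_
      rw [fA_apply, smul_smul]
      congr 2
      push_cast
      field_simp
    have h2 := h1.inner ℂ (hW θ)
    refine h2.congr_deriv ?_
    rw [inner_smul_left]
    simp only [map_mul, Complex.conj_I, map_intCast]; ring
  rw [intervalIntegral.integral_eq_sub_of_hasDerivAt (fun θ _ => hd θ)]
  · have : ((2 * Real.pi : ℝ) : TT) = ((0 : ℝ) : TT) := by simp
    rw [this]; simp
  · apply Continuous.intervalIntegrable
    have hc : Continuous (fun θ : ℝ => (θ : TT)) := AddCircle.continuous_mk' _
    fun_prop

lemma hasDerivAt_fA (j : ℤ) (b : B) (θ : ℝ) :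
    HasDerivAt (fun θ : ℝ => fA j b (θ : TT)) ((I * j) • fA j b (θ : TT)) θ := by
  have := (hasDerivAt_fourier (2 * Real.pi) j θ).smul_const b
  refine this.congr_deriv ?_
  rw [fA_apply, smul_smul]
  congr 2
  push_cast
  field_simp

lemma mk1_mul (k : ℕ) : mk1 k * (I * (((k : ℤ) + 1 : ℤ) : ℂ)) = 1 := by
  unfold mk1
  push_cast
  apply inv_mul_cancel₀
  apply mul_ne_zero I_ne_zero
  exact_mod_cast Nat.succ_ne_zero k

lemma NN1_compat_fin (Φ : ℝ × (P × A) → B) (h : ContDiff ℝ 2 Φ) (hp : PerT Φ) (δ : P)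
    (s : Finset ℕ) (a : ℕ → A) (j : ℤ) (b : B) :
    inner ℂ (toL2 (fA j b)) (NN1 Φ h hp (δ, ∑ k ∈ s, XSp.sg k (a k))) =
      (I * j) * inner ℂ (toL2 (fA j b)) (toL2 (NN0 Φ h hp (δ, ∑ k ∈ s, XSp.sg k (a k)))) := by
  set x : XSp A := ∑ k ∈ s, XSp.sg k (a k) with hx
  set v : C(TT, A) := ∑ k ∈ s, fA ((k : ℤ) + 1) (a k) with hv
  have hU : UR x = toL2 v := by
    rw [hx, hv, map_sum]
    refine Eq.trans ?_ (map_sum (ContinuousMap.toLp (E := A) 2 muT ℂ) _ _).symm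
    exact Finset.sum_congr rfl fun k _ => UR_sg k (a k)
  have hi : ∀ t, iR x t = ∑ k ∈ s, mk1 k • fA ((k : ℤ) + 1) (a k) t := by
    intro t
    rw [hx, map_sum, ContinuousMap.sum_apply]
    exact Finset.sum_congr rfl fun k _ => by rw [iR_sg]; rfl
  have hid : ∀ θ : ℝ, HasDerivAt (fun θ : ℝ => iR x (θ : TT)) (v (θ : TT)) θ := by
    intro θ
    have h1 : HasDerivAt (fun θ : ℝ => ∑ k ∈ s, mk1 k • fA ((k : ℤ) + 1) (a k) (θ : TT))
        (∑ k ∈ s, mk1 k • ((I * (((k : ℤ) + 1 : ℤ) : ℂ)) • fA ((k : ℤ) + 1) (a k) (θ : TT))) θ :=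
      HasDerivAt.fun_sum fun k _ => (hasDerivAt_fA _ (a k) θ).const_smul (mk1 k)
    have e : (fun θ : ℝ => iR x (θ : TT)) =
        fun θ : ℝ => ∑ k ∈ s, mk1 k • fA ((k : ℤ) + 1) (a k) (θ : TT) := by
      funext θ; exact hi _
    rw [e]
    refine h1.congr_deriv ?_
    rw [hv, ContinuousMap.sum_apply]
    refine Finset.sum_congr rfl fun k _ => ?_
    rw [smul_smul, mk1_mul, one_smul]
  have hN1 : NN1 Φ h hp (δ, x) = toL2 (nem (liftT (dTh Φ) (cd_dTh h).continuous (per_dTh hp)) (uu (δ, x)) +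
      mulC (nem (liftT (dA Φ) (cd_dA h).continuous (per_dA hp)) (uu (δ, x))) v) := by
    unfold NN1
    simp only
    rw [hU, mulL2_toL2, toL2R_eq, ← map_add]
  rw [hN1]
  apply ibp_coeff
  intro θ
  have hp1 : HasDerivAt (fun θ : ℝ => (θ, (δ, iR x (θ : TT)))) ((1 : ℝ), ((0 : P), v (θ : TT))) θ :=
    (hasDerivAt_id θ).prodMk ((hasDerivAt_const θ δ).prodMk (hid θ))
  have hp2 := ((h.differentiable (by norm_num)) (θ, (δ, iR x (θ : TT)))).hasFDerivAt.comp_hasDerivAt θ hp1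
  refine hp2.congr_deriv ?_
  change _ = dTh Φ (θ, (δ, iR x (θ : TT))) + dA Φ (θ, (δ, iR x (θ : TT))) (v (θ : TT))
  simp only [dTh, dA, dY, ContinuousLinearMap.comp_apply, ContinuousLinearMap.inr_apply]
  rw [← map_add]
  simp

lemma NN1_compat (Φ : ℝ × (P × A) → B) (h : ContDiff ℝ 2 Φ) (hp : PerT Φ) (q : P × XSp A)
    (j : ℤ) (b : B) :
    inner ℂ (toL2 (fA j b)) (NN1 Φ h hp q) =
      (I * j) * inner ℂ (toL2 (fA j b)) (toL2 (NN0 Φ h hp q)) := by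
  obtain ⟨δ, x⟩ := q
  have hc1 : Continuous fun x : XSp A => inner ℂ (toL2 (fA j b)) (NN1 Φ h hp (δ, x)) := by
    have := (NN1_contDiff Φ h hp).continuous
    fun_prop
  have hc2 : Continuous fun x : XSp A =>
      (I * j) * inner ℂ (toL2 (fA j b)) (toL2 (NN0 Φ h hp (δ, x))) := by
    have := (NN0_contDiff Φ h hp).continuous
    fun_prop
  have hx := x.hasSum_sg
  have l1 := (hc1.tendsto x).comp hx
  have l2 := (hc2.tendsto x).comp hx
  refine tendsto_nhds_unique l1 (l2.congr ?_)
  intro s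
  exact (NN1_compat_fin Φ h hp δ s (fun k => x.co k) j b).symm

end CalN

/-! part 5 -/
set_option linter.unusedSectionVars false
open Complex Metric MeasureTheory Filter Set

section Quad
variable {A : Type*} [NormedAddCommGroup A] [InnerProductSpace ℂ A] [NormedSpace ℝ A]
  [IsScalarTower ℝ ℂ A] [FiniteDimensional ℂ A]

/-- l as operator on L² -/
noncomputable def lD2 (l : A →L[ℂ] ℂ) : Lp A 2 muT →L[ℝ] Lp ℂ 2 muT :=
  (l.restrictScalars ℝ).compLpL 2 muT

/-- conjugate of l as operator on L² -/
noncomputable def lD1 (l : A →L[ℂ] ℂ) : Lp A 2 muT →L[ℝ] Lp ℂ 2 muT :=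
  ((conjCLE : ℂ →L[ℝ] ℂ).comp (l.restrictScalars ℝ)).compLpL 2 muT

lemma lD2_ae (l : A →L[ℂ] ℂ) (v : Lp A 2 muT) : lD2 l v =ᵐ[muT] fun t => l (v t) :=
  ContinuousLinearMap.coeFn_compLpL _ v

lemma lD1_ae (l : A →L[ℂ] ℂ) (v : Lp A 2 muT) :
    lD1 l v =ᵐ[muT] fun t => starRingEnd ℂ (l (v t)) :=
  ContinuousLinearMap.coeFn_compLpL _ v

lemma lD2_fA (l : A →L[ℂ] ℂ) (j : ℤ) (a : A) : lD2 l (toL2 (fA j a)) = toL2 (fA j (l a)) := by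
  apply Lp.ext
  filter_upwards [lD2_ae l (toL2 (fA j a)), ContinuousMap.coeFn_toLp (p := 2) (𝕜 := ℂ) muT (fA j a),
    ContinuousMap.coeFn_toLp (p := 2) (𝕜 := ℂ) muT (fA j (l a))] with t h1 h2 h3
  rw [h1, h2, h3, fA_apply, fA_apply, map_smul]

lemma lD1_fA (l : A →L[ℂ] ℂ) (j : ℤ) (a : A) :
    lD1 l (toL2 (fA j a)) = toL2 (fA (-j) (starRingEnd ℂ (l a))) := by
  apply Lp.ext
  filter_upwards [lD1_ae l (toL2 (fA j a)), ContinuousMap.coeFn_toLp (p := 2) (𝕜 := ℂ) muT (fA j a),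
    ContinuousMap.coeFn_toLp (p := 2) (𝕜 := ℂ) muT (fA (-j) (starRingEnd ℂ (l a)))] with t h1 h2 h3
  rw [h1, h2, h3, fA_apply, fA_apply, map_smul, fourier_neg, smul_eq_mul, smul_eq_mul, map_mul]

lemma lQ_zero (l : A →L[ℂ] ℂ) (W : XSp A →L[ℝ] Lp A 2 muT) (c : ℕ → ℂ)
    (hW : ∀ k a, W (XSp.sg k a) = toL2 (fA ((k : ℤ) + 1) (c k • a))) (x y : XSp A) :
    reIn (lD1 l (W x)) (lD2 l (W y)) = 0 := by
  have key : ∀ k a j b, reIn (lD1 l (W (XSp.sg k a))) (lD2 l (W (XSp.sg j b))) = 0 := by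
    intro k a j b
    rw [hW, hW, lD1_fA, lD2_fA, reIn_apply, inner_fA, if_neg (by omega)]; simp
  have k2 : ∀ k a, reIn (lD1 l (W (XSp.sg k a))) (lD2 l (W y)) = 0 := by
    intro k a
    have h := (((reIn (lD1 l (W (XSp.sg k a)))).comp (lD2 l)).comp W).hasSum y.hasSum_sg
    simp only [ContinuousLinearMap.comp_apply, key] at h
    exact h.unique hasSum_zero
  have h := (((reIn.flip (lD2 l (W y))).comp (lD1 l)).comp W).hasSum x.hasSum_sg
  simp only [ContinuousLinearMap.comp_apply, ContinuousLinearMap.flip_apply, k2] at h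
  exact h.unique hasSum_zero

lemma reIn_int (v w : Lp A 2 muT) :
    reIn v w = ∫ t, (inner ℂ (v t) (w t) : ℂ).re ∂muT := by
  rw [reIn_apply, L2.inner_def]
  exact (integral_re (𝕜 := ℂ) (L2.integrable_inner (𝕜 := ℂ) v w)).symm

lemma quad_ge (l : A →L[ℂ] ℂ) (m : C(TT, A →L[ℝ] A)) (c c0 : ℝ)
    (hco : ∀ t a, c * ‖a‖ ^ 2 + c0 * ((l a) ^ 2).re ≤ (inner ℂ (m t a) a : ℂ).re) (v : Lp A 2 muT) :
    c * ‖v‖ ^ 2 + c0 * reIn (lD1 l v) (lD2 l v) ≤ reIn (mulL2 m v) v := by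
  have e1 : ‖v‖ ^ 2 = ∫ t, ‖v t‖ ^ 2 ∂muT := by
    have := inner_self_eq_norm_sq (𝕜 := ℂ) v
    rw [← this, L2.inner_def]
    have h2 := integral_re (𝕜 := ℂ) (L2.integrable_inner (𝕜 := ℂ) v v)
    rw [← h2]
    exact integral_congr_ae (Eventually.of_forall fun t => inner_self_eq_norm_sq (𝕜 := ℂ) (v t))
  have i1 : Integrable (fun t => ‖v t‖ ^ 2) muT := (Lp.memLp v).norm.integrable_sq
  have i2 : Integrable (fun t => (inner ℂ (lD1 l v t) (lD2 l v t) : ℂ).re) muT :=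
    (L2.integrable_inner (𝕜 := ℂ) (lD1 l v) (lD2 l v)).re
  have i3 : Integrable (fun t => (inner ℂ (mulL2 m v t) (v t) : ℂ).re) muT :=
    (L2.integrable_inner (𝕜 := ℂ) (mulL2 m v) v).re
  rw [e1, reIn_int, reIn_int, ← integral_const_mul, ← integral_const_mul, ← integral_add (i1.const_mul c) (i2.const_mul c0)]
  apply integral_mono_ae ((i1.const_mul c).add (i2.const_mul c0)) i3
  filter_upwards [lD1_ae l v, lD2_ae l v, mulL2_ae m v] with t h1 h2 h3
  have := hco t (v t)
  have e : (inner ℂ (lD1 l v t) (lD2 l v t) : ℂ) = (l (v t)) ^ 2 := by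
    rw [h1, h2, RCLike.inner_apply, sq]; simp
  simp only [h3, Pi.add_apply]
  rw [e]
  exact this

end Quad

section ThmA

lemma toL2_smul {A : Type*} [NormedAddCommGroup A] [InnerProductSpace ℂ A] (c : ℂ) (u : C(TT, A)) :
    toL2 (c • u) = c • toL2 u := map_smul _ _ _

variable {P A : Type*} [NormedAddCommGroup P] [NormedSpace ℝ P] [CompleteSpace P]
  [NormedAddCommGroup A] [InnerProductSpace ℂ A] [NormedSpace ℝ A]
  [IsScalarTower ℝ ℂ A] [FiniteDimensional ℂ A]

/-- linearisation symbol -/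
noncomputable def mSym (Φ : ℝ × (P × A) → A) (h : ContDiff ℝ 2 Φ) (hp : PerT Φ) : C(TT, A →L[ℝ] A) :=
  nem (liftT (dA Φ) (cd_dA h).continuous (per_dA hp)) (uu 0)

lemma c_dA {B : Type*} [NormedAddCommGroup B] [InnerProductSpace ℂ B] [NormedSpace ℝ B]
    {Φ : ℝ × (P × A) → B} (h : ContDiff ℝ 1 Φ) : Continuous (dA Φ) := by
  have := c_dY h
  unfold dA; fun_prop

/-- derivative of linearisation symbol -/
noncomputable def mSymTh (Φ : ℝ × (P × A) → A) (h : ContDiff ℝ 2 Φ) (hp : PerT Φ) : C(TT, A →L[ℝ] A) :=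
  nem (liftT (dA (dTh Φ)) (c_dA (cd_dTh h)) (per_dA (per_dTh hp))) (uu 0)

lemma nemT_uu_deriv {Φ : ℝ × (P × A) → A} (h : ContDiff ℝ 1 Φ) (hp : PerT Φ) (x : XSp A) :
    mulC (nem (liftT (dY Φ) (c_dY h) (per_dY hp)) (uu 0)) (uu ((0 : P), x)) =
    mulC (nem (liftT (dA Φ) (c_dA h) (per_dA hp)) (uu 0)) (iR x) := by
  ext t
  induction t using QuotientAddGroup.induction_on with
  | H θ => rfl

lemma NN0_deriv (Φ : ℝ × (P × A) → A) (h : ContDiff ℝ 2 Φ) (hp : PerT Φ) (x : XSp A) :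
    fderiv ℝ (NN0 Φ h hp) 0 (0, x) = mulC (mSym Φ h hp) (iR x) := by
  have h1 : ContDiff ℝ 1 Φ := h.of_le (by norm_num)
  have hd : HasFDerivAt (NN0 Φ h hp) _ 0 :=
    (nemT_hasFDerivAt h1 hp (uu (0 : P × XSp A))).comp (0 : P × XSp A) (uu (P := P) (A := A)).hasFDerivAt
  rw [hd.fderiv]
  exact nemT_uu_deriv h1 hp x

lemma NN1_deriv (Φ : ℝ × (P × A) → A) (h : ContDiff ℝ 2 Φ) (hp : PerT Φ) (x : XSp A) :
    fderiv ℝ (NN1 Φ h hp) 0 (0, x) =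
      toL2R (mulC (mSymTh Φ h hp) (iR x)) + mulL2 (mSym Φ h hp) (UR x) := by
  have hd1 : HasFDerivAt (fun q : P × XSp A =>
      toL2R (nem (liftT (dTh Φ) (cd_dTh h).continuous (per_dTh hp)) (uu q))) _ 0 :=
    (toL2R (A := A)).hasFDerivAt.comp (0 : P × XSp A)
      ((nemT_hasFDerivAt (cd_dTh h) (per_dTh hp) (uu (0 : P × XSp A))).comp (0 : P × XSp A) (uu (P := P) (A := A)).hasFDerivAt)
  have hd2 : HasFDerivAt (fun q : P × XSp A =>
      mulL2 (nem (liftT (dA Φ) (cd_dA h).continuous (per_dA hp)) (uu q))) _ 0 :=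
    (mulL2 (A := A) (B := A)).hasFDerivAt.comp (0 : P × XSp A)
      ((nemT_hasFDerivAt (cd_dA h) (per_dA hp) (uu (0 : P × XSp A))).comp (0 : P × XSp A) (uu (P := P) (A := A)).hasFDerivAt)
  have hd3 : HasFDerivAt (fun q : P × XSp A => UR q.2) (UR.comp (ContinuousLinearMap.snd ℝ P (XSp A))) 0 :=
    (UR.comp (ContinuousLinearMap.snd ℝ P (XSp A))).hasFDerivAt
  have hd : HasFDerivAt (NN1 Φ h hp) _ 0 := hd1.add (hd2.clm_apply hd3)
  rw [hd.fderiv]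
  simp only [add_apply, ContinuousLinearMap.comp_apply,
    Prod.snd_zero, map_zero, add_zero, ContinuousLinearMap.coe_snd']
  have e := nemT_uu_deriv (cd_dTh h) (per_dTh hp) x
  simp only [map_zero] at e
  rw [e]
  simp only [mSym, mSymTh, map_zero]

/-- pairing operator 0 -/
noncomputable def Lp0 : C(TT, A) →L[ℝ] (XSp A →L[ℝ] ℝ) :=
  (((ContinuousLinearMap.compL ℝ (XSp A) (Lp A 2 muT) ℝ).flip (toL2R.comp iR)).comp reIn).comp toL2R

/-- pairing operator 1 -/
noncomputable def Lp1 : Lp A 2 muT →L[ℝ] (XSp A →L[ℝ] ℝ) :=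
  ((ContinuousLinearMap.compL ℝ (XSp A) (Lp A 2 muT) ℝ).flip UR).comp reIn

lemma Lp0_apply (u : C(TT, A)) (y : XSp A) : Lp0 u y = reIn (toL2 u) (toL2 (iR y)) := rfl
lemma Lp1_apply (u : Lp A 2 muT) (y : XSp A) : Lp1 u y = reIn u (UR y) := rfl

/-- The weak equation. -/
noncomputable def psi (C : ℝ) (Φ : ℝ × (P × A) → A) (h : ContDiff ℝ 2 Φ) (hp : PerT Φ)
    (q : P × XSp A) : XSp A →L[ℝ] ℝ := (C • Lp0) (NN0 Φ h hp q) + Lp1 (NN1 Φ h hp q)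

lemma psi_contDiff (C : ℝ) (Φ : ℝ × (P × A) → A) (h : ContDiff ℝ 2 Φ) (hp : PerT Φ) :
    ContDiff ℝ 1 (psi C Φ h hp) :=
  ((C • Lp0).contDiff.comp (NN0_contDiff Φ h hp)).add (Lp1.contDiff.comp (NN1_contDiff Φ h hp))

lemma psi_deriv (C : ℝ) (Φ : ℝ × (P × A) → A) (h : ContDiff ℝ 2 Φ) (hp : PerT Φ) (x y : XSp A) :
    fderiv ℝ (psi C Φ h hp) 0 (0, x) y =
      C * reIn (mulL2 (mSym Φ h hp) (toL2 (iR x))) (toL2 (iR y)) +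
      reIn (toL2 (mulC (mSymTh Φ h hp) (iR x)) + mulL2 (mSym Φ h hp) (UR x)) (UR y) := by
  have d0 := ((NN0_contDiff Φ h hp).differentiable (by norm_num) 0).hasFDerivAt
  have d1 := ((NN1_contDiff Φ h hp).differentiable (by norm_num) 0).hasFDerivAt
  have hd : HasFDerivAt (psi C Φ h hp) _ 0 :=
    ((C • Lp0).hasFDerivAt.comp (0 : P × XSp A) d0).add (Lp1.hasFDerivAt.comp (0 : P × XSp A) d1)
  rw [hd.fderiv]
  simp only [add_apply, ContinuousLinearMap.comp_apply, NN0_deriv, NN1_deriv,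
    smul_apply, Lp0_apply, Lp1_apply, smul_eq_mul, mulL2_toL2, toL2R_eq]

lemma mulC_L2_bound (m : C(TT, A →L[ℝ] A)) :
    ∃ D : ℝ, 0 ≤ D ∧ ∀ u : C(TT, A), ‖toL2 (mulC m u)‖ ≤ D * ‖toL2 u‖ := by
  refine ⟨‖mulL2 m‖, norm_nonneg _, fun u => ?_⟩
  rw [← mulL2_toL2]
  exact (mulL2 m).le_opNorm _

theorem thmA (Φ : ℝ × (P × A) → A) (h : ContDiff ℝ 2 Φ) (hp : PerT Φ) (c c0 : ℝ) (hc : 0 < c)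
    (l : A →L[ℂ] ℂ)
    (hco : ∀ θ a, c * ‖a‖ ^ 2 + c0 * ((l a) ^ 2).re ≤ (inner ℂ (dA Φ (θ, 0) a) a : ℂ).re)
    (h0 : ∀ (k : ℕ) b, inner ℂ (toL2 (fA ((k : ℤ) + 1) b)) (toL2 (NN0 Φ h hp 0)) = 0) :
    ∃ X : P → XSp A, X 0 = 0 ∧ ContDiffAt ℝ 1 X 0 ∧
      ∀ᶠ δ in nhds 0, ∀ (k : ℕ) b,
        inner ℂ (toL2 (fA ((k : ℤ) + 1) b)) (toL2 (NN0 Φ h hp (δ, X δ))) = 0 := by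
  have hA : CompleteSpace A := FiniteDimensional.complete ℂ A
  obtain ⟨D, hD, hDb⟩ := mulC_L2_bound (mSymTh Φ h hp)
  have hco' : ∀ t a, c * ‖a‖ ^ 2 + c0 * ((l a) ^ 2).re ≤ (inner ℂ (mSym Φ h hp t a) a : ℂ).re := by
    intro t a
    induction t using QuotientAddGroup.induction_on with
    | H θ =>
      have := hco θ a
      convert this using 5
      change dA Φ (θ, uu 0 (θ : TT)) = _
      rw [map_zero]; rfl
  set C : ℝ := D ^ 2 / c ^ 2 + 1 with hC
  have hCpos : 0 < C := by positivity
  -- coercivity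
  let T : XSp A →L[ℝ] XSp A →L[ℝ] ℝ := (fderiv ℝ (psi C Φ h hp) 0) ∘L (.inr ℝ P (XSp A))
  have hT : ∀ x y, T x y = C * reIn (mulL2 (mSym Φ h hp) (toL2 (iR x))) (toL2 (iR y)) +
      reIn (toL2 (mulC (mSymTh Φ h hp) (iR x)) + mulL2 (mSym Φ h hp) (UR x)) (UR y) :=
    fun x y => psi_deriv C Φ h hp x y
  have hcoer : IsCoercive T := by
    refine ⟨c / 2, by positivity, fun x => ?_⟩
    rw [hT]
    have q1 := quad_ge l (mSym Φ h hp) c c0 hco' (toL2 (iR x))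
    have q2 := quad_ge l (mSym Φ h hp) c c0 hco' (UR x)
    have z1 : reIn (lD1 l (toL2 (iR x))) (lD2 l (toL2 (iR x))) = 0 := by
      refine lQ_zero l (toL2R.comp iR) mk1 (fun k a => ?_) x x
      change toL2 (iR (XSp.sg k a)) = _
      rw [iR_sg]
      congr 1
      ext t
      simp only [fA_apply, ContinuousMap.smul_apply]; exact smul_comm _ _ _
    have z2 : reIn (lD1 l (UR x)) (lD2 l (UR x)) = 0 := by
      refine lQ_zero l UR (fun _ => 1) (fun k a => ?_) x x
      rw [UR_sg, one_smul]
    rw [z1] at q1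
    rw [z2, norm_UR] at q2
    have q3 : |reIn (toL2 (mulC (mSymTh Φ h hp) (iR x))) (UR x)| ≤ D * ‖toL2 (iR x)‖ * ‖x‖ := by
      rw [reIn_apply]
      refine (Complex.abs_re_le_norm _).trans ((norm_inner_le_norm _ _).trans ?_)
      rw [norm_UR]
      exact mul_le_mul_of_nonneg_right (hDb _) (norm_nonneg _)
    have q4 := (abs_le.1 q3).1
    rw [map_add, add_apply]
    set p := ‖toL2 (iR x)‖ with hpdef
    set s := ‖x‖ with hs
    have q5 : C * (c * p ^ 2) ≤ C * reIn (mulL2 (mSym Φ h hp) (toL2 (iR x))) (toL2 (iR x)) :=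
      mul_le_mul_of_nonneg_left (by linarith) hCpos.le
    have q6 : D * p * s ≤ D ^ 2 / c * p ^ 2 + c / 2 * s ^ 2 := by
      have e : D ^ 2 / c * p ^ 2 + c / 2 * s ^ 2 - D * p * s
        = (2 * (D * p) ^ 2 + (c * s) ^ 2 - 2 * (D * p) * (c * s)) / (2 * c) := by
        field_simp
      have e2 : 0 ≤ (2 * (D * p) ^ 2 + (c * s) ^ 2 - 2 * (D * p) * (c * s)) / (2 * c) := by
        apply div_nonneg _ (by positivity)
        nlinarith [sq_nonneg (D * p - c * s), sq_nonneg (D * p)]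
      linarith
    have q7 : C * (c * p ^ 2) = D ^ 2 / c * p ^ 2 + c * p ^ 2 := by
      rw [hC]; field_simp
    have q8 : 0 ≤ c * p ^ 2 := by positivity
    nlinarith
  have hinv : ((fderiv ℝ (psi C Φ h hp) 0) ∘L (.inr ℝ P (XSp A))).IsInvertible := by
    refine ⟨hcoer.continuousLinearEquivOfBilin.trans
      (InnerProductSpace.toDual ℝ (XSp A)).toContinuousLinearEquiv, ?_⟩
    ext x y
    exact hcoer.continuousLinearEquivOfBilin_apply x y
  -- equivalence of weak equation with vanishing of coefficients
  have hiff : ∀ q, psi C Φ h hp q = 0 ↔ ∀ (k : ℕ) b,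
      inner ℂ (toL2 (fA ((k : ℤ) + 1) b)) (toL2 (NN0 Φ h hp q)) = 0 := by
    intro q
    have hsg : ∀ (k : ℕ) b, psi C Φ h hp q (XSp.sg k b) =
        ((I * (C / (k + 1) + (k + 1))) *
          inner ℂ (toL2 (fA ((k : ℤ) + 1) b)) (toL2 (NN0 Φ h hp q))).re := by
      intro k b
      have c1 : psi C Φ h hp q (XSp.sg k b) = C * reIn (toL2 (NN0 Φ h hp q)) (toL2 (iR (XSp.sg k b)))
        + reIn (NN1 Φ h hp q) (UR (XSp.sg k b)) := rfl
      rw [c1, reIn_apply, reIn_apply, UR_sg, iR_sg, toL2_smul, inner_smul_right,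
        ← inner_conj_symm, ← inner_conj_symm (NN1 Φ h hp q), NN1_compat]
      set ζ : ℂ := inner ℂ (toL2 (fA ((k : ℤ) + 1) b)) (toL2 (NN0 Φ h hp q))
      have e1 : mk1 k * (starRingEnd ℂ) ζ = (starRingEnd ℂ) ((I * (((k : ℝ) + 1)⁻¹ : ℝ)) * ζ) := by
        rw [map_mul, map_mul, Complex.conj_I, Complex.conj_ofReal]
        congr 1
        unfold mk1
        rw [mul_inv, Complex.inv_I]
        push_cast; ring
      rw [e1, Complex.conj_re, Complex.conj_re, ← Complex.re_ofReal_mul, ← Complex.add_re]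
      congr 1
      push_cast
      have : ((k : ℂ) + 1) ≠ 0 := by exact_mod_cast Nat.succ_ne_zero k
      field_simp
    constructor
    · intro hz k b
      have hk : (C / ((k : ℝ) + 1) + (k + 1)) ≠ 0 := by positivity
      have e1 := hsg k b
      have e2 := hsg k (I • b)
      have e3 : inner ℂ (toL2 (fA ((k : ℤ) + 1) (I • b))) (toL2 (NN0 Φ h hp q)) =
          (-I) * inner ℂ (toL2 (fA ((k : ℤ) + 1) b)) (toL2 (NN0 Φ h hp q)) := by
        have : toL2 (fA ((k : ℤ) + 1) (I • b)) = I • toL2 (fA ((k : ℤ) + 1) b) := by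
          rw [← map_smul]; congr 1; ext t
          simp only [fA_apply, ContinuousMap.smul_apply]; exact smul_comm _ _ _
        rw [this, inner_smul_left, Complex.conj_I]
      rw [e3] at e2
      rw [hz] at e1 e2
      set ζ : ℂ := inner ℂ (toL2 (fA ((k : ℤ) + 1) b)) (toL2 (NN0 Φ h hp q))
      have cast1 : (C : ℂ) / (k + 1) + (k + 1) = ((C / ((k : ℝ) + 1) + (k + 1) : ℝ) : ℂ) := by push_cast; rfl
      rw [cast1] at e1 e2
      have f1 : ζ.im = 0 := by
        have : (0 : ℝ) = -((C / ((k : ℝ) + 1) + (k + 1)) * ζ.im) := by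
          have := e1
          rw [show I * ((C / ((k : ℝ) + 1) + (k + 1) : ℝ) : ℂ) * ζ =
            ((C / ((k : ℝ) + 1) + (k + 1) : ℝ) : ℂ) * (I * ζ) by ring,
            Complex.re_ofReal_mul, Complex.I_mul_re] at this
          rw [← mul_neg]
          exact this
        rcases mul_eq_zero.1 (neg_eq_zero.1 this.symm) with g | g
        · exact absurd g hk
        · exact g
      have f2 : ζ.re = 0 := by
        have : (0 : ℝ) = (C / ((k : ℝ) + 1) + (k + 1)) * ζ.re := by
          have := e2
          rw [show I * ((C / ((k : ℝ) + 1) + (k + 1) : ℝ) : ℂ) * (-I * ζ) =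
            ((C / ((k : ℝ) + 1) + (k + 1) : ℝ) : ℂ) * ζ by linear_combination (-((C / ((k : ℝ) + 1) + (k + 1) : ℝ) : ℂ) * ζ) * I_mul_I,
            Complex.re_ofReal_mul] at this
          exact this
        rcases mul_eq_zero.1 this.symm with g | g
        · exact absurd g hk
        · exact g
      exact Complex.ext f2 f1
    · intro hz
      ext y
      have hs := (psi C Φ h hp q).hasSum y.hasSum_sg
      have : ∀ k, psi C Φ h hp q (XSp.sg k (y.co k)) = 0 := by
        intro k; rw [hsg, hz]; simp
      simp only [this] at hs
      exact hs.unique hasSum_zero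
  have hcd : ContDiffAt ℝ 1 (psi C Φ h hp) ((0 : P), (0 : XSp A)) := (psi_contDiff C Φ h hp).contDiffAt
  have hz : psi C Φ h hp ((0 : P), (0 : XSp A)) = 0 := (hiff _).2 h0
  refine ⟨hcd.implicitFunction one_ne_zero hinv, hcd.implicitFunction_apply_self one_ne_zero hinv,
    hcd.contDiffAt_implicitFunction one_ne_zero hinv, ?_⟩
  filter_upwards [hcd.eventually_apply_implicitFunction one_ne_zero hinv] with δ hδ
  rw [hz] at hδ
  exact (hiff _).1 hδ

end ThmA

/-! part 6 -/
set_option linter.unusedSectionVars false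
open Complex Metric MeasureTheory Filter Set

section ThmB

/-- diagonal multiplier -/
noncomputable def diagM (m : ℤ → ℂ) (hm : ∀ j, ‖m j‖ ≤ 1) : Seq2 →L[ℂ] Seq2 :=
  LinearMap.mkContinuous
    { toFun := fun a => ⟨fun j => m j * a j, (lp.memℓp a).mono' fun j => by
        rw [norm_mul]; exact mul_le_of_le_one_left (norm_nonneg _) (hm j)⟩
      map_add' := by intro a b; ext j; exact mul_add _ _ _
      map_smul' := by intro a b; ext j; simp; ring }
    1 (by
      intro a
      rw [one_mul]
      refine lp.norm_mono (by norm_num) fun j => ?_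
      change ‖m j * a j‖ ≤ _
      rw [norm_mul]; exact mul_le_of_le_one_left (norm_nonneg _) (hm j))

lemma diagM_apply (m : ℤ → ℂ) (hm : ∀ j, ‖m j‖ ≤ 1) (a : Seq2) (j : ℤ) :
    diagM m hm a j = m j * a j := rfl

/-- the weight -/
noncomputable def wt (j : ℤ) : ℝ := Real.sqrt (1 + (j : ℝ) ^ 2)

lemma wt_pos (j : ℤ) : 0 < wt j := Real.sqrt_pos.2 (by positivity)
lemma wt_sq (j : ℤ) : wt j ^ 2 = 1 + (j : ℝ) ^ 2 := Real.sq_sqrt (by positivity)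

lemma mult0 (j : ℤ) : ‖((wt j : ℂ))⁻¹‖ ≤ 1 := by
  rw [norm_inv, Complex.norm_real, Real.norm_of_nonneg (wt_pos j).le]
  apply inv_le_one_of_one_le₀
  have := wt_sq j
  nlinarith [wt_pos j, sq_nonneg (j : ℝ)]

lemma mult1 (j : ℤ) : ‖-(I * j) * ((wt j : ℂ))⁻¹‖ ≤ 1 := by
  rw [norm_mul, norm_neg, norm_mul, Complex.norm_I, one_mul, norm_inv, Complex.norm_real,
    Real.norm_of_nonneg (wt_pos j).le, ← div_eq_mul_inv, div_le_one (wt_pos j)]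
  rw [show ((j : ℂ)) = ((j : ℝ) : ℂ) by push_cast; rfl, Complex.norm_real, Real.norm_eq_abs]
  apply abs_le_of_sq_le_sq
  · rw [wt_sq]; linarith
  · exact (wt_pos j).le

lemma repr_coeff (v : Lp ℂ 2 muT) (j : ℤ) :
    (fourierBasis (T := 2 * Real.pi)).repr v j = inner ℂ (toL2 (fA j (1 : ℂ))) v := by
  rw [HilbertBasis.repr_apply_apply, coe_fourierBasis]
  congr 1
  change toL2 (fourier j) = _
  congr 1
  ext t
  simp only [fA_apply, smul_eq_mul, mul_one]

variable {P A : Type*} [NormedAddCommGroup P] [NormedSpace ℝ P]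
  [NormedAddCommGroup A] [InnerProductSpace ℂ A] [NormedSpace ℝ A]
  [IsScalarTower ℝ ℂ A] [FiniteDimensional ℂ A]

/-- The Fourier coefficient map. -/
noncomputable def SB (Φ : ℝ × (P × A) → ℂ) (h : ContDiff ℝ 2 Φ) (hp : PerT Φ) (q : P × XSp A) : Seq2 :=
  diagM (fun j => ((wt j : ℂ))⁻¹) mult0 ((fourierBasis (T := 2 * Real.pi)).repr (toL2 (NN0 Φ h hp q))) +
  diagM (fun j => -(I * j) * ((wt j : ℂ))⁻¹) mult1 ((fourierBasis (T := 2 * Real.pi)).repr (NN1 Φ h hp q))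

lemma SB_contDiff (Φ : ℝ × (P × A) → ℂ) (h : ContDiff ℝ 2 Φ) (hp : PerT Φ) :
    ContDiff ℝ 1 (SB Φ h hp) := by
  let r : Lp ℂ 2 muT →L[ℂ] Seq2 :=
    ((fourierBasis (T := 2 * Real.pi)).repr.toContinuousLinearEquiv : Lp ℂ 2 muT →L[ℂ] Seq2)
  have h0 : ContDiff ℝ 1 (fun q => toL2 (NN0 Φ h hp q)) :=
    (toL2R (A := ℂ)).contDiff.comp (NN0_contDiff Φ h hp)
  refine ContDiff.add ?_ ?_
  · exact (((diagM (fun j => ((wt j : ℂ))⁻¹) mult0).comp r).restrictScalars ℝ).contDiff.comp h0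
  · exact (((diagM (fun j => -(I * j) * ((wt j : ℂ))⁻¹) mult1).comp r).restrictScalars ℝ).contDiff.comp
      (NN1_contDiff Φ h hp)

lemma inner_fA_coeff (u : C(TT, ℂ)) (j : ℤ) :
    inner ℂ (toL2 (fA j (1 : ℂ))) (toL2 u) = fourierCoeff u j := by
  rw [← repr_coeff, fourierBasis_repr]
  exact fourierCoeff_toLp u j

lemma SB_apply (Φ : ℝ × (P × A) → ℂ) (h : ContDiff ℝ 2 Φ) (hp : PerT Φ) (q : P × XSp A) (j : ℤ) :
    SB Φ h hp q j = (Real.sqrt (1 + (j : ℝ) ^ 2) : ℂ) * fourierCoeff (NN0 Φ h hp q) j := by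
  change ((wt j : ℂ))⁻¹ * ((fourierBasis (T := 2 * Real.pi)).repr (toL2 (NN0 Φ h hp q))) j +
    -(I * j) * ((wt j : ℂ))⁻¹ * ((fourierBasis (T := 2 * Real.pi)).repr (NN1 Φ h hp q)) j =
    (wt j : ℂ) * _
  rw [repr_coeff, repr_coeff, NN1_compat, inner_fA_coeff]
  have h1 : (wt j : ℂ) ≠ 0 := by exact_mod_cast (wt_pos j).ne'
  have h2 : (wt j : ℂ) ^ 2 = 1 + (j : ℂ) ^ 2 := by exact_mod_cast wt_sq j
  field_simp
  linear_combination (-fourierCoeff (NN0 Φ h hp q) j) * h2 -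
    (fourierCoeff (NN0 Φ h hp q) j) * (j : ℂ) ^ 2 * I_sq

lemma bCoeff_eq (f : ℂ → ℂ) (u : TT → ℂ) (hu : ∀ θ : ℝ, f (Complex.exp (θ * I)) = u (θ : TT)) (j : ℤ) :
    bCoeff f j = fourierCoeff u j := by
  rw [fourierCoeff_eq_intervalIntegral u j 0, bCoeff, zero_add]
  rw [show (1 / (2 * Real.pi) : ℂ) = ((1 / (2 * Real.pi) : ℝ) : ℂ) by push_cast; rfl,
    ← Complex.real_smul]
  congr 1
  apply intervalIntegral.integral_congr
  intro θ _
  simp only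
  rw [hu, smul_eq_mul, mul_comm, fourier_coe_apply]
  congr 2
  push_cast
  field_simp

lemma repOf_SB (Φ : ℝ × (P × A) → ℂ) (h : ContDiff ℝ 2 Φ) (hp : PerT Φ) (q : P × XSp A) (f : ℂ → ℂ)
    (hf : ∀ θ : ℝ, f (Complex.exp (θ * I)) = Φ (θ, (q.1, iR q.2 (θ : TT)))) :
    RepOf (SB Φ h hp q) f := by
  intro j
  rw [SB_apply, bCoeff_eq f (NN0 Φ h hp q) hf]

end ThmB

/-! part 7 -/
set_option linter.unusedSectionVars false
open Complex Metric MeasureTheory Filter Set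

section DiskAlg

lemma fourier_exp (j : ℤ) (θ : ℝ) : (fourier j (θ : TT) : ℂ) = Complex.exp (θ * I) ^ j := by
  rw [fourier_coe_apply, ← Complex.exp_int_mul]
  congr 1
  push_cast
  field_simp

lemma exp_mem_Circ (θ : ℝ) : Complex.exp (θ * I) ∈ Circ := by
  simp [Circ, Complex.norm_exp_ofReal_mul_I]

lemma exists_exp_of_mem_Circ {z : ℂ} (hz : z ∈ Circ) : ∃ θ : ℝ, z = Complex.exp (θ * I) := by
  refine ⟨z.arg, ?_⟩
  have h := Complex.norm_mul_exp_arg_mul_I z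
  have h1 : ‖z‖ = 1 := by simpa [Circ] using hz
  rw [h1] at h
  simpa using h.symm

lemma Circ_sub_Disk : Circ ⊆ Disk := Metric.sphere_subset_closedBall

lemma MemA.dcc {h : ℂ → ℂ} (hh : MemA h) : DiffContOnCl ℂ h (ball 0 1) := by
  refine ⟨hh.2, ?_⟩
  rw [closure_ball _ one_ne_zero]
  exact hh.1

lemma MemA.add {h k : ℂ → ℂ} (hh : MemA h) (hk : MemA k) : MemA (fun z => h z + k z) :=
  ⟨hh.1.add hk.1, hh.2.add hk.2⟩
lemma MemA.sub {h k : ℂ → ℂ} (hh : MemA h) (hk : MemA k) : MemA (fun z => h z - k z) :=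
  ⟨hh.1.sub hk.1, hh.2.sub hk.2⟩
lemma MemA.mul {h k : ℂ → ℂ} (hh : MemA h) (hk : MemA k) : MemA (fun z => h z * k z) :=
  ⟨hh.1.mul hk.1, hh.2.mul hk.2⟩
lemma MemA.div {h k : ℂ → ℂ} (hh : MemA h) (hk : MemA k) (h0 : ∀ z ∈ Disk, k z ≠ 0) :
    MemA (fun z => h z / k z) :=
  ⟨hh.1.div hk.1 h0, hh.2.div hk.2 (fun z hz => h0 z (Metric.ball_subset_closedBall hz))⟩
lemma MemA.const (c : ℂ) : MemA (fun _ => c) := ⟨continuousOn_const, differentiableOn_const c⟩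
lemma MemA.sum {ι : Type*} (s : Finset ι) {h : ι → ℂ → ℂ} (hh : ∀ i ∈ s, MemA (h i)) :
    MemA (fun z => ∑ i ∈ s, h i z) :=
  ⟨continuousOn_finsetSum s fun i hi => (hh i hi).1,
    DifferentiableOn.fun_sum fun i hi => (hh i hi).2⟩
lemma MemA.cexp {h : ℂ → ℂ} (hh : MemA h) : MemA (fun z => Complex.exp (h z)) :=
  ⟨hh.1.cexp, hh.2.cexp⟩
lemma MemH12.memA {h : ℂ → ℂ} (hh : MemH12 h) : MemA h := ⟨hh.1, hh.2.1⟩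

/-- power series with summable coefficients -/
lemma memA_series (c : ℕ → ℂ) (hc : Summable (fun k => ‖c k‖)) :
    MemA (fun z => ∑' k : ℕ, c k * z ^ k) := by
  have hb : ∀ (k : ℕ) (z : ℂ), z ∈ Disk → ‖c k * z ^ k‖ ≤ ‖c k‖ := by
    intro k z hz
    have hz : ‖z‖ ≤ 1 := by simpa [Disk] using hz
    rw [norm_mul, norm_pow]
    exact mul_le_of_le_one_right (norm_nonneg _) (pow_le_one₀ (norm_nonneg _) hz)
  constructor
  · exact continuousOn_tsum (fun k => by fun_prop) hc hb
  · exact differentiableOn_tsum_of_summable_norm hc (fun k => by fun_prop) isOpen_ball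
      (fun k z hz => hb k z (ball_subset_closedBall hz))

lemma series_zero (c : ℕ → ℂ) : (∑' k : ℕ, c k * (0 : ℂ) ^ k) = c 0 := by
  rw [tsum_eq_single 0]
  · simp
  · intro k hk; simp [hk]

/-- continuous functions with summable Fourier coefficients, no negative ones, extend. -/
lemma ext_of_coeff (u : C(TT, ℂ)) (hs : Summable (fourierCoeff u))
    (hneg : ∀ k : ℕ, fourierCoeff u (-((k : ℤ) + 1)) = 0) :
    ∃ h : ℂ → ℂ, MemA h ∧ (∀ θ : ℝ, h (Complex.exp (θ * I)) = u (θ : TT)) ∧ h 0 = fourierCoeff u 0 := by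
  have hinj : Function.Injective (fun k : ℕ => (k : ℤ)) := fun a b h => by simpa using h
  refine ⟨fun z => ∑' k : ℕ, fourierCoeff u (k : ℤ) * z ^ k, memA_series _ ?_, ?_, series_zero _⟩
  · exact (hs.norm).comp_injective hinj
  · intro θ
    have h := has_pointwise_sum_fourier_series_of_summable hs (θ : TT)
    have h' := (hinj.hasSum_iff (f := fun i : ℤ => fourierCoeff u i • (fourier i (θ : TT) : ℂ))
      (a := u (θ : TT)) ?_).2 h
    · rw [← h'.tsum_eq]
      apply tsum_congr
      intro k
      simp only [Function.comp, smul_eq_mul]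
      rw [fourier_exp, zpow_natCast]
    · intro j hj
      have : j < 0 := by
        by_contra hcon
        push Not at hcon
        exact hj ⟨j.toNat, by simp [hcon]⟩
      obtain ⟨k, hk⟩ : ∃ k : ℕ, j = -((k : ℤ) + 1) := ⟨(-j - 1).toNat, by omega⟩
      rw [hk, hneg, zero_smul]

lemma summable_wt : Summable (fun j : ℤ => (wt j)⁻¹ ^ 2) := by
  have h1 : ∀ k : ℕ, (wt (k : ℤ))⁻¹ ^ 2 = (1 + (k : ℝ) ^ 2)⁻¹ := by
    intro k; rw [inv_pow, wt_sq]; simp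
  have h2 : Summable (fun k : ℕ => (1 + (k : ℝ) ^ 2)⁻¹) := by
    rw [← summable_nat_add_iff 1]
    refine Summable.of_nonneg_of_le (fun k => by positivity) (fun k => ?_)
      ((summable_nat_add_iff 1).2 (Real.summable_nat_pow_inv.2 one_lt_two))
    apply inv_anti₀ (by positivity)
    linarith
  apply Summable.of_nat_of_neg
  · simp_rw [h1]; exact h2
  · have : ∀ k : ℕ, (wt (-(k : ℤ)))⁻¹ ^ 2 = (1 + (k : ℝ) ^ 2)⁻¹ := by
      intro k; rw [inv_pow, wt_sq]; simp
    simp_rw [this]; exact h2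

lemma summable_of_rep (a : Seq2) (c : ℤ → ℂ)
    (h : ∀ j, a j = (Real.sqrt (1 + (j : ℝ) ^ 2) : ℂ) * c j) : Summable c := by
  have h1 : Summable (fun j : ℤ => ‖a j‖ ^ 2) := by
    have := (lp.memℓp a).summable (by simp)
    simpa using this
  refine Summable.of_norm_bounded (summable_wt.add h1) fun j => ?_
  have hc : ‖c j‖ = (wt j)⁻¹ * ‖a j‖ := by
    rw [h j, norm_mul, Complex.norm_real]
    change _ = (wt j)⁻¹ * (‖wt j‖ * _)
    rw [Real.norm_of_nonneg (wt_pos j).le]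
    rw [inv_mul_cancel_left₀ (wt_pos j).ne']
  rw [hc]
  nlinarith [sq_nonneg ((wt j)⁻¹ - ‖a j‖), sq_nonneg ((wt j)⁻¹), sq_nonneg (‖a j‖)]

/-- mean value -/
lemma MemA.mean {h : ℂ → ℂ} (hh : MemA h) :
    ∫ θ in (0 : ℝ)..2 * Real.pi, h (Complex.exp (θ * I)) = 2 * Real.pi * h 0 := by
  have h1 := DiffContOnCl.circleAverage (c := 0) (R := 1) (f := h) (by simpa using hh.dcc)
  rw [Real.circleAverage_def] at h1
  have h2 : ∀ θ : ℝ, circleMap 0 1 θ = Complex.exp (θ * I) := by intro θ; simp [circleMap]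
  simp_rw [h2] at h1
  rw [← h1, Complex.real_smul, ← mul_assoc]
  push_cast
  have : (2 * Real.pi : ℂ) ≠ 0 := by exact_mod_cast Real.two_pi_pos.ne'
  rw [mul_inv_cancel₀ this, one_mul]

lemma cont_circ {h : ℂ → ℂ} (hh : ContinuousOn h Disk) :
    Continuous (fun θ : ℝ => h (Complex.exp (θ * I))) :=
  hh.comp_continuous (by fun_prop) fun θ => Circ_sub_Disk (exp_mem_Circ θ)

lemma conj_zero {h1 h2 : ℂ → ℂ} (hh1 : MemA h1) (hh2 : MemA h2)
    (hc : ∀ z ∈ Circ, h1 z = (starRingEnd ℂ) (h2 z)) (h0 : h2 0 = 0) : ∀ z ∈ Circ, h2 z = 0 := by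
  have hm := (hh1.mul hh2).mean
  simp only [h0, mul_zero] at hm
  have hreal : ∀ θ : ℝ, h1 (Complex.exp (θ * I)) * h2 (Complex.exp (θ * I)) =
      ((‖h2 (Complex.exp (θ * I))‖ ^ 2 : ℝ) : ℂ) := by
    intro θ
    rw [hc _ (exp_mem_Circ θ), mul_comm, Complex.mul_conj, Complex.normSq_eq_norm_sq]
  simp_rw [hreal] at hm
  rw [intervalIntegral.integral_ofReal] at hm
  have hm' : ∫ θ in (0 : ℝ)..2 * Real.pi, ‖h2 (Complex.exp (θ * I))‖ ^ 2 = 0 := by exact_mod_cast hm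
  have hcont : Continuous (fun θ : ℝ => ‖h2 (Complex.exp (θ * I))‖ ^ 2) :=
    (cont_circ hh2.1).norm.pow 2
  intro z hz
  obtain ⟨θ, rfl⟩ := exists_exp_of_mem_Circ hz
  by_contra hne
  obtain ⟨φ, hφ, hφe⟩ : ∃ φ ∈ Icc (0 : ℝ) (2 * Real.pi), Complex.exp (φ * I) = Complex.exp (θ * I) := by
    obtain ⟨φ, hφ, he⟩ := (Function.Periodic.exists_mem_Ico₀
      (f := fun t : ℝ => Complex.exp (t * I)) (c := 2 * Real.pi) (by
        intro t; simp only; push_cast; rw [add_mul, Complex.exp_add, Complex.exp_two_pi_mul_I, mul_one])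
      Real.two_pi_pos θ)
    exact ⟨φ, Ico_subset_Icc_self hφ, he.symm⟩
  have := intervalIntegral.integral_pos (f := fun θ : ℝ => ‖h2 (Complex.exp (θ * I))‖ ^ 2)
    Real.two_pi_pos hcont.continuousOn (fun _ _ => by positivity) ⟨φ, hφ, by
      simp only [hφe]
      exact pow_pos (norm_pos_iff.2 hne) 2⟩
  linarith

lemma real_const {h : ℂ → ℂ} (hh : MemA h) (hr : ∀ z ∈ Circ, (h z).im = 0) :
    ∀ z ∈ Circ, h z = h 0 := by
  have := conj_zero (h1 := fun z => h z - (starRingEnd ℂ) (h 0)) (h2 := fun z => h z - h 0)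
    (hh.sub (MemA.const _)) (hh.sub (MemA.const _)) (by
      intro z hz
      simp only [map_sub]
      congr 1
      exact (Complex.conj_eq_iff_im.2 (hr z hz)).symm) (by simp)
  intro z hz
  exact sub_eq_zero.1 (this z hz)

lemma MemA.eqOn {h k : ℂ → ℂ} (hh : MemA h) (hk : MemA k) (he : ∀ z ∈ Circ, h z = k z) :
    ∀ z ∈ Disk, h z = k z := by
  have := Complex.eqOn_closure_of_eqOn_frontier isBounded_ball hh.dcc hk.dcc (by
    rw [frontier_ball _ one_ne_zero]; exact he)
  rw [closure_ball _ one_ne_zero] at this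
  exact this

lemma MemA.norm_le {h : ℂ → ℂ} (hh : MemA h) {C : ℝ} (hC : ∀ z ∈ Circ, ‖h z‖ ≤ C) :
    ∀ z ∈ Disk, ‖h z‖ ≤ C := by
  intro z hz
  refine Complex.norm_le_of_forall_mem_frontier_norm_le isBounded_ball hh.dcc ?_ ?_
  · rw [frontier_ball _ one_ne_zero]; exact hC
  · rw [closure_ball _ one_ne_zero]; exact hz

variable {A : Type*} [NormedAddCommGroup A] [InnerProductSpace ℂ A] [NormedSpace ℝ A]
  [IsScalarTower ℝ ℂ A] [FiniteDimensional ℂ A]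

/-- extension of the functions `iR x` into the disk -/
noncomputable def eX (l : A →L[ℂ] ℂ) (x : XSp A) (z : ℂ) : ℂ :=
  z * ∑' k : ℕ, l (mk1 k • x.co k) * z ^ k

lemma eX_zero (l : A →L[ℂ] ℂ) (x : XSp A) : eX l x 0 = 0 := by simp [eX]

lemma eX_memA (l : A →L[ℂ] ℂ) (x : XSp A) : MemA (eX l x) := by
  refine MemA.mul ⟨continuousOn_id, differentiableOn_id⟩ (memA_series _ ?_)
  have : CompleteSpace A := FiniteDimensional.complete ℂ A
  refine Summable.of_nonneg_of_le (fun _ => norm_nonneg _) (fun k => ?_) (x.hol.1.mul_left ‖l‖)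
  rw [← norm_smul]
  exact l.le_opNorm _

lemma eX_exp (l : A →L[ℂ] ℂ) (x : XSp A) (θ : ℝ) :
    eX l x (Complex.exp (θ * I)) = l (iR x (θ : TT)) := by
  have h := (l.hasSum (iR_apply x (θ : TT))).tsum_eq
  rw [← h, eX, ← tsum_mul_left]
  apply tsum_congr
  intro k
  rw [map_smul l (fourier _ _ : ℂ), smul_eq_mul, fourier_exp, ← Nat.cast_succ, zpow_natCast, pow_succ]
  ring

end DiskAlg

/-! part 8 -/
set_option linter.unusedSectionVars false
open Complex Metric MeasureTheory Filter Set

section RhoSmooth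

variable {n : ℕ}

lemma pi_decomp (u : Fin n → ℂ) :
    u = ∑ j, ((u j).re • (Pi.single j (1 : ℂ) : Fin n → ℂ) + (u j).im • (Pi.single j I : Fin n → ℂ)) := by
  ext i
  rw [Finset.sum_apply, Finset.sum_eq_single i]
  · simp [Complex.re_add_im]
  · intro j _ hj; simp [hj.symm]
  · simp

/-- pairing with the complex gradient -/
lemma sum_wderiv (g : (Fin n → ℂ) → ℝ) (w u : Fin n → ℂ) :
    ∑ j, u j * wderiv g w j =
      ((fderiv ℝ g w u : ℂ) - I * (fderiv ℝ g w (I • u) : ℂ)) / 2 := by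
  have key : ∀ D : (Fin n → ℂ) →L[ℝ] ℝ, ∀ u : Fin n → ℂ, (D u : ℝ) = ∑ j, ((u j).re * D (Pi.single j 1)
      + (u j).im * D (Pi.single j I)) := by
    intro D u
    conv_lhs => rw [pi_decomp u]
    simp
  rw [key _ u, key _ (I • u)]
  push_cast
  rw [Finset.mul_sum, ← Finset.sum_sub_distrib, Finset.sum_div]
  apply Finset.sum_congr rfl
  intro j _
  simp only [wderiv, Pi.smul_apply, smul_eq_mul, I_mul_re, I_mul_im]
  conv_lhs => rw [← Complex.re_add_im (u j)]
  push_cast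
  linear_combination (-((u j).im : ℂ) * (fderiv ℝ g w (Pi.single j I) : ℂ) / 2) * I_sq

lemma re_sum_wderiv (g : (Fin n → ℂ) → ℝ) (w u : Fin n → ℂ) :
    (∑ j, u j * wderiv g w j).re = fderiv ℝ g w u / 2 := by
  rw [sum_wderiv]
  have : ((fderiv ℝ g w u : ℂ) - I * (fderiv ℝ g w (I • u) : ℂ)) / 2 =
    ((fderiv ℝ g w u / 2 : ℝ) : ℂ) - ((fderiv ℝ g w (I • u) / 2 : ℝ) : ℂ) * I := by
    push_cast; ring
  rw [this]; simp

variable {ρ : ℂ → (Fin n → ℂ) → ℝ} {R : ℝ}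

/-- `ρ` in the angular variable -/
noncomputable def rt (ρ : ℂ → (Fin n → ℂ) → ℝ) (p : ℝ × (Fin n → ℂ)) : ℝ := ρ (Complex.exp (p.1 * I)) p.2

lemma rho_ne (hρ : Cond3 n ρ R (fun _ => 0)) {z : ℂ} (hz : z ∈ Circ) {w : Fin n → ℂ} (hw : w ≠ 0) :
    ρ z w ≠ 0 := fun h => hw ((hρ.Szero z hz w).1 h)

lemma rt_contDiffAt (hρ : Cond3 n ρ R (fun _ => 0)) (p : ℝ × (Fin n → ℂ)) (hp : p.2 ≠ 0) :
    ContDiffAt ℝ 6 (rt ρ) p := by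
  have h1 : ContDiffOn ℝ 6 (rt ρ) {p : ℝ × (Fin n → ℂ) | p.2 ≠ 0} := by
    have hg : ContDiff ℝ 6 (fun p : ℝ × (Fin n → ℂ) => (Complex.exp (p.1 * I), p.2)) := by
      refine ContDiff.prodMk ?_ contDiff_snd
      exact Complex.contDiff_exp.comp (((ofRealCLM.contDiff).comp contDiff_fst).mul contDiff_const)
    exact hρ.smooth.comp hg.contDiffOn (fun p hp => ⟨exp_mem_Circ _, rho_ne hρ (exp_mem_Circ _) hp⟩)
  exact h1.contDiffAt ((isOpen_ne.preimage continuous_snd).mem_nhds hp)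

lemma rt_cont (hρ : Cond3 n ρ R (fun _ => 0)) : Continuous (rt ρ) := by
  have hg : Continuous (fun p : ℝ × (Fin n → ℂ) => (Complex.exp (p.1 * I), p.2)) := by fun_prop
  exact hρ.cont.comp_continuous hg (fun p => exp_mem_Circ _)

lemma rho_contDiffAt (hρ : Cond3 n ρ R (fun _ => 0)) {z : ℂ} (hz : z ∈ Circ) {w : Fin n → ℂ}
    (hw : w ≠ 0) : ContDiffAt ℝ 6 (ρ z) w := by
  obtain ⟨θ, rfl⟩ := exists_exp_of_mem_Circ hz
  have h := (rt_contDiffAt hρ (θ, w) hw).comp w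
    ((contDiff_const (c := θ)).prodMk contDiff_id).contDiffAt
  exact h

lemma rho_cont (hρ : Cond3 n ρ R (fun _ => 0)) {z : ℂ} (hz : z ∈ Circ) : Continuous (ρ z) := by
  obtain ⟨θ, rfl⟩ := exists_exp_of_mem_Circ hz
  exact (rt_cont hρ).comp (Continuous.prodMk_right θ)

lemma fderiv_rt (hρ : Cond3 n ρ R (fun _ => 0)) (p : ℝ × (Fin n → ℂ)) (hp : p.2 ≠ 0) (u : Fin n → ℂ) :
    fderiv ℝ (ρ (Complex.exp (p.1 * I))) p.2 u = fderiv ℝ (rt ρ) p (0, u) := by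
  have h1 : HasFDerivAt (rt ρ) (fderiv ℝ (rt ρ) p) p :=
    ((rt_contDiffAt hρ p hp).differentiableAt (by norm_num)).hasFDerivAt
  have h2 : HasFDerivAt (fun w : Fin n → ℂ => (p.1, w)) (ContinuousLinearMap.inr ℝ ℝ (Fin n → ℂ)) p.2 :=
    hasFDerivAt_prodMk_right p.1 p.2
  have h3 : HasFDerivAt (fun w => rt ρ (p.1, w))
      ((fderiv ℝ (rt ρ) p).comp (ContinuousLinearMap.inr ℝ ℝ (Fin n → ℂ))) p.2 :=
    HasFDerivAt.comp (g := rt ρ) p.2 (f := fun w : Fin n → ℂ => (p.1, w)) h1 h2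
  have h4 : (fun w => rt ρ (p.1, w)) = ρ (Complex.exp (p.1 * I)) := rfl
  rw [h4] at h3
  rw [h3.fderiv]
  rfl

/-- complex gradient in the angular variable -/
noncomputable def pd (ρ : ℂ → (Fin n → ℂ) → ℝ) (p : ℝ × (Fin n → ℂ)) (j : Fin n) : ℂ :=
  wderiv (ρ (Complex.exp (p.1 * I))) p.2 j

lemma pd_contDiffAt (hρ : Cond3 n ρ R (fun _ => 0)) (p : ℝ × (Fin n → ℂ)) (hp : p.2 ≠ 0) :
    ContDiffAt ℝ 5 (pd ρ) p := by
  rw [contDiffAt_pi]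
  intro j
  have hev : ∀ᶠ q : ℝ × (Fin n → ℂ) in nhds p, q.2 ≠ 0 :=
    (isOpen_ne.preimage continuous_snd).mem_nhds hp
  have h1 : ContDiffAt ℝ 5 (fderiv ℝ (rt ρ)) p :=
    (rt_contDiffAt hρ p hp).fderiv_right (by norm_num)
  have h2 : ∀ u : Fin n → ℂ, ContDiffAt ℝ 5 (fun q => ((fderiv ℝ (rt ρ) q (0, u) : ℝ) : ℂ)) p := fun u =>
    ofRealCLM.contDiff.contDiffAt.comp p (h1.clm_apply contDiffAt_const)
  refine ContDiffAt.congr_of_eventuallyEq (f := fun q => (((fderiv ℝ (rt ρ) q (0, Pi.single j 1) : ℝ) : ℂ)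
    - I * ((fderiv ℝ (rt ρ) q (0, Pi.single j I) : ℝ) : ℂ)) / 2) ?_ ?_
  · exact ((h2 _).sub (contDiffAt_const.mul (h2 _))).div_const 2
  · filter_upwards [hev] with q hq
    rw [pd, wderiv, fderiv_rt hρ q hq, fderiv_rt hρ q hq]

/-- Hessian identity -/
lemma hess_wderiv (hρ : Cond3 n ρ R (fun _ => 0)) {z : ℂ} (hz : z ∈ Circ) {w : Fin n → ℂ}
    (hw : w ≠ 0) (h k : Fin n → ℂ) (Dp : Fin n → ((Fin n → ℂ) →L[ℝ] ℂ))
    (hD : ∀ j, HasFDerivAt (fun w => wderiv (ρ z) w j) (Dp j) w) :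
    (∑ j, k j * Dp j h).re = fderiv ℝ (fderiv ℝ (ρ z)) w h k / 2 := by
  have h1 : HasFDerivAt (fun w => (∑ j, k j * wderiv (ρ z) w j).re)
      (reCLM.comp (∑ j, k j • Dp j)) w := by
    refine reCLM.hasFDerivAt.comp w (HasFDerivAt.fun_sum fun j _ => ?_)
    exact (hD j).const_mul (k j)
  simp only [re_sum_wderiv] at h1
  have h2 : HasFDerivAt (fderiv ℝ (ρ z)) (fderiv ℝ (fderiv ℝ (ρ z)) w) w :=
    (((rho_contDiffAt hρ hz hw).fderiv_right (m := 1) (by norm_num)).differentiableAt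
      (by norm_num)).hasFDerivAt
  have h3 : HasFDerivAt (fun w => fderiv ℝ (ρ z) w k / 2)
      ((1 / 2 : ℝ) • ((ContinuousLinearMap.apply ℝ ℝ k).comp (fderiv ℝ (fderiv ℝ (ρ z)) w))) w := by
    have := ((ContinuousLinearMap.apply ℝ ℝ k).hasFDerivAt.comp w h2).const_mul (1 / 2)
    refine this.congr_of_eventuallyEq (Filter.Eventually.of_forall fun w => ?_)
    simp; ring
  have h4 := congrArg (fun L : (Fin n → ℂ) →L[ℝ] ℝ => L h) (h1.unique h3)
  simp only [ContinuousLinearMap.comp_apply, sum_apply, smul_apply,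
    ContinuousLinearMap.apply_apply, smul_eq_mul, reCLM_apply] at h4
  rw [h4]; ring

end RhoSmooth

/-! part 9 -/
set_option linter.unusedSectionVars false
open Complex Metric MeasureTheory Filter Set

section MountainPass

/-- the level of a minimal connecting continuum is attained -/
lemma mp_attained (φ : ℂ → ℝ) (hc : Continuous φ) (y0 : ℂ) (R : ℝ)
    (hR : IsCompact {ζ | φ ζ ≤ R}) (S : Set ℝ)
    (hS : S = {t | ∃ C : Set ℂ, IsPreconnected C ∧ 0 ∈ C ∧ y0 ∈ C ∧ C ⊆ {ζ | φ ζ ≤ t}})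
    (hRS : R ∈ S) (hb : BddBelow S) : sInf S ∈ S := by
  have hne : S.Nonempty := ⟨R, hRS⟩
  rcases eq_or_lt_of_le (csInf_le hb hRS) with h | hlt
  · rw [h]; exact hRS
  set t := sInf S with ht
  have h0K : φ 0 ≤ t := le_csInf hne fun s hs => by
    rw [hS] at hs; obtain ⟨C, _, h0, _, hC⟩ := hs; exact hC h0
  have hyK : φ y0 ≤ t := le_csInf hne fun s hs => by
    rw [hS] at hs; obtain ⟨C, _, _, h0, hC⟩ := hs; exact hC h0
  let K : Set ℂ := {ζ | φ ζ ≤ t}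
  have hKc : IsCompact K := hR.of_isClosed_subset (isClosed_le hc continuous_const)
    (fun ζ hζ => le_trans hζ hlt.le)
  have : CompactSpace K := isCompact_iff_compactSpace.1 hKc
  by_contra hcon
  have hnot : (⟨y0, hyK⟩ : K) ∉ connectedComponent (⟨0, h0K⟩ : K) := by
    intro hmem
    apply hcon
    rw [hS]
    refine ⟨Set.image Subtype.val (connectedComponent (⟨0, h0K⟩ : K)), ?_, ?_, ?_, ?_⟩
    · exact isPreconnected_connectedComponent.image _ continuous_subtype_val.continuousOn
    · exact ⟨_, mem_connectedComponent, rfl⟩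
    · exact ⟨_, hmem, rfl⟩
    · rintro _ ⟨x, _, rfl⟩; exact x.2
  rw [connectedComponent_eq_iInter_isClopen] at hnot
  simp only [mem_iInter, not_forall] at hnot
  obtain ⟨⟨Z, hZ, h0Z⟩, hyZ⟩ := hnot
  have hA : IsCompact (Set.image Subtype.val Z) := hZ.1.isCompact.image continuous_subtype_val
  have hB : IsCompact (Set.image Subtype.val Zᶜ) := hZ.2.isClosed_compl.isCompact.image continuous_subtype_val
  obtain ⟨U, V, hU, hV, hAU, hBV, hUV⟩ := SeparatedNhds.of_isCompact_isCompact hA hB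
    ((disjoint_image_iff Subtype.val_injective).2 disjoint_compl_right)
  have hKUV : K ⊆ U ∪ V := by
    intro x hx
    by_cases hxZ : (⟨x, hx⟩ : K) ∈ Z
    · exact Or.inl (hAU ⟨_, hxZ, rfl⟩)
    · exact Or.inr (hBV ⟨_, hxZ, rfl⟩)
  obtain ⟨m, hm, hmR, hmK⟩ : ∃ m, t < m ∧ m ≤ R ∧ ∀ s < m, {ζ | φ ζ ≤ s} ⊆ U ∪ V := by
    have hD : IsCompact ({ζ | φ ζ ≤ R} \ (U ∪ V)) := hR.diff (hU.union hV)
    rcases eq_empty_or_nonempty ({ζ | φ ζ ≤ R} \ (U ∪ V)) with he | hn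
    · refine ⟨R, hlt, le_rfl, fun s hs ζ hζ => ?_⟩
      by_contra hh
      have : ζ ∈ ({ζ | φ ζ ≤ R} \ (U ∪ V)) := ⟨le_trans hζ hs.le, hh⟩
      rw [he] at this; exact this
    · obtain ⟨x, hx, hxm⟩ := hD.exists_isMinOn hn hc.continuousOn
      refine ⟨φ x, ?_, hx.1, fun s hs ζ hζ => ?_⟩
      · by_contra hh
        push Not at hh
        exact hx.2 (hKUV hh)
      · by_contra hh
        have h1 : ζ ∈ ({ζ | φ ζ ≤ R} \ (U ∪ V)) := ⟨le_trans hζ (hs.le.trans hx.1), hh⟩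
        have h2 := hxm h1
        have h3 : φ ζ ≤ s := hζ
        have h4 : φ x ≤ φ ζ := h2
        linarith
  obtain ⟨s, hs, hsm⟩ := exists_lt_of_csInf_lt hne hm
  rw [hS] at hs
  obtain ⟨C, hCc, h0, hy, hC⟩ := hs
  have h0U : (0 : ℂ) ∈ U := hAU ⟨_, h0Z, rfl⟩
  have hyV : y0 ∈ V := hBV ⟨_, hyZ, rfl⟩
  have := hCc.subset_left_of_subset_union hU hV hUV (hC.trans (hmK s hsm)) ⟨0, h0, h0U⟩
  exact (Set.disjoint_left.1 hUV) (this hy) hyV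

lemma mp (φ : ℂ → ℝ) (hc : Continuous φ) (h0 : φ 0 = 0) (hpos : ∀ ζ ≠ 0, 0 < φ ζ)
    (hd : ∀ ζ ≠ 0, ContDiffAt ℝ 1 φ ζ) (R : ℝ) (hR : IsCompact {ζ | φ ζ ≤ R})
    (hconn : IsPreconnected {ζ | φ ζ ≤ R})
    (hmin : ∀ y ≠ 0, φ y ≤ R → fderiv ℝ φ y = 0 → ∀ᶠ x in nhds y, x ≠ y → φ y < φ x)
    (y0 : ℂ) (hy0 : y0 ≠ 0) (hy0R : φ y0 ≤ R) : fderiv ℝ φ y0 ≠ 0 := by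
  intro hcrit
  let S : Set ℝ := {t | ∃ C : Set ℂ, IsPreconnected C ∧ 0 ∈ C ∧ y0 ∈ C ∧ C ⊆ {ζ | φ ζ ≤ t}}
  have hnn : ∀ ζ, 0 ≤ φ ζ := fun ζ => by
    by_cases h : ζ = 0
    · rw [h, h0]
    · exact (hpos ζ h).le
  have hRS : R ∈ S := ⟨_, hconn, by simpa [h0] using (hnn y0).trans hy0R, hy0R, subset_rfl⟩
  have hb : BddBelow S := ⟨0, fun t ⟨C, _, h0C, _, hC⟩ => by
    have : φ 0 ≤ t := hC h0C
    rwa [h0] at this⟩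
  have hat := mp_attained φ hc y0 R hR S rfl hRS hb
  set t := sInf S with ht
  have htR : t ≤ R := csInf_le hb hRS
  obtain ⟨C0, hC0, h0C0, hyC0, hC0t⟩ := hat
  have htpos : 0 < t := lt_of_lt_of_le (hpos y0 hy0) (hC0t hyC0)
  have hclosed : IsClosed {ζ | φ ζ ≤ t} := isClosed_le hc continuous_const
  let C := closure C0
  have hCt : C ⊆ {ζ | φ ζ ≤ t} := closure_minimal hC0t hclosed
  have hCp : IsPreconnected C := hC0.closure
  have h0C : (0 : ℂ) ∈ C := subset_closure h0C0
  have hyC : y0 ∈ C := subset_closure hyC0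
  have hCc : IsCompact C := hR.of_isClosed_subset isClosed_closure
    (fun ζ hζ => le_trans (hCt hζ) htR)
  have hnocrit : ∀ y ∈ C, φ y = t → fderiv ℝ φ y ≠ 0 := by
    intro y hy hyt hcy
    have hyne : y ≠ 0 := by rintro rfl; rw [h0] at hyt; linarith
    obtain ⟨W, hW, hWo, hyW⟩ := _root_.eventually_nhds_iff.1 (hmin y hyne (hyt.le.trans htR) hcy)
    obtain ⟨x, hxC, hxW, hxy⟩ := hCp W {y}ᶜ hWo isOpen_compl_singleton (fun x _ => by
      by_cases h : x = y
      · left; rw [h]; exact hyW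
      · right; exact h) ⟨y, hy, hyW⟩ ⟨0, h0C, hyne.symm⟩
    have h1 := hW x hxW hxy
    have h2 : φ x ≤ t := hCt hxC
    linarith
  -- vector field
  let v : ℂ → ℂ := fun ζ => ((fderiv ℝ φ ζ 1 : ℝ) : ℂ) + ((fderiv ℝ φ ζ I : ℝ) : ℂ) * I
  let V : ℂ → ℂ := fun ζ => ((max 0 (φ ζ - t / 2) : ℝ) : ℂ) * v ζ
  have hVc : Continuous V := by
    rw [continuous_iff_continuousAt]
    intro ζ
    by_cases hζ : ζ = 0
    · have : V =ᶠ[nhds ζ] fun _ => 0 := by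
        have h1 : ∀ᶠ x in nhds ζ, φ x < t / 2 :=
          hc.continuousAt.eventually_lt continuousAt_const (by rw [hζ, h0]; linarith)
        filter_upwards [h1] with x hx
        simp only [V]
        rw [max_eq_left (by linarith)]; simp
      exact continuousAt_const.congr this.symm
    · have hfd : ContinuousAt (fderiv ℝ φ) ζ :=
        ((hd ζ hζ).fderiv_right (m := 0) (by norm_num)).continuousAt
      have h1 : ContinuousAt (fun x => fderiv ℝ φ x 1) ζ := hfd.clm_apply continuousAt_const
      have h2 : ContinuousAt (fun x => fderiv ℝ φ x I) ζ := hfd.clm_apply continuousAt_const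
      refine ContinuousAt.mul ?_ ?_
      · exact (Complex.continuous_ofReal.comp (continuous_const.max (hc.sub continuous_const))).continuousAt
      · exact (Complex.continuous_ofReal.continuousAt.comp h1).add
          ((Complex.continuous_ofReal.continuousAt.comp h2).mul continuousAt_const)
  have hDv : ∀ ζ, fderiv ℝ φ ζ (v ζ) = (fderiv ℝ φ ζ 1) ^ 2 + (fderiv ℝ φ ζ I) ^ 2 := by
    intro ζ
    have : v ζ = (fderiv ℝ φ ζ 1) • (1 : ℂ) + (fderiv ℝ φ ζ I) • I := by
      simp only [v, Complex.real_smul, mul_one]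
    rw [this, map_add, map_smul, map_smul]
    simp only [smul_eq_mul]; ring
  have hDV : ∀ y ∈ C, φ y = t → 0 < fderiv ℝ φ y (V y) := by
    intro y hy hyt
    have h1 : V y = (t / 2) • v y := by
      simp only [V, Complex.real_smul]
      rw [hyt, max_eq_right (by linarith)]
      congr 2; ring
    rw [h1, map_smul, hDv, smul_eq_mul]
    apply mul_pos (by linarith)
    by_contra hh
    push Not at hh
    have e1 : fderiv ℝ φ y 1 = 0 := by nlinarith [sq_nonneg (fderiv ℝ φ y 1), sq_nonneg (fderiv ℝ φ y I)]
    have e2 : fderiv ℝ φ y I = 0 := by nlinarith [sq_nonneg (fderiv ℝ φ y 1), sq_nonneg (fderiv ℝ φ y I)]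
    apply hnocrit y hy hyt
    ext x
    have : x = x.re • (1 : ℂ) + x.im • I := by
      simp [Complex.re_add_im]
    rw [this, map_add, map_smul, map_smul, e1, e2]; simp
  have hψ : Continuous (fun p : ℝ × ℂ => p.2 - p.1 • V p.2) :=
    continuous_snd.sub (continuous_fst.smul (hVc.comp continuous_snd))
  have hpush : ∀ᶠ s in nhds (0 : ℝ), ∀ ζ ∈ C, 0 < s → ζ ∈ C → φ (ζ - s • V ζ) < t := by
    refine hCc.eventually_forall_of_forall_eventually fun y hy => ?_
    rcases lt_or_eq_of_le (show φ y ≤ t from hCt hy) with hlt | heq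
    · have : ∀ᶠ p : ℝ × ℂ in nhds (0, y), φ (p.2 - p.1 • V p.2) < t :=
        (hc.comp hψ).continuousAt.eventually_lt continuousAt_const (by simpa using hlt)
      filter_upwards [this] with p hp _ _
      exact hp
    · have hyne : y ≠ 0 := by rintro rfl; rw [h0] at heq; linarith
      have hstrict : HasStrictFDerivAt φ (fderiv ℝ φ y) y :=
        (hd y hyne).hasStrictFDerivAt (by norm_num)
      set D := fderiv ℝ φ y with hDdef
      have hdp : 0 < D (V y) := hDV y hy heq
      set c := D (V y) / (2 * (‖V y‖ + 1)) with hcdef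
      have hcpos : 0 < c := by positivity
      have hcV : 0 < D (V y) - c * ‖V y‖ := by
        have : c * (2 * (‖V y‖ + 1)) = D (V y) := by rw [hcdef]; field_simp
        nlinarith [norm_nonneg (V y)]
      have e1 : ∀ᶠ p : ℝ × ℂ in nhds (0, y), 0 < D (V p.2) - c * ‖V p.2‖ := by
        refine continuousAt_const.eventually_lt (f := fun _ => (0 : ℝ)) (Continuous.continuousAt ?_) hcV
        have := hVc.comp (continuous_snd (X := ℝ) (Y := ℂ))
        exact (D.continuous.comp this).sub (continuous_const.mul this.norm)
      have e2 := hstrict.isLittleO.bound hcpos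
      have htend : Tendsto (fun p : ℝ × ℂ => (p.2 - p.1 • V p.2, p.2)) (nhds (0, y)) (nhds (y, y)) := by
        have := (hψ.prodMk continuous_snd).tendsto ((0 : ℝ), y)
        simpa using this
      filter_upwards [e1, htend.eventually e2] with p hp1 hp2 hs hpC
      have h1 : p.2 - p.1 • V p.2 - p.2 = -(p.1 • V p.2) := by ring
      simp only [h1] at hp2
      rw [map_neg, map_smul, norm_neg, norm_smul, Real.norm_of_nonneg hs.le, smul_eq_mul] at hp2
      have h2 := (abs_le.1 hp2).2
      have h3 : φ p.2 ≤ t := hCt hpC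
      nlinarith [mul_pos hs hp1]
  obtain ⟨s, hs, hsP⟩ : ∃ s > (0 : ℝ), ∀ ζ ∈ C, φ (ζ - s • V ζ) < t := by
    obtain ⟨ε, hε, hball⟩ := Metric.eventually_nhds_iff.1 hpush
    refine ⟨ε / 2, by positivity, fun ζ hζ => hball ?_ ζ hζ (by positivity) hζ⟩
    rw [dist_zero_right, Real.norm_of_nonneg (by positivity)]; linarith
  have hψs : Continuous (fun ζ => ζ - s • V ζ) := continuous_id.sub (hVc.const_smul s)
  obtain ⟨x, hx, hxm⟩ := hCc.exists_isMaxOn ⟨0, h0C⟩ (hc.comp hψs).continuousOn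
  have hmem : φ (x - s • V x) ∈ S := by
    refine ⟨Set.image (fun ζ => ζ - s • V ζ) C, hCp.image _ hψs.continuousOn, ⟨0, h0C, ?_⟩, ⟨y0, hyC, ?_⟩, ?_⟩
    · have : V 0 = 0 := by
        simp only [V]; rw [h0, max_eq_left (by linarith)]; simp
      simp [this]
    · have : V y0 = 0 := by
        simp only [V, v]; rw [hcrit]; simp
      simp [this]
    · rintro _ ⟨ζ, hζ, rfl⟩
      exact hxm hζ
  have h1 := csInf_le hb hmem
  have h2 := hsP x hx
  linarith

/-- strict local minimum from a positive definite second derivative -/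
lemma strict_min {E : Type*} [NormedAddCommGroup E] [NormedSpace ℝ E] (φ : E → ℝ) (y : E)
    (hd : ContDiffAt ℝ 2 φ y) (hcrit : fderiv ℝ φ y = 0) (K : ℝ) (hK : 0 < K)
    (hpos : ∀ h, K * ‖h‖ ^ 2 ≤ fderiv ℝ (fderiv ℝ φ) y h h) :
    ∀ᶠ x in nhds y, x ≠ y → φ y < φ x := by
  have h1 : HasFDerivAt (fderiv ℝ φ) (fderiv ℝ (fderiv ℝ φ) y) y :=
    ((hd.fderiv_right (m := 1) (by norm_num)).differentiableAt (by norm_num)).hasFDerivAt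
  have h2 := h1.isLittleO.bound (half_pos hK)
  have h3 : ∀ᶠ x in nhds y, DifferentiableAt ℝ φ x := by
    filter_upwards [hd.eventually (by simp)] with x hx
    exact hx.differentiableAt (by norm_num)
  obtain ⟨ε, hε, hball⟩ := Metric.eventually_nhds_iff_ball.1 (h2.and h3)
  refine Metric.eventually_nhds_iff_ball.2 ⟨ε, hε, fun x hx hxy => ?_⟩
  have hne : 0 < ‖x - y‖ := norm_pos_iff.2 (sub_ne_zero.2 hxy)
  set h := x - y with hh
  have hseg : ∀ s ∈ Icc (0 : ℝ) 1, y + s • h ∈ ball y ε := by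
    intro s hs
    rw [mem_ball, dist_eq_norm] at hx ⊢
    rw [add_sub_cancel_left, norm_smul, Real.norm_of_nonneg hs.1]
    exact lt_of_le_of_lt (mul_le_of_le_one_left (norm_nonneg _) hs.2) hx
  have hder : ∀ s ∈ Icc (0 : ℝ) 1, HasDerivAt (fun s : ℝ => φ (y + s • h)) (fderiv ℝ φ (y + s • h) h) s := by
    intro s hs
    have hl : HasDerivAt (fun s : ℝ => y + s • h) h s := by
      simpa using ((hasDerivAt_id s).smul_const h).const_add y
    exact (hball _ (hseg s hs)).2.hasFDerivAt.comp_hasDerivAt s hl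
  have hmono : StrictMonoOn (fun s : ℝ => φ (y + s • h)) (Icc 0 1) := by
    refine strictMonoOn_of_deriv_pos (convex_Icc 0 1)
      (fun s hs => (hder s hs).continuousAt.continuousWithinAt) ?_
    intro s hs
    rw [interior_Icc] at hs
    have hs' := Ioo_subset_Icc_self hs
    rw [(hder s hs').deriv]
    have hb := (hball _ (hseg s hs')).1
    rw [hcrit, sub_zero, add_sub_cancel_left] at hb
    have e1 : |(fderiv ℝ φ (y + s • h) - fderiv ℝ (fderiv ℝ φ) y (s • h)) h| ≤
        K / 2 * ‖s • h‖ * ‖h‖ :=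
      (ContinuousLinearMap.le_opNorm _ _).trans (mul_le_mul_of_nonneg_right hb (norm_nonneg _))
    rw [sub_apply, map_smul, smul_apply, smul_eq_mul, norm_smul,
      Real.norm_of_nonneg hs.1.le] at e1
    have e2 := (abs_le.1 e1).1
    have e3 := mul_le_mul_of_nonneg_left (hpos h) hs.1.le
    have e4 : 0 < s * (K * ‖h‖ ^ 2) := mul_pos hs.1 (by positivity)
    nlinarith
  have := hmono (left_mem_Icc.2 zero_le_one) (right_mem_Icc.2 zero_le_one) zero_lt_one
  simpa [hh] using this

end MountainPass

/-! part 10 -/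
set_option linter.unusedSectionVars false
open Complex Metric MeasureTheory Filter Set

section Lam

variable {n : ℕ}

lemma euclNorm_eq (w : Fin n → ℂ) : euclNorm w = ‖(WithLp.toLp 2 w : EuclideanSpace ℂ (Fin n))‖ := by
  rw [EuclideanSpace.norm_eq, euclNorm]
  simp [Complex.normSq_eq_norm_sq]

lemma euclNorm_smul (c : ℂ) (w : Fin n → ℂ) : euclNorm (c • w) = ‖c‖ * euclNorm w := by
  rw [euclNorm_eq, euclNorm_eq, WithLp.toLp_smul, norm_smul]

lemma euclNorm_nonneg (w : Fin n → ℂ) : 0 ≤ euclNorm w := Real.sqrt_nonneg _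

lemma euclNorm_pos {w : Fin n → ℂ} (hw : w ≠ 0) : 0 < euclNorm w := by
  rw [euclNorm_eq, norm_pos_iff]
  intro h
  exact hw (by simpa using h)

lemma euclNorm_sq (w : Fin n → ℂ) : euclNorm w ^ 2 = ∑ j, ‖w j‖ ^ 2 := by
  rw [euclNorm, Real.sq_sqrt (Finset.sum_nonneg fun j _ => Complex.normSq_nonneg _)]
  simp [Complex.normSq_eq_norm_sq]

variable {ρ : ℂ → (Fin n → ℂ) → ℝ} {R : ℝ}

lemma rho_le_R (hρ : Cond3 n ρ R (fun _ => 0)) {z : ℂ} (hz : z ∈ Circ) (w : Fin n → ℂ) :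
    ρ z w ≤ R ↔ euclNorm w ≤ R := by
  constructor
  · intro h
    by_contra hcon
    push Not at hcon
    exact absurd (hρ.aboveR z hz w hcon) (not_lt.2 h)
  · intro h
    rcases eq_or_lt_of_le h with he | hlt
    · exact ((hρ.levelR z hz w).2 he).le
    · by_contra hcon
      push Not at hcon
      have hcont : ContinuousOn (fun s : ℝ => ρ z ((s : ℂ) • w)) (Icc 0 1) :=
        ((rho_cont hρ hz).comp (by fun_prop : Continuous fun s : ℝ => (s : ℂ) • w)).continuousOn
      have hR0 : (0 : ℝ) < R := by linarith [hρ.hR]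
      have h00 : ρ z 0 = 0 := (hρ.Szero z hz 0).2 rfl
      obtain ⟨s, hs, hsR⟩ := intermediate_value_Icc zero_le_one hcont (show R ∈ Icc _ _ by
        simp only [Complex.ofReal_zero, zero_smul, Complex.ofReal_one, one_smul, h00]
        exact ⟨hR0.le, hcon.le⟩)
      have := (hρ.levelR z hz _).1 hsR
      rw [euclNorm_smul, Complex.norm_real, Real.norm_of_nonneg hs.1] at this
      nlinarith [hs.2, euclNorm_nonneg w, hs.1]

/-- radial complex derivative -/
noncomputable def lam (ρ : ℂ → (Fin n → ℂ) → ℝ) (z : ℂ) (w : Fin n → ℂ) : ℂ :=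
  ∑ j, w j * wderiv (ρ z) w j

lemma lam_ne (hρ : Cond3 n ρ R (fun _ => 0)) {z : ℂ} (hz : z ∈ Circ) {w : Fin n → ℂ} (hw : w ≠ 0)
    (hwR : euclNorm w ≤ R) : lam ρ z w ≠ 0 := by
  intro hl
  let L : ℂ →L[ℝ] (Fin n → ℂ) := (ContinuousLinearMap.toSpanSingleton ℂ w).restrictScalars ℝ
  have hL : ∀ ζ, L ζ = ζ • w := fun ζ => rfl
  have hLne : ∀ ζ, ζ ≠ 0 → L ζ ≠ 0 := fun ζ hζ => by rw [hL]; exact smul_ne_zero hζ hw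
  have hwp := euclNorm_pos hw
  have hset : {ζ : ℂ | ρ z (L ζ) ≤ R} = closedBall 0 (R / euclNorm w) := by
    ext ζ
    rw [Set.mem_ofPred_eq, rho_le_R hρ hz, hL, euclNorm_smul, mem_closedBall, dist_zero_right,
      le_div_iff₀ hwp]
  have hfd : ∀ ζ, ζ ≠ 0 → fderiv ℝ (fun ζ => ρ z (L ζ)) ζ = (fderiv ℝ (ρ z) (L ζ)).comp L := by
    intro ζ hζ
    exact ((((rho_contDiffAt hρ hz (hLne ζ hζ)).differentiableAt (by norm_num)).hasFDerivAt).comp ζ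
      L.hasFDerivAt).fderiv
  refine mp (fun ζ => ρ z (L ζ)) ((rho_cont hρ hz).comp L.continuous) ?_ ?_ ?_ R ?_ ?_ ?_ 1 one_ne_zero
    ?_ ?_
  · simp only [map_zero]; exact (hρ.Szero z hz 0).2 rfl
  · intro ζ hζ
    exact lt_of_le_of_ne (hρ.nonneg z hz _) (rho_ne hρ hz (hLne ζ hζ)).symm
  · intro ζ hζ
    exact ((rho_contDiffAt hρ hz (hLne ζ hζ)).of_le (by norm_num)).comp ζ L.contDiff.contDiffAt
  · rw [hset]; exact isCompact_closedBall _ _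
  · rw [hset]; exact (convex_closedBall _ _).isPreconnected
  · intro y hy hyR hcrit
    obtain ⟨K0, hK0, hK⟩ := hρ.hypo {(z, L y)} (by
      rintro _ rfl; exact ⟨hz, rho_ne hρ hz (hLne y hy)⟩) isCompact_singleton
    have hfd2 : ∀ h k, fderiv ℝ (fderiv ℝ (fun ζ => ρ z (L ζ))) y h k =
        fderiv ℝ (fderiv ℝ (ρ z)) (L y) (L h) (L k) := by
      intro h k
      have h2 : HasFDerivAt (fderiv ℝ (ρ z)) (fderiv ℝ (fderiv ℝ (ρ z)) (L y)) (L y) :=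
        (((rho_contDiffAt hρ hz (hLne y hy)).fderiv_right (m := 1) (by norm_num)).differentiableAt
          (by norm_num)).hasFDerivAt
      have h3 : HasFDerivAt (fun ζ => fderiv ℝ (ρ z) (L ζ))
          ((fderiv ℝ (fderiv ℝ (ρ z)) (L y)).comp L) y := h2.comp y L.hasFDerivAt
      have h4 : HasFDerivAt (fun ζ => (fderiv ℝ (ρ z) (L ζ)).comp L)
          (((ContinuousLinearMap.compL ℝ ℂ (Fin n → ℂ) ℝ).flip L).comp
            ((fderiv ℝ (fderiv ℝ (ρ z)) (L y)).comp L)) y :=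
        ((ContinuousLinearMap.compL ℝ ℂ (Fin n → ℂ) ℝ).flip L).hasFDerivAt.comp y h3
      have h5 : fderiv ℝ (fun ζ => ρ z (L ζ)) =ᶠ[nhds y] fun ζ => (fderiv ℝ (ρ z) (L ζ)).comp L := by
        filter_upwards [isOpen_ne.mem_nhds hy] with ζ hζ
        exact hfd ζ hζ
      rw [(h4.congr_of_eventuallyEq h5).fderiv]
      rfl
    refine strict_min (fun ζ => ρ z (L ζ)) y (((rho_contDiffAt hρ hz (hLne y hy)).of_le (by norm_num)).comp y
      L.contDiff.contDiffAt) hcrit (K0 * euclNorm w ^ 2) (by positivity) ?_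
    intro h
    rw [hfd2]
    have h1 := hK (z, L y) rfl (L h) (by
      rw [sum_wderiv]
      have e1 : ∀ k, fderiv ℝ (ρ z) (L y) (L k) = 0 := by
        intro k
        have := congrArg (fun T : ℂ →L[ℝ] ℝ => T k) ((hfd y hy).symm.trans hcrit)
        simpa using this
      have e2 : I • L h = L (I * h) := by rw [hL, hL, smul_smul]
      rw [e2, e1, e1]; simp)
    rw [iteratedFDeriv_two_apply] at h1
    simp only [Matrix.cons_val_zero, Matrix.cons_val_one] at h1
    have h2 : K0 * euclNorm w ^ 2 * ‖h‖ ^ 2 = K0 * euclNorm (L h) ^ 2 := by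
      rw [hL, euclNorm_smul]; ring
    rw [h2]; exact h1
  · simp only [hL, one_smul]; exact (rho_le_R hρ hz w).2 hwR
  · rw [hfd 1 one_ne_zero]
    rw [lam, sum_wderiv] at hl
    have hl2 : (fderiv ℝ (ρ z) w w : ℂ) - I * (fderiv ℝ (ρ z) w (I • w) : ℂ) = 0 := by
      linear_combination 2 * hl
    have r1 := congrArg Complex.re hl2
    have r2 := congrArg Complex.im hl2
    simp at r1 r2
    have hL1 : L 1 = w := by rw [hL, one_smul]
    ext h
    rw [hL1]
    have : L h = h.re • w + h.im • (I • w) := by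
      rw [hL]
      conv_lhs => rw [← Complex.re_add_im h]
      rw [add_smul, mul_smul]
      rfl
    rw [ContinuousLinearMap.comp_apply, this, map_add, map_smul, map_smul, r1, r2]
    simp

lemma lam_real (hρ : Cond3 n ρ R (fun _ => 0)) {z : ℂ} (hz : z ∈ Circ) {w : Fin n → ℂ}
    (hwR : euclNorm w = R) : (lam ρ z w).im = 0 := by
  have hw : w ≠ 0 := by
    rintro rfl
    have : euclNorm (0 : Fin n → ℂ) = 0 := by simp [euclNorm]
    rw [this] at hwR; linarith [hρ.hR]
  have h1 : HasFDerivAt (ρ z) (fderiv ℝ (ρ z) w) w :=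
    ((rho_contDiffAt hρ hz hw).differentiableAt (by norm_num)).hasFDerivAt
  have h2 : HasDerivAt (fun t : ℝ => Complex.exp (t * I) • w) (I • w) 0 := by
    have h3 : HasDerivAt (fun t : ℝ => Complex.exp (t * I)) I 0 := by
      have h4 : HasDerivAt (fun t : ℝ => (t : ℂ) * I) I 0 := by
        simpa using (Complex.ofRealCLM.hasDerivAt (x := 0)).mul_const I
      have := h4.cexp
      simpa using this
    exact h3.smul_const w
  have h5 : HasDerivAt (fun t : ℝ => ρ z (Complex.exp (t * I) • w)) (fderiv ℝ (ρ z) w (I • w)) 0 := by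
    refine HasFDerivAt.comp_hasDerivAt (f := fun t : ℝ => Complex.exp (t * I) • w) 0 ?_ h2
    simpa using h1
  have h6 : (fun t : ℝ => ρ z (Complex.exp (t * I) • w)) = fun _ => R := by
    funext t
    rw [hρ.levelR z hz, euclNorm_smul, Complex.norm_exp_ofReal_mul_I, one_mul, hwR]
  rw [h6] at h5
  have h7 := h5.unique (hasDerivAt_const 0 R)
  rw [lam, sum_wderiv, h7]
  have : ((fderiv ℝ (ρ z) w w : ℂ) - I * ((0 : ℝ) : ℂ)) / 2 = ((fderiv ℝ (ρ z) w w / 2 : ℝ) : ℂ) := by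
    push_cast; ring
  rw [this, Complex.ofReal_im]

lemma lam_contAt (hρ : Cond3 n ρ R (fun _ => 0)) (p : ℝ × (Fin n → ℂ)) (hp : p.2 ≠ 0) :
    ContDiffAt ℝ 5 (fun q : ℝ × (Fin n → ℂ) => lam ρ (Complex.exp (q.1 * I)) q.2) p := by
  refine ContDiffAt.sum fun j _ => ?_
  refine ContDiffAt.mul ?_ (contDiffAt_pi.1 (pd_contDiffAt hρ p hp) j)
  exact ((ContinuousLinearMap.proj (R := ℝ) (φ := fun _ : Fin n => ℂ) j).contDiff.comp contDiff_snd).contDiffAt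

end Lam

/-! part 11 -/
set_option linter.unusedSectionVars false
open Complex Metric MeasureTheory Filter Set

section Logs

/-- existence of a continuous periodic logarithm -/
def HasLog (u : ℝ → ℂ) : Prop :=
  ∃ L : ℝ → ℂ, Continuous L ∧ Function.Periodic L (2 * Real.pi) ∧ ∀ θ, Complex.exp (L θ) = u θ

lemma hasLog_near {u v : ℝ → ℂ} (hu : HasLog u) (huc : Continuous u) (hv : Continuous v)
    (hup : Function.Periodic u (2 * Real.pi)) (hvp : Function.Periodic v (2 * Real.pi))
    (h : ∀ θ, ‖v θ - u θ‖ < ‖u θ‖) : HasLog v := by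
  obtain ⟨L, hLc, hLp, hL⟩ := hu
  have hne : ∀ θ, u θ ≠ 0 := fun θ => by rw [← hL]; exact Complex.exp_ne_zero _
  have hsl : ∀ θ, v θ / u θ ∈ slitPlane := by
    intro θ
    have h1 : v θ / u θ = 1 + (v θ - u θ) / u θ := by
      have := hne θ
      field_simp; ring
    rw [h1]
    apply Complex.mem_slitPlane_of_norm_lt_one
    rw [norm_div, div_lt_one (norm_pos_iff.2 (hne θ))]
    exact h θ
  refine ⟨fun θ => L θ + Complex.log (v θ / u θ), ?_, ?_, ?_⟩
  · exact hLc.add ((hv.div huc hne).clog hsl)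
  · intro θ
    simp only [hLp θ, hup θ, hvp θ]
  · intro θ
    rw [Complex.exp_add, hL, Complex.exp_log (slitPlane_ne_zero (hsl θ)), mul_div_cancel₀ _ (hne θ)]

lemma hasLog_homotopy (H : ℝ → ℝ → ℂ)
    (hH : ContinuousOn (fun p : ℝ × ℝ => H p.1 p.2) (Icc 0 1 ×ˢ univ))
    (hp : ∀ s, Function.Periodic (H s) (2 * Real.pi))
    (hne : ∀ s ∈ Icc (0 : ℝ) 1, ∀ θ, H s θ ≠ 0) (h0 : HasLog (H 0)) : HasLog (H 1) := by
  let K : Set (ℝ × ℝ) := Icc 0 1 ×ˢ Icc 0 (2 * Real.pi)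
  have hK : IsCompact K := isCompact_Icc.prod isCompact_Icc
  have hHK : ContinuousOn (fun p : ℝ × ℝ => H p.1 p.2) K :=
    hH.mono (prod_mono subset_rfl (subset_univ _))
  have hcont : ∀ s ∈ Icc (0 : ℝ) 1, Continuous (H s) := fun s hs =>
    hH.comp_continuous (by fun_prop : Continuous fun θ : ℝ => (s, θ)) (fun θ => ⟨hs, mem_univ _⟩)
  obtain ⟨p0, hp0, hmin⟩ := hK.exists_isMinOn ⟨(0, 0), by simp [K, Real.pi_nonneg]⟩ hHK.norm
  set m := ‖H p0.1 p0.2‖ with hm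
  have hmpos : 0 < m := norm_pos_iff.2 (hne _ hp0.1 _)
  obtain ⟨δ, hδ, hunif⟩ := Metric.uniformContinuousOn_iff.1 (hK.uniformContinuousOn_of_continuous hHK) m hmpos
  obtain ⟨N, hN⟩ := exists_nat_one_div_lt hδ
  have hN1 : (0 : ℝ) < (N : ℝ) + 1 := by positivity
  have hstep : ∀ k : ℕ, k ≤ N + 1 → HasLog (H (k / ((N : ℝ) + 1))) := by
    intro k
    induction k with
    | zero => intro _; simpa using h0
    | succ k ih =>
      intro hk
      have hk1 : (k : ℝ) + 1 ≤ N + 1 := by exact_mod_cast hk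
      have hs1 : (k : ℝ) / ((N : ℝ) + 1) ∈ Icc (0 : ℝ) 1 :=
        ⟨by positivity, by rw [div_le_one hN1]; linarith⟩
      have hs2 : ((k + 1 : ℕ) : ℝ) / ((N : ℝ) + 1) ∈ Icc (0 : ℝ) 1 :=
        ⟨by positivity, by rw [div_le_one hN1]; push_cast; linarith⟩
      refine hasLog_near (ih (by omega)) (hcont _ hs1) (hcont _ hs2) (hp _) (hp _) fun θ => ?_
      obtain ⟨φ, hφ, he⟩ := Function.Periodic.exists_mem_Ico₀
        (f := fun t : ℝ => (H ((k : ℝ) / ((N : ℝ) + 1)) t, H (((k + 1 : ℕ) : ℝ) / ((N : ℝ) + 1)) t))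
        (c := 2 * Real.pi) (fun t => by simp only [hp _ t]) Real.two_pi_pos θ
      have he1 := congrArg Prod.fst he
      have he2 := congrArg Prod.snd he
      simp only at he1 he2
      rw [he1, he2]
      have hφ' := Ico_subset_Icc_self hφ
      have h1 := hunif (((k + 1 : ℕ) : ℝ) / ((N : ℝ) + 1), φ) ⟨hs2, hφ'⟩ ((k : ℝ) / ((N : ℝ) + 1), φ) ⟨hs1, hφ'⟩ (by
        rw [Prod.dist_eq, dist_self, max_eq_left dist_nonneg, Real.dist_eq]
        push_cast
        rw [← sub_div, add_sub_cancel_left, abs_of_pos (by positivity)]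
        exact hN)
      rw [dist_eq_norm] at h1
      exact lt_of_lt_of_le h1 (hmin (show ((k : ℝ) / ((N : ℝ) + 1), φ) ∈ K from ⟨hs1, hφ'⟩))
  have := hstep (N + 1) le_rfl
  push_cast at this
  rwa [div_self hN1.ne'] at this

lemma hasLog_real {u : ℝ → ℂ} (hc : Continuous u) (hp : Function.Periodic u (2 * Real.pi))
    (hne : ∀ θ, u θ ≠ 0) (hr : ∀ θ, (u θ).im = 0) : HasLog u := by
  have hre : ∀ θ, u θ = ((u θ).re : ℂ) := fun θ => Complex.ext (by simp) (by simp [hr θ])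
  have hne' : ∀ θ, (u θ).re ≠ 0 := fun θ h => hne θ (by rw [hre θ, h]; simp)
  have hpos : ∀ θ, 0 < (u θ).re / (u 0).re := by
    intro θ
    by_contra hcon
    push Not at hcon
    have hcc : Continuous (fun θ => (u θ).re / (u 0).re) := (Complex.continuous_re.comp hc).div_const _
    have : (0 : ℝ) ∈ range (fun θ => (u θ).re / (u 0).re) :=
      mem_range_of_exists_le_of_exists_ge hcc ⟨θ, hcon⟩ ⟨0, by rw [div_self (hne' 0)]; exact zero_le_one⟩
    obtain ⟨t, ht⟩ := this
    exact div_ne_zero (hne' t) (hne' 0) ht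
  refine ⟨fun θ => ((Real.log ((u θ).re / (u 0).re) : ℝ) : ℂ) + Complex.log (u 0), ?_, ?_, ?_⟩
  · refine (Complex.continuous_ofReal.comp ?_).add continuous_const
    exact ((Complex.continuous_re.comp hc).div_const _).log fun θ => (hpos θ).ne'
  · intro θ; simp only [hp θ]
  · intro θ
    rw [Complex.exp_add, Complex.exp_log (hne 0), ← Complex.ofReal_exp, Real.exp_log (hpos θ)]
    conv_rhs => rw [hre θ]
    conv_lhs => rw [hre 0]
    push_cast
    have : ((u 0).re : ℂ) ≠ 0 := by exact_mod_cast hne' 0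
    simp only [Complex.ofReal_re]
    field_simp

lemma hasLog_smooth {u : ℝ → ℂ} {L : ℝ → ℂ} (hLc : Continuous L) (hL : ∀ θ, Complex.exp (L θ) = u θ)
    (hu : ContDiff ℝ 4 u) : ContDiff ℝ 4 L := by
  rw [contDiff_iff_contDiffAt]
  intro θ0
  have h1 : ∀ᶠ θ in nhds θ0, |(L θ - L θ0).im| < Real.pi := by
    have : Continuous (fun θ => |(L θ - L θ0).im|) :=
      (Complex.continuous_im.comp (hLc.sub continuous_const)).abs
    exact this.continuousAt.eventually_lt continuousAt_const (by simp [Real.pi_pos])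
  have h2 : L =ᶠ[nhds θ0] fun θ => Complex.log (u θ / u θ0) + L θ0 := by
    filter_upwards [h1] with θ hθ
    rw [abs_lt] at hθ
    rw [← hL, ← hL, ← Complex.exp_sub, Complex.log_exp hθ.1 hθ.2.le]
    ring
  refine ContDiffAt.congr_of_eventuallyEq ?_ h2
  refine ContDiffAt.add ?_ contDiffAt_const
  have hne : u θ0 ≠ 0 := by rw [← hL]; exact Complex.exp_ne_zero _
  have h3 : ContDiffAt ℝ 4 Complex.log (u θ0 / u θ0) := by
    refine (Complex.contDiffAt_log (n := 4) ?_).restrict_scalars ℝ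
    rw [div_self hne]; exact one_mem_slitPlane
  exact h3.comp θ0 ((hu.div_const (u θ0)).contDiffAt)

variable {n : ℕ} {ρ : ℂ → (Fin n → ℂ) → ℝ} {R : ℝ}

lemma euclNorm_max {f : ℂ → Fin n → ℂ} (hf : MemAV f) (hR : ∀ z ∈ Circ, euclNorm (f z) ≤ R) :
    ∀ z ∈ Disk, euclNorm (f z) ≤ R := by
  intro z hz
  let e : (Fin n → ℂ) →L[ℂ] EuclideanSpace ℂ (Fin n) :=
    ((EuclideanSpace.equiv (Fin n) ℂ).symm : (Fin n → ℂ) →L[ℂ] EuclideanSpace ℂ (Fin n))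
  have h1 : DiffContOnCl ℂ (fun z => e (f z)) (ball 0 1) := by
    constructor
    · exact e.differentiable.comp_differentiableOn (differentiableOn_pi.2 fun j => (hf j).2)
    · rw [closure_ball _ one_ne_zero]
      exact e.continuous.comp_continuousOn (continuousOn_pi.2 fun j => (hf j).1)
  rw [euclNorm_eq]
  refine Complex.norm_le_of_forall_mem_frontier_norm_le isBounded_ball h1 (z := z) ?_ ?_
  · rw [frontier_ball _ one_ne_zero]
    intro w hw
    have := hR w hw
    rw [euclNorm_eq] at this
    exact this
  · rw [closure_ball _ one_ne_zero]; exact hz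

lemma periodic_exp : Function.Periodic (fun t : ℝ => Complex.exp (t * I)) (2 * Real.pi) := by
  intro t
  simp only
  push_cast
  rw [add_mul, Complex.exp_add, Complex.exp_two_pi_mul_I, mul_one]

set_option maxHeartbeats 1600000 in
lemma lam_hasLog (hρ : Cond3 n ρ R (fun _ => 0)) {f g : ℂ → Fin n → ℂ} (hf : MemAV f) (hg : MemAV g)
    (hρf : ∀ z ∈ Circ, ρ z (f z) ≤ R) (hfg : ∀ z ∈ Circ, ∑ j, f z j * g z j = 1) :
    HasLog (fun θ : ℝ => lam ρ (Complex.exp (θ * I)) (f (Complex.exp (θ * I)))) := by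
  have hfR : ∀ z ∈ Disk, euclNorm (f z) ≤ R :=
    euclNorm_max hf (fun z hz => (rho_le_R hρ hz _).1 (hρf z hz))
  have hfg' : ∀ z ∈ Disk, ∑ j, f z j * g z j = 1 :=
    MemA.eqOn (MemA.sum _ fun j _ => (hf j).mul (hg j)) (MemA.const 1) hfg
  have hfne : ∀ z ∈ Disk, f z ≠ 0 := by
    intro z hz h0
    have := hfg' z hz
    simp [h0] at this
  have h0D : (0 : ℂ) ∈ Disk := by simp [Disk]
  have hw0 := hfne 0 h0D
  have hw0p := euclNorm_pos hw0
  set w0 := f 0 with hw0def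
  have hlc : ∀ (g1 : ℝ × ℝ → Fin n → ℂ) (s : Set (ℝ × ℝ)), ContinuousOn g1 s → (∀ p ∈ s, g1 p ≠ 0) →
      ContinuousOn (fun p : ℝ × ℝ => lam ρ (Complex.exp (p.2 * I)) (g1 p)) s := by
    intro g1 s hg1 hne p hp
    have h1 := (lam_contAt hρ (p.2, g1 p) (hne p hp)).continuousAt
    exact ContinuousAt.comp_continuousWithinAt (f := fun p : ℝ × ℝ => (p.2, g1 p))
      (g := fun q : ℝ × (Fin n → ℂ) => lam ρ (Complex.exp (q.1 * I)) q.2) h1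
      (continuous_snd.continuousWithinAt.prodMk (hg1 p hp))
  -- stage zero
  have hR0 : 0 < R := by linarith [hρ.hR]
  set c0 : ℝ := R / euclNorm w0 with hc0
  have hc0p : 0 < c0 := by positivity
  have hc01 : 1 ≤ c0 := by rw [hc0, le_div_iff₀ hw0p, one_mul]; exact hfR 0 h0D
  have s2 : HasLog (fun θ : ℝ => lam ρ (Complex.exp (θ * I)) w0) := by
    have := hasLog_homotopy (fun s θ => lam ρ (Complex.exp (θ * I)) ((((1 - s) * c0 + s : ℝ) : ℂ) • w0))
      ?_ ?_ ?_ ?_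
    · simpa using this
    · refine hlc (fun p => (((1 - p.1) * c0 + p.1 : ℝ) : ℂ) • w0) _ (by fun_prop) ?_
      intro p hp
      have h1 := hp.1
      refine smul_ne_zero ?_ hw0
      have : 0 < (1 - p.1) * c0 + p.1 := by nlinarith [h1.1, h1.2]
      exact_mod_cast this.ne'
    · intro s θ
      have := periodic_exp θ
      simp only at this
      simp only [this]
    · intro s hs θ
      have h1 : 0 < (1 - s) * c0 + s := by nlinarith [hs.1, hs.2]
      refine lam_ne hρ (exp_mem_Circ θ) (smul_ne_zero (by exact_mod_cast h1.ne') hw0) ?_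
      rw [euclNorm_smul, Complex.norm_real, Real.norm_of_nonneg h1.le]
      have h2 : c0 * euclNorm w0 = R := by rw [hc0]; field_simp
      have h3 : (1 - s) * c0 + s ≤ c0 := by nlinarith [hs.1]
      nlinarith
    · have h2 : euclNorm ((c0 : ℂ) • w0) = R := by
        rw [euclNorm_smul, Complex.norm_real, Real.norm_of_nonneg hc0p.le, hc0]; field_simp
      have hne2 : (c0 : ℂ) • w0 ≠ 0 := smul_ne_zero (by exact_mod_cast hc0p.ne') hw0
      have h3 : HasLog (fun θ : ℝ => lam ρ (Complex.exp (θ * I)) ((c0 : ℂ) • w0)) := by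
        refine hasLog_real ?_ ?_ ?_ ?_
        · have := hlc (fun _ => (c0 : ℂ) • w0) univ continuousOn_const (fun _ _ => hne2)
          rw [continuousOn_univ] at this
          have h5 : Continuous fun θ : ℝ => ((0 : ℝ), θ) := by fun_prop
          exact Continuous.comp (f := fun θ : ℝ => ((0 : ℝ), θ)) this h5
        · intro θ
          have := periodic_exp θ
          simp only at this
          simp only [this]
        · exact fun θ => lam_ne hρ (exp_mem_Circ θ) hne2 h2.le
        · exact fun θ => lam_real hρ (exp_mem_Circ θ) h2
      simpa using h3
  have hD : ∀ s ∈ Icc (0 : ℝ) 1, ∀ θ : ℝ, (s : ℂ) * Complex.exp (θ * I) ∈ Disk := by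
    intro s hs θ
    simp only [Disk, mem_closedBall, dist_zero_right, norm_mul, Complex.norm_real,
      Complex.norm_exp_ofReal_mul_I, mul_one]
    rw [Real.norm_of_nonneg hs.1]; exact hs.2
  have := hasLog_homotopy (fun s θ => lam ρ (Complex.exp (θ * I)) (f ((s : ℂ) * Complex.exp (θ * I))))
    ?_ ?_ ?_ ?_
  · simpa using this
  · refine hlc (fun p => f ((p.1 : ℂ) * Complex.exp (p.2 * I))) _ ?_ ?_
    · have hfc : ContinuousOn f Disk := continuousOn_pi.2 fun j => (hf j).1
      exact hfc.comp (by fun_prop) (fun p hp => hD p.1 hp.1 p.2)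
    · exact fun p hp => hfne _ (hD p.1 hp.1 p.2)
  · intro s θ
    have := periodic_exp θ
    simp only at this
    simp only [this]
  · intro s hs θ
    exact lam_ne hρ (exp_mem_Circ θ) (hfne _ (hD s hs θ)) (hfR _ (hD s hs θ))
  · simpa using s2

end Logs

/-! part 12 -/
set_option linter.unusedSectionVars false
open Complex Metric MeasureTheory Filter Set

section Conj

/-- lift of a periodic function to the circle -/
noncomputable def lf (w : ℝ → ℂ) (hc : Continuous w) (hp : Function.Periodic w (2 * Real.pi)) : C(TT, ℂ) where
  toFun t := hp.lift t
  continuous_toFun := by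
    have hq : IsOpenQuotientMap (QuotientAddGroup.mk : ℝ → TT) := QuotientAddGroup.isOpenQuotientMap_mk
    rw [hq.isQuotientMap.continuous_iff]
    exact hc

lemma lf_coe (w : ℝ → ℂ) (hc : Continuous w) (hp : Function.Periodic w (2 * Real.pi)) (θ : ℝ) :
    lf w hc hp (θ : TT) = w θ := rfl

lemma periodic_deriv {w : ℝ → ℂ} {T : ℝ} (hp : Function.Periodic w T) : Function.Periodic (deriv w) T := by
  intro θ
  have : (fun x => w (x + T)) = w := funext hp
  rw [← deriv_comp_add_const w T θ, this]

lemma coeff_decay (k : ℕ) : ∀ (w : ℝ → ℂ) (hw : ContDiff ℝ k w) (hp : Function.Periodic w (2 * Real.pi)),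
    ∃ C : ℝ, ∀ j : ℤ, |(j : ℝ)| ^ k * ‖fourierCoeff (lf w hw.continuous hp) j‖ ≤ C := by
  induction k with
  | zero =>
    intro w hw hp
    refine ⟨‖toL2 (lf w hw.continuous hp)‖, fun j => ?_⟩
    rw [pow_zero, one_mul, ← inner_fA_coeff]
    refine (norm_inner_le_norm _ _).trans ?_
    have h1 : ‖toL2 (fA j (1 : ℂ))‖ = 1 := by
      have h := inner_fA j j (1 : ℂ) 1
      simp only [if_true] at h
      have h1 := congrArg RCLike.re h
      rw [inner_self_eq_norm_sq, inner_self_eq_norm_sq] at h1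
      have := (pow_left_inj₀ (norm_nonneg _) (norm_nonneg _) two_ne_zero).1 h1
      rw [this, norm_one]
    rw [h1, one_mul]
  | succ k ih =>
    intro w hw hp
    have hd : ContDiff ℝ k (deriv w) := by
      have := (contDiff_succ_iff_deriv (n := k) (f := w)).1 (by exact_mod_cast hw)
      exact this.2.2
    obtain ⟨C, hC⟩ := ih (deriv w) hd (periodic_deriv hp)
    refine ⟨C, fun j => ?_⟩
    have h := ibp_coeff (lf w hw.continuous hp) (lf (deriv w) hd.continuous (periodic_deriv hp))
      (fun θ => by
        change HasDerivAt w (deriv w θ) θ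
        exact ((hw.differentiable (by simp)) θ).hasDerivAt) j (1 : ℂ)
    rw [inner_fA_coeff, inner_fA_coeff] at h
    have h2 := hC j
    rw [h, norm_mul, norm_mul, norm_I, one_mul, Complex.norm_intCast] at h2
    rw [pow_succ]
    linarith

lemma coeff_conj (u : C(TT, ℂ)) (hu : ∀ t, (starRingEnd ℂ) (u t) = u t) (j : ℤ) :
    fourierCoeff u (-j) = (starRingEnd ℂ) (fourierCoeff u j) := by
  unfold fourierCoeff
  rw [← integral_conj]
  congr 1
  ext t
  simp only [smul_eq_mul, map_mul, hu, neg_neg]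
  rw [fourier_neg, Complex.conj_conj]

lemma conj_ext (τ : ℝ → ℝ) (hτ : ContDiff ℝ 4 τ) (hp : Function.Periodic τ (2 * Real.pi)) :
    ∃ Y : ℂ → ℂ, MemA Y ∧ ContDiff ℝ 2 (fun θ : ℝ => Y (Complex.exp (θ * I))) ∧
      ∀ θ : ℝ, (Y (Complex.exp (θ * I))).im = τ θ := by
  have hw : ContDiff ℝ (4 : ℕ) (fun θ => (τ θ : ℂ)) := Complex.ofRealCLM.contDiff.comp hτ
  have hwp : Function.Periodic (fun θ => (τ θ : ℂ)) (2 * Real.pi) := fun θ => by simp only [hp θ]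
  set u := lf _ hw.continuous hwp with hu
  obtain ⟨C, hC⟩ := coeff_decay 4 _ hw hwp
  rw [← hu] at hC
  have hC0 : 0 ≤ C := le_trans (by positivity) (hC 0)
  have hreal : ∀ t, (starRingEnd ℂ) (u t) = u t := by
    intro t
    induction t using QuotientAddGroup.induction_on with
    | H θ => change (starRingEnd ℂ) (τ θ : ℂ) = (τ θ : ℂ); exact Complex.conj_ofReal _
  have hcj := coeff_conj u hreal
  -- bounds
  have hb : ∀ (m : ℕ), m ≤ 2 → ∀ j : ℕ, (j : ℝ) ^ m * ‖fourierCoeff u j‖ ≤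
      (if j = 0 then ‖fourierCoeff u 0‖ else 0) + C * (1 / (j : ℝ) ^ 2) := by
    intro m hm j
    by_cases hj : j = 0
    · subst hj
      simp only [if_true, Nat.cast_zero]
      rcases Nat.eq_zero_or_pos m with h | h
      · subst h; simp
      · rw [zero_pow (by omega)]; simp
    · simp only [hj, if_false, zero_add]
      have hj1 : (1 : ℝ) ≤ j := by exact_mod_cast Nat.one_le_iff_ne_zero.2 hj
      have h := hC j
      simp only [Int.cast_natCast, Nat.abs_cast] at h
      rw [mul_one_div, le_div_iff₀ (by positivity)]
      refine le_trans ?_ h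
      have : (j : ℝ) ^ m ≤ (j : ℝ) ^ 2 := pow_le_pow_right₀ hj1 hm
      have h3 : (j : ℝ) ^ 4 = (j : ℝ) ^ 2 * (j : ℝ) ^ 2 := by ring
      rw [h3]
      have := mul_le_mul_of_nonneg_right (mul_le_mul_of_nonneg_right this (norm_nonneg (fourierCoeff u j)))
        (by positivity : (0 : ℝ) ≤ (j : ℝ) ^ 2)
      linarith
  have hbs : Summable (fun j : ℕ => (if j = 0 then ‖fourierCoeff u 0‖ else 0) + C * (1 / (j : ℝ) ^ 2)) := by
    refine Summable.add ?_ ((Real.summable_one_div_nat_pow.2 (by norm_num)).mul_left C)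
    exact (hasSum_ite_eq 0 _).summable
  have hsN : Summable (fun j : ℕ => ‖fourierCoeff u j‖) :=
    Summable.of_nonneg_of_le (fun _ => norm_nonneg _) (fun j => by simpa using hb 0 (by norm_num) j) hbs
  have hsZ : Summable (fourierCoeff u) := by
    refine Summable.of_norm ?_
    refine Summable.of_nat_of_neg hsN ?_
    refine hsN.congr fun j => ?_
    rw [hcj, RCLike.norm_conj]
  let c : ℕ → ℂ := fun k => 2 * I * fourierCoeff u k
  have hcs : Summable (fun k => ‖c k‖) := by
    refine (hsN.mul_left 2).congr fun k => ?_
    simp [c]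
  have hexp : ∀ (k : ℕ) (θ : ℝ), Complex.exp (θ * I) ^ k = Complex.exp ((k * I) * θ) := by
    intro k θ
    rw [← Complex.exp_nat_mul]; congr 1; ring
  refine ⟨fun z => (∑' k : ℕ, c k * z ^ k) - I * fourierCoeff u 0,
    (memA_series c hcs).sub (MemA.const _), ?_, ?_⟩
  · refine ContDiff.sub ?_ contDiff_const
    have hit : ∀ (m k : ℕ), iteratedDeriv m (fun θ : ℝ => c k * Complex.exp (θ * I) ^ k) =
        fun θ : ℝ => (k * I) ^ m * (c k * Complex.exp (θ * I) ^ k) := by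
      intro m k
      induction m with
      | zero => simp
      | succ m ih =>
        rw [iteratedDeriv_succ, ih]
        ext θ
        refine HasDerivAt.deriv ?_
        simp only [hexp]
        have h1 : HasDerivAt (fun θ : ℝ => ((k : ℂ) * I) * (θ : ℂ)) ((k * I) * 1) θ :=
          (Complex.ofRealCLM.hasDerivAt (x := θ)).const_mul _
        refine (((h1.cexp).const_mul (c k)).const_mul ((k * I) ^ m)).congr_deriv ?_
        ring
    refine contDiff_tsum (𝕜 := ℝ) (N := 2) (f := fun (k : ℕ) (θ : ℝ) => c k * Complex.exp (θ * I) ^ k)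
      (v := fun m k => 2 * ((if k = 0 then ‖fourierCoeff u 0‖ else 0) + C * (1 / (k : ℝ) ^ 2))) ?_ ?_ ?_
    · intro k
      simp only [hexp]
      exact contDiff_const.mul ((contDiff_const.mul Complex.ofRealCLM.contDiff).cexp)
    · intro m _
      exact hbs.mul_left 2
    · intro m k θ hm
      have hm2 : m ≤ 2 := by exact_mod_cast hm
      rw [norm_iteratedFDeriv_eq_norm_iteratedDeriv, hit]
      have := hb m hm2 k
      have h1 : ‖((k : ℂ) * I) ^ m * (c k * Complex.exp (θ * I) ^ k)‖ =
          2 * ((k : ℝ) ^ m * ‖fourierCoeff u k‖) := by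
        simp only [c, norm_mul, norm_pow, norm_I, Complex.norm_exp_ofReal_mul_I]
        simp
        ring
      rw [h1]
      linarith
  · intro θ
    have h := (has_pointwise_sum_fourier_series_of_summable hsZ (θ : TT)).nat_add_neg
    rw [hu, lf_coe, ← hu] at h
    have hs : HasSum (fun k : ℕ => c k * Complex.exp (θ * I) ^ k) (∑' k : ℕ, c k * Complex.exp (θ * I) ^ k) := by
      refine Summable.hasSum (Summable.of_norm (hcs.congr fun k => ?_))
      simp [Complex.norm_exp_ofReal_mul_I]
    have h1 := Complex.imCLM.hasSum hs
    have h2 := Complex.reCLM.hasSum h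
    have he : (fun b : ℕ => Complex.reCLM (fourierCoeff u (b : ℤ) • (fourier (b : ℤ) (θ : TT) : ℂ) +
        fourierCoeff u (-(b : ℤ)) • (fourier (-(b : ℤ)) (θ : TT) : ℂ))) =
        fun k : ℕ => Complex.imCLM (c k * Complex.exp (θ * I) ^ k) := by
      ext k
      rw [hcj, fourier_neg, smul_eq_mul, smul_eq_mul, ← map_mul, fourier_exp, zpow_natCast]
      simp only [Complex.imCLM_apply, Complex.reCLM_apply, c]
      rw [Complex.add_re, Complex.conj_re, mul_assoc, show (2 : ℂ) * I = I * ((2 : ℝ) : ℂ) by push_cast; ring,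
        mul_assoc, Complex.I_mul_im, Complex.re_ofReal_mul]
      ring
    rw [he] at h2
    have h3 := h1.unique h2
    simp only [Complex.imCLM_apply, Complex.reCLM_apply] at h3
    rw [Complex.sub_im, h3, fourier_zero, Complex.I_mul_im]
    simp

lemma exists_X (u : ℝ → ℂ) (hu : ContDiff ℝ 4 u) (hL : HasLog u) :
    ∃ Y : ℂ → ℂ, MemA Y ∧ ContDiff ℝ 2 (fun θ : ℝ => Y (Complex.exp (θ * I))) ∧
      ∃ r : ℝ → ℝ, Continuous r ∧ Function.Periodic r (2 * Real.pi) ∧ (∀ θ, 0 < r θ) ∧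
        ∀ θ : ℝ, u θ = r θ * Complex.exp (Y (Complex.exp (θ * I))) := by
  obtain ⟨L, hLc, hLp, hL⟩ := hL
  have hLs := hasLog_smooth hLc hL hu
  obtain ⟨Y, hY, hYs, hYi⟩ := conj_ext (fun θ => (L θ).im) (Complex.imCLM.contDiff.comp hLs)
    (fun θ => by simp only [hLp θ])
  refine ⟨Y, hY, hYs, fun θ => Real.exp ((L θ).re - (Y (Complex.exp (θ * I))).re), ?_, ?_, fun θ => Real.exp_pos _, ?_⟩
  · have := hYs.continuous
    exact Real.continuous_exp.comp ((Complex.continuous_re.comp hLc).sub (Complex.continuous_re.comp this))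
  · intro θ
    simp only [hLp θ, periodic_exp θ]
  · intro θ
    rw [← hL, Complex.ofReal_exp, ← Complex.exp_add]
    congr 1
    apply Complex.ext
    · simp
    · simp [hYi]
end Conj

/-! part 13 -/
set_option linter.unusedSectionVars false
open Complex Metric MeasureTheory Filter Set

section Concrete

/-- the space of unknowns -/
abbrev AA (n : ℕ) : Type := EuclideanSpace ℂ (Option (Fin n))

/-- the boundary data of the unperturbed solution -/
structure Dat (n : ℕ) (ρ : ℂ → (Fin n → ℂ) → ℝ) (R : ℝ) where
  f : ℝ → Fin n → ℂ
  g : ℝ → Fin n → ℂ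
  X : ℝ → ℂ
  r : ℝ → ℝ
  hρ : Cond3 n ρ R (fun _ => 0)
  hf : ContDiff ℝ 2 f
  hg : ContDiff ℝ 2 g
  hX : ContDiff ℝ 2 X
  hr : Continuous r
  pf : Function.Periodic f (2 * Real.pi)
  pg : Function.Periodic g (2 * Real.pi)
  pX : Function.Periodic X (2 * Real.pi)
  pr : Function.Periodic r (2 * Real.pi)
  X0 : ∀ θ, X θ ≠ 0
  r0 : ∀ θ, 0 < r θ
  fg : ∀ θ, ∑ j, f θ j * g θ j = 1
  pd : ∀ (θ : ℝ) j, wderiv (ρ (Complex.exp (θ * I))) (f θ) j = r θ * X θ * g θ j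

variable {n : ℕ} {ρ : ℂ → (Fin n → ℂ) → ℝ} {R : ℝ} (D : Dat n ρ R)

namespace Dat

noncomputable def ft (θ : ℝ) (j : Fin n) : ℂ := D.f θ j / D.X θ
noncomputable def gt (θ : ℝ) (j : Fin n) : ℂ := D.X θ * D.g θ j

lemma hft : ContDiff ℝ 2 D.ft := by
  rw [contDiff_pi]
  intro j
  simp only [ft, div_eq_mul_inv]
  exact (contDiff_pi.1 D.hf j).mul (D.hX.inv D.X0)

lemma hgt : ContDiff ℝ 2 D.gt := by
  rw [contDiff_pi]
  intro j
  exact D.hX.mul (contDiff_pi.1 D.hg j)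

lemma pft : Function.Periodic D.ft (2 * Real.pi) := by
  intro θ; funext j; simp only [ft, D.pf θ, D.pX θ]

lemma pgt : Function.Periodic D.gt (2 * Real.pi) := by
  intro θ; funext j; simp only [gt, D.pg θ, D.pX θ]

/-- `g̃ · κ` -/
noncomputable def gk (p : ℝ × ((Fin n → ℂ) × AA n)) : ℂ := ∑ i, D.gt p.1 i * p.2.2 (some i)

/-- the perturbed disc -/
noncomputable def FF (p : ℝ × ((Fin n → ℂ) × AA n)) (j : Fin n) : ℂ :=
  D.f p.1 j + p.2.1 j + p.2.2 none * D.ft p.1 j + p.2.2 (some j) - D.gk p * D.ft p.1 j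

/-- gradient at the perturbed disc -/
noncomputable def pp (p : ℝ × ((Fin n → ℂ) × AA n)) : Fin n → ℂ := _root_.pd ρ (p.1, D.FF p)

noncomputable def den (p : ℝ × ((Fin n → ℂ) × AA n)) : ℂ := ∑ j, D.f p.1 j * D.pp p j

noncomputable def num (p : ℝ × ((Fin n → ℂ) × AA n)) : ℂ := ∑ j, D.FF p j * D.pp p j

noncomputable def vv (N0 : ℝ) (p : ℝ × ((Fin n → ℂ) × AA n)) : Option (Fin n) → ℂ
  | none => ((N0 * rt ρ (p.1, D.FF p) : ℝ) : ℂ)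
  | some i => D.X p.1 * D.pp p i / D.den p + D.gt p.1 i * (starRingEnd ℂ) (D.gk p)

lemma contDiff_coord (i : Option (Fin n)) :
    ContDiff ℝ 2 (fun p : ℝ × ((Fin n → ℂ) × AA n) => p.2.2 i) := by
  have h : ContDiff ℝ 2 (fun a : AA n => a i) :=
    ((EuclideanSpace.proj i : AA n →L[ℂ] ℂ).restrictScalars ℝ).contDiff
  exact h.comp (contDiff_snd.comp contDiff_snd)

lemma gk_contDiff : ContDiff ℝ 2 D.gk := by
  unfold gk
  refine ContDiff.sum fun i _ => ?_
  exact ((contDiff_pi.1 D.hgt i).comp contDiff_fst).mul (contDiff_coord _)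

lemma FF_contDiff : ContDiff ℝ 2 D.FF := by
  rw [contDiff_pi]
  intro j
  unfold FF
  have h1 := (contDiff_pi.1 D.hf j).comp (contDiff_fst (E := ℝ) (F := (Fin n → ℂ) × AA n))
  have h2 := (contDiff_pi.1 D.hft j).comp (contDiff_fst (E := ℝ) (F := (Fin n → ℂ) × AA n))
  have h3 : ContDiff ℝ 2 (fun p : ℝ × ((Fin n → ℂ) × AA n) => p.2.1 j) :=
    (contDiff_apply ℝ ℂ j).comp (contDiff_fst.comp contDiff_snd)
  exact (((h1.add h3).add ((contDiff_coord _).mul h2)).add (contDiff_coord _)).sub (D.gk_contDiff.mul h2)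

lemma pp_contDiffAt {p : ℝ × ((Fin n → ℂ) × AA n)} (h : D.FF p ≠ 0) : ContDiffAt ℝ 2 D.pp p := by
  have h1 := (pd_contDiffAt D.hρ (p.1, D.FF p) h).of_le (m := 2) (by norm_num)
  exact h1.comp p (contDiff_fst.contDiffAt.prodMk D.FF_contDiff.contDiffAt)

lemma den_contDiffAt {p : ℝ × ((Fin n → ℂ) × AA n)} (h : D.FF p ≠ 0) : ContDiffAt ℝ 2 D.den p := by
  unfold den
  refine ContDiffAt.sum fun j _ => ?_
  exact ((contDiff_pi.1 D.hf j).comp contDiff_fst).contDiffAt.mul (contDiffAt_pi.1 (D.pp_contDiffAt h) j)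

lemma num_contDiffAt {p : ℝ × ((Fin n → ℂ) × AA n)} (h : D.FF p ≠ 0) : ContDiffAt ℝ 2 D.num p := by
  unfold num
  refine ContDiffAt.sum fun j _ => ?_
  exact (contDiff_pi.1 D.FF_contDiff j).contDiffAt.mul (contDiffAt_pi.1 (D.pp_contDiffAt h) j)

lemma vv_contDiffAt (N0 : ℝ) {p : ℝ × ((Fin n → ℂ) × AA n)} (h : D.FF p ≠ 0) (hd : D.den p ≠ 0)
    (i : Option (Fin n)) : ContDiffAt ℝ 2 (fun p => D.vv N0 p i) p := by
  cases i with
  | none =>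
    have h1 := (rt_contDiffAt D.hρ (p.1, D.FF p) h).of_le (m := 2) (by norm_num)
    have h2 : ContDiffAt ℝ 2 (fun p => rt ρ (p.1, D.FF p)) p :=
      ContDiffAt.comp (g := rt ρ) (f := fun p => (p.1, D.FF p)) p h1
        (contDiff_fst.contDiffAt.prodMk D.FF_contDiff.contDiffAt)
    exact Complex.ofRealCLM.contDiff.contDiffAt.comp p (contDiffAt_const.mul h2)
  | some i =>
    have h1 : ContDiffAt ℝ 2 (fun p : ℝ × ((Fin n → ℂ) × AA n) => D.X p.1) p :=
      (D.hX.comp contDiff_fst).contDiffAt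
    have h2 : ContDiffAt ℝ 2 (fun p : ℝ × ((Fin n → ℂ) × AA n) => D.gt p.1 i) p :=
      ((contDiff_pi.1 D.hgt i).comp contDiff_fst).contDiffAt
    have h3 : ContDiffAt ℝ 2 (fun p => (starRingEnd ℂ) (D.gk p)) p :=
      Complex.conjCLE.contDiff.contDiffAt.comp p D.gk_contDiff.contDiffAt
    simp only [vv, div_eq_mul_inv]
    exact ((h1.mul (contDiffAt_pi.1 (D.pp_contDiffAt h) i)).mul ((D.den_contDiffAt h).inv hd)).add (h2.mul h3)

lemma FF_zero (θ : ℝ) : D.FF (θ, 0) = D.f θ := by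
  funext j; simp [FF, gk]

lemma f_ne (θ : ℝ) : D.f θ ≠ 0 := by
  intro h
  have := D.fg θ
  simp [h] at this

lemma pp_zero (θ : ℝ) (j : Fin n) : D.pp (θ, 0) j = D.r θ * D.X θ * D.g θ j := by
  rw [pp, FF_zero]
  exact D.pd θ j

lemma den_zero (θ : ℝ) : D.den (θ, 0) = D.r θ * D.X θ := by
  simp only [den, pp_zero]
  have h : ∑ j, D.f θ j * (D.r θ * D.X θ * D.g θ j) = D.r θ * D.X θ * ∑ j, D.f θ j * D.g θ j := by
    rw [Finset.mul_sum]
    exact Finset.sum_congr rfl fun j _ => by ring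
  rw [h, D.fg, mul_one]

lemma num_zero (θ : ℝ) : D.num (θ, 0) = D.r θ * D.X θ := by
  rw [← den_zero]; simp only [num, den, FF_zero]

lemma rX_ne (θ : ℝ) : (D.r θ : ℂ) * D.X θ ≠ 0 :=
  mul_ne_zero (by exact_mod_cast (D.r0 θ).ne') (D.X0 θ)

lemma gk_zero (θ : ℝ) : D.gk (θ, 0) = 0 := by simp [gk]

lemma vv_zero_none (N0 θ : ℝ) : D.vv N0 (θ, 0) none = ((N0 * rt ρ (θ, D.f θ) : ℝ) : ℂ) := by
  simp only [vv, FF_zero]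

lemma vv_zero_some (N0 θ : ℝ) (i : Fin n) : D.vv N0 (θ, 0) (some i) = D.X θ * D.g θ i := by
  simp only [vv, gk_zero, map_zero, mul_zero, add_zero, den_zero, pp_zero]
  have := D.rX_ne θ
  have h1 : (D.r θ : ℂ) ≠ 0 := by exact_mod_cast (D.r0 θ).ne'
  have h2 := D.X0 θ
  field_simp

/-- the good set -/
def good (p : ℝ × ((Fin n → ℂ) × AA n)) : Prop :=
  D.FF p ≠ 0 ∧ D.den p ≠ 0 ∧ D.num p ≠ 0 ∧ ‖D.num p / D.den p - 1‖ < 1 / 2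

lemma good_near (θ : ℝ) : ∀ᶠ p in nhds ((θ, 0) : ℝ × ((Fin n → ℂ) × AA n)), D.good p := by
  have hF0 : D.FF (θ, 0) ≠ 0 := by rw [FF_zero]; exact D.f_ne θ
  have hd0 : D.den (θ, 0) ≠ 0 := by rw [den_zero]; exact D.rX_ne θ
  have hn0 : D.num (θ, 0) ≠ 0 := by rw [num_zero]; exact D.rX_ne θ
  have h1 := D.FF_contDiff.continuous.continuousAt.eventually_ne hF0
  have h2 := (D.den_contDiffAt hF0).continuousAt.eventually_ne hd0
  have h3 := (D.num_contDiffAt hF0).continuousAt.eventually_ne hn0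
  have h4 : ContinuousAt (fun p => ‖D.num p / D.den p - 1‖) (θ, 0) :=
    (((D.num_contDiffAt hF0).continuousAt.div (D.den_contDiffAt hF0).continuousAt hd0).sub
      continuousAt_const).norm
  have h5 := h4.eventually_lt (g := fun _ => (1 / 2 : ℝ)) continuousAt_const (by
    rw [num_zero, den_zero, div_self (D.rX_ne θ)]; norm_num)
  filter_upwards [h1, h2, h3, h5] with p a b c d using ⟨a, b, c, d⟩

lemma FF_per (θ : ℝ) (y) : D.FF (θ + 2 * Real.pi, y) = D.FF (θ, y) := by
  funext j; simp only [FF, gk, D.pf θ, D.pft θ, D.pgt θ]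

lemma pp_per (θ : ℝ) (y) : D.pp (θ + 2 * Real.pi, y) = D.pp (θ, y) := by
  funext j
  simp only [pp, FF_per]
  simp only [_root_.pd]
  have := periodic_exp θ
  simp only at this
  rw [this]

lemma den_per (θ : ℝ) (y) : D.den (θ + 2 * Real.pi, y) = D.den (θ, y) := by
  simp only [den, pp_per, D.pf θ]

lemma num_per (θ : ℝ) (y) : D.num (θ + 2 * Real.pi, y) = D.num (θ, y) := by
  simp only [num, pp_per, FF_per]

lemma vv_per (N0 θ : ℝ) (y) : D.vv N0 (θ + 2 * Real.pi, y) = D.vv N0 (θ, y) := by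
  funext i
  have := periodic_exp θ
  simp only at this
  cases i with
  | none => simp only [vv, FF_per, rt]; rw [this]
  | some i => simp only [vv, den_per, pp_per, gk, D.pX θ, D.pgt θ]

lemma good_per (θ : ℝ) (y) : D.good (θ + 2 * Real.pi, y) ↔ D.good (θ, y) := by
  simp only [good, FF_per, den_per, num_per]

lemma good_tube : ∃ ε > 0, ∀ (θ : ℝ) (y : (Fin n → ℂ) × AA n), ‖y‖ < ε → D.good (θ, y) := by
  have h := (isCompact_Icc (a := (0 : ℝ)) (b := 2 * Real.pi)).eventually_forall_of_forall_eventually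
    (x₀ := (0 : (Fin n → ℂ) × AA n)) (P := fun y θ => D.good (θ, y)) (by
      intro θ _
      have h1 : Tendsto (fun q : ((Fin n → ℂ) × AA n) × ℝ => (q.2, q.1)) (nhds (0, θ)) (nhds (θ, 0)) :=
        (continuous_swap.tendsto _)
      exact h1.eventually (D.good_near θ))
  obtain ⟨ε, hε, h⟩ := Metric.eventually_nhds_iff.1 h
  refine ⟨ε, hε, fun θ y hy => ?_⟩
  have hper : Function.Periodic (fun θ => D.good (θ, y)) (2 * Real.pi) :=
    fun θ => propext (D.good_per θ y)
  obtain ⟨φ, hφ, he⟩ := hper.exists_mem_Ico₀ Real.two_pi_pos θ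
  have := h (by simpa using hy) φ ⟨hφ.1, hφ.2.le⟩
  exact he ▸ this

end Dat

/-- cutoff -/
lemma exists_cutoff {E : Type*} [NormedAddCommGroup E] [NormedSpace ℝ E] [HasContDiffBump E]
    {ε : ℝ} (hε : 0 < ε) : ∃ T : E → E, ContDiff ℝ 2 T ∧ (∀ y, ‖T y‖ < ε) ∧
      ∀ y, ‖y‖ < ε / 4 → T y = y := by
  let χ : ContDiffBump (0 : E) := ⟨ε / 4, ε / 2, by positivity, by linarith⟩
  refine ⟨fun y => χ y • y, χ.contDiff.smul contDiff_id, fun y => ?_, fun y hy => ?_⟩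
  · rw [norm_smul, Real.norm_of_nonneg χ.nonneg]
    by_cases h : ‖y‖ < ε / 2
    · have := mul_le_of_le_one_left (norm_nonneg y) (χ.le_one (x := y))
      linarith
    · rw [χ.zero_of_le_dist (by simpa [χ] using h)]
      simpa using hε
  · simp only
    rw [χ.one_of_mem_closedBall (by simpa [χ] using hy.le), one_smul]

end Concrete

/-! part 14 -/
set_option linter.unusedSectionVars false
open Complex Metric MeasureTheory Filter Set

section Coercive
variable {n : ℕ} {ρ : ℂ → (Fin n → ℂ) → ℝ} {R : ℝ} (D : Dat n ρ R)
namespace Dat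

/-- projection on the complex tangent space -/
noncomputable def pk (θ : ℝ) (a : AA n) (j : Fin n) : ℂ :=
  a (some j) - (∑ i, D.gt θ i * a (some i)) * D.ft θ j

noncomputable def hh (θ : ℝ) (a : AA n) (j : Fin n) : ℂ := a none * D.ft θ j + D.pk θ a j

/-- derivative of the gradient -/
noncomputable def Dp (θ : ℝ) : (Fin n → ℂ) →L[ℝ] (Fin n → ℂ) :=
  (fderiv ℝ (_root_.pd ρ) (θ, D.f θ)).comp (ContinuousLinearMap.inr ℝ ℝ (Fin n → ℂ))

lemma Dp_has (θ : ℝ) : HasFDerivAt (fun w => _root_.pd ρ (θ, w)) (D.Dp θ) (D.f θ) := by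
  have h1 := ((pd_contDiffAt D.hρ (θ, D.f θ) (D.f_ne θ)).differentiableAt (by norm_num)).hasFDerivAt
  have h2 : HasFDerivAt (fun w : Fin n → ℂ => (θ, w)) (ContinuousLinearMap.inr ℝ ℝ (Fin n → ℂ)) (D.f θ) :=
    hasFDerivAt_prodMk_right θ (D.f θ)
  exact HasFDerivAt.comp (g := _root_.pd ρ) (f := fun w : Fin n → ℂ => (θ, w)) _ h1 h2

lemma Dp_cont : Continuous D.Dp := by
  have h : Continuous (fun θ => fderiv ℝ (_root_.pd ρ) (θ, D.f θ)) := by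
    rw [continuous_iff_continuousAt]
    intro θ
    have h1 : ContDiffAt ℝ 1 (fderiv ℝ (_root_.pd ρ)) (θ, D.f θ) :=
      (pd_contDiffAt D.hρ (θ, D.f θ) (D.f_ne θ)).fderiv_right (by norm_num)
    exact ContinuousAt.comp (g := fderiv ℝ (_root_.pd ρ)) (f := fun θ => (θ, D.f θ)) h1.continuousAt
      (continuousAt_id.prodMk D.hf.continuous.continuousAt)
  exact h.clm_comp continuous_const

lemma FF_line (θ t : ℝ) (a : AA n) : D.FF (θ, ((0 : Fin n → ℂ), t • a)) = D.f θ + t • D.hh θ a := by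
  funext j
  simp only [FF, gk, hh, pk, PiLp.smul_apply, Pi.add_apply, Pi.smul_apply, Pi.zero_apply, Complex.real_smul]
  have : ∑ i, D.gt θ i * ((t : ℂ) * a (some i)) = t * ∑ i, D.gt θ i * a (some i) := by
    rw [Finset.mul_sum]; exact Finset.sum_congr rfl fun _ _ => by ring
  rw [this]; ring

lemma gtft (θ : ℝ) : ∑ j, D.gt θ j * D.ft θ j = 1 := by
  rw [← D.fg θ]
  refine Finset.sum_congr rfl fun j _ => ?_
  have := D.X0 θ
  simp only [gt, ft]; field_simp

lemma g_pk (θ : ℝ) (a : AA n) : ∑ j, D.gt θ j * D.pk θ a j = 0 := by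
  have h : ∑ j, D.gt θ j * D.pk θ a j = (∑ i, D.gt θ i * a (some i)) -
      (∑ i, D.gt θ i * a (some i)) * ∑ j, D.gt θ j * D.ft θ j := by
    rw [Finset.mul_sum, ← Finset.sum_sub_distrib]
    exact Finset.sum_congr rfl fun j _ => by simp only [pk]; ring
  rw [h, gtft]; ring

lemma g_hh (θ : ℝ) (a : AA n) : ∑ j, D.gt θ j * D.hh θ a j = a none := by
  have h : ∑ j, D.gt θ j * D.hh θ a j = a none * (∑ j, D.gt θ j * D.ft θ j) +
      ∑ j, D.gt θ j * D.pk θ a j := by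
    rw [Finset.mul_sum, ← Finset.sum_add_distrib]
    exact Finset.sum_congr rfl fun j _ => by simp only [hh]; ring
  rw [h, gtft, g_pk]; ring

lemma line_has (θ : ℝ) (h : Fin n → ℂ) : HasDerivAt (fun t : ℝ => D.f θ + t • h) h 0 := by
  have := ((hasDerivAt_id (0 : ℝ)).smul_const h).const_add (D.f θ)
  simpa using this

lemma pp_line (θ : ℝ) (a : AA n) :
    HasDerivAt (fun t : ℝ => D.pp (θ, ((0 : Fin n → ℂ), t • a))) (D.Dp θ (D.hh θ a)) 0 := by
  have h1 := D.Dp_has θ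
  have e : D.f θ = D.f θ + (0 : ℝ) • D.hh θ a := by simp
  rw [e] at h1
  have h := HasFDerivAt.comp_hasDerivAt (0 : ℝ) h1 (D.line_has θ (D.hh θ a))
  refine h.congr_of_eventuallyEq (Eventually.of_forall fun t => ?_)
  simp only [pp, FF_line]; rfl

lemma vv_line_none (N0 θ : ℝ) (a : AA n) :
    HasDerivAt (fun t : ℝ => D.vv N0 (θ, ((0 : Fin n → ℂ), t • a)) none)
      ((2 * N0 * D.r θ * (a none).re : ℝ) : ℂ) 0 := by
  have hc := (rho_contDiffAt D.hρ (exp_mem_Circ θ) (D.f_ne θ)).differentiableAt (by norm_num)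
  have h1 := hc.hasFDerivAt
  have e : D.f θ = D.f θ + (0 : ℝ) • D.hh θ a := by simp
  rw [e] at h1
  have h := HasFDerivAt.comp_hasDerivAt (0 : ℝ) h1 (D.line_has θ (D.hh θ a))
  rw [← e] at h
  have h2 := re_sum_wderiv (ρ (Complex.exp (θ * I))) (D.f θ) (D.hh θ a)
  have h3 : ∑ j, D.hh θ a j * wderiv (ρ (Complex.exp (θ * I))) (D.f θ) j = D.r θ * a none := by
    rw [← g_hh, Finset.mul_sum]
    exact Finset.sum_congr rfl fun j _ => by rw [D.pd]; simp only [gt]; ring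
  rw [h3, Complex.re_ofReal_mul] at h2
  have h4 := ((h.const_mul N0).ofReal_comp)
  refine (h4.congr_of_eventuallyEq (Eventually.of_forall fun t => ?_)).congr_deriv ?_
  · simp only [vv, FF_line, rt]; rfl
  · congr 1
    rw [mul_assoc (2 * N0), h2]; ring

lemma vv_line_some (N0 θ : ℝ) (a : AA n) (i : Fin n) :
    HasDerivAt (fun t : ℝ => D.vv N0 (θ, ((0 : Fin n → ℂ), t • a)) (some i))
      (((D.r θ)⁻¹ : ℝ) * (D.Dp θ (D.hh θ a) i - D.g θ i * ∑ j, D.f θ j * D.Dp θ (D.hh θ a) j) +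
        D.gt θ i * (starRingEnd ℂ) (∑ j, D.gt θ j * a (some j))) 0 := by
  have h1 := hasDerivAt_pi.1 (D.pp_line θ a)
  have h2 : HasDerivAt (fun t : ℝ => D.den (θ, ((0 : Fin n → ℂ), t • a)))
      (∑ j, D.f θ j * D.Dp θ (D.hh θ a) j) 0 := by
    simp only [den]
    exact HasDerivAt.fun_sum fun j _ => (h1 j).const_mul _
  have e0 : ((θ, ((0 : Fin n → ℂ), (0 : ℝ) • a)) : ℝ × ((Fin n → ℂ) × AA n)) = (θ, 0) := by
    rw [zero_smul]; rfl
  have hd : D.den (θ, ((0 : Fin n → ℂ), (0 : ℝ) • a)) ≠ 0 := by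
    rw [e0, den_zero]; exact D.rX_ne θ
  have h3 := (((h1 i).const_mul (D.X θ)).div h2 hd)
  have h4 : HasDerivAt (fun t : ℝ => (starRingEnd ℂ) (D.gk (θ, ((0 : Fin n → ℂ), t • a))))
      ((starRingEnd ℂ) (∑ j, D.gt θ j * a (some j))) 0 := by
    have e : (fun t : ℝ => (starRingEnd ℂ) (D.gk (θ, ((0 : Fin n → ℂ), t • a)))) =
        fun t : ℝ => (t : ℂ) * (starRingEnd ℂ) (∑ j, D.gt θ j * a (some j)) := by
      funext t
      simp only [gk, PiLp.smul_apply, Complex.real_smul]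
      rw [show ∑ i, D.gt θ i * ((t : ℂ) * a (some i)) = t * ∑ i, D.gt θ i * a (some i) by
        rw [Finset.mul_sum]; exact Finset.sum_congr rfl fun _ _ => by ring]
      rw [map_mul, Complex.conj_ofReal]
    rw [e]
    simpa using (Complex.ofRealCLM.hasDerivAt (x := (0 : ℝ))).mul_const
      ((starRingEnd ℂ) (∑ j, D.gt θ j * a (some j)))
  have h5 := h3.add (h4.const_mul (D.gt θ i))
  refine (h5.congr_of_eventuallyEq (Eventually.of_forall fun t => ?_)).congr_deriv ?_
  · simp only [vv]; rfl
  · congr 1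
    rw [e0, den_zero, pp_zero]
    have h1 : (D.r θ : ℂ) ≠ 0 := by exact_mod_cast (D.r0 θ).ne'
    have h2 := D.X0 θ
    push_cast
    field_simp


lemma sum_line (N0 θ : ℝ) (a : AA n) (dv : Option (Fin n) → ℂ)
    (hdv : ∀ i, HasDerivAt (fun t : ℝ => D.vv N0 (θ, ((0 : Fin n → ℂ), t • a)) i) (dv i) 0) :
    (∑ i, a i * dv i).re = 2 * N0 * D.r θ * (a none).re ^ 2 +
      (D.r θ)⁻¹ * (∑ j, D.pk θ a j * D.Dp θ (D.hh θ a) j).re + ‖∑ j, D.gt θ j * a (some j)‖ ^ 2 := by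
  rw [Fintype.sum_option, Complex.add_re]
  have h0 : dv none = _ := (hdv none).unique (D.vv_line_none N0 θ a)
  have h1 : ∀ i, dv (some i) = _ := fun i => (hdv (some i)).unique (D.vv_line_some N0 θ a i)
  have e0 : (a none * dv none).re = 2 * N0 * D.r θ * (a none).re ^ 2 := by
    rw [h0, Complex.re_mul_ofReal]; ring
  set q := D.Dp θ (D.hh θ a) with hq
  set c := ∑ j, D.gt θ j * a (some j) with hc
  have e1 : ∑ i, a (some i) * dv (some i) = ((D.r θ)⁻¹ : ℝ) * (∑ j, D.pk θ a j * q j) + c * (starRingEnd ℂ) c := by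
    have h3 : c = D.X θ * ∑ i, D.g θ i * a (some i) := by
      rw [hc, Finset.mul_sum]; exact Finset.sum_congr rfl fun i _ => by simp only [gt]; ring
    have h2 : ∑ j, D.pk θ a j * q j = ∑ j, a (some j) * q j -
        (∑ i, D.g θ i * a (some i)) * ∑ j, D.f θ j * q j := by
      rw [Finset.mul_sum, ← Finset.sum_sub_distrib]
      refine Finset.sum_congr rfl fun j _ => ?_
      simp only [pk, ← hc, h3, ft]
      have := D.X0 θ
      field_simp
    have h4 : ∑ i, a (some i) * dv (some i) = ((D.r θ)⁻¹ : ℝ) * (∑ j, a (some j) * q j -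
        (∑ i, D.g θ i * a (some i)) * ∑ j, D.f θ j * q j) + (∑ j, D.gt θ j * a (some j)) * (starRingEnd ℂ) c := by
      rw [Finset.sum_mul, Finset.sum_mul, ← Finset.sum_sub_distrib, Finset.mul_sum, ← Finset.sum_add_distrib]
      refine Finset.sum_congr rfl fun j _ => ?_
      rw [h1]; ring
    rw [h4, h2]
  rw [e0, e1, Complex.add_re, Complex.re_ofReal_mul, Complex.mul_conj, Complex.ofReal_re,
    Complex.normSq_eq_norm_sq]
  ring

lemma bdd_per {u : ℝ → ℝ} (hu : Continuous u) (hp : Function.Periodic u (2 * Real.pi)) :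
    ∃ M > 0, ∀ θ, u θ ≤ M := by
  obtain ⟨M, hM⟩ := (isCompact_Icc (a := (0 : ℝ)) (b := 2 * Real.pi)).bddAbove_image hu.continuousOn
  refine ⟨max M 1, by positivity, fun θ => ?_⟩
  obtain ⟨φ, hφ, he⟩ := hp.exists_mem_Ico₀ Real.two_pi_pos θ
  rw [he]
  exact le_max_of_le_left (hM ⟨φ, ⟨hφ.1, hφ.2.le⟩, rfl⟩)

lemma pDp : Function.Periodic D.Dp (2 * Real.pi) := by
  intro θ
  have h1 := D.Dp_has (θ + 2 * Real.pi)
  have h2 := D.Dp_has θ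
  rw [D.pf θ] at h1
  have e : (fun w => _root_.pd ρ (θ + 2 * Real.pi, w)) = fun w => _root_.pd ρ (θ, w) := by
    funext w j
    have := periodic_exp θ
    simp only at this
    simp only [_root_.pd]
    rw [this]
  rw [e] at h1
  exact h1.unique h2

lemma euclNorm_le_of (w : Fin n → ℂ) (j : Fin n) : ‖w j‖ ≤ euclNorm w := by
  have h := euclNorm_sq w
  have h1 : ‖w j‖ ^ 2 ≤ euclNorm w ^ 2 := by
    rw [h]
    exact Finset.single_le_sum (f := fun j => ‖w j‖ ^ 2) (fun _ _ => by positivity) (Finset.mem_univ j)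
  exact (pow_le_pow_iff_left₀ (norm_nonneg _) (euclNorm_nonneg w) two_ne_zero).1 h1

lemma hypo_unif : ∃ K0 > 0, ∀ (θ : ℝ) (u : Fin n → ℂ), (∑ j, D.gt θ j * u j) = 0 →
    K0 * euclNorm u ^ 2 ≤ 2 * (∑ j, u j * D.Dp θ u j).re := by
  let C : Set (ℂ × (Fin n → ℂ)) := Set.image (fun θ : ℝ => (Complex.exp (θ * I), D.f θ)) (Icc 0 (2 * Real.pi))
  have hC : IsCompact C := isCompact_Icc.image (by
    have := D.hf.continuous
    fun_prop)
  obtain ⟨K0, hK0, h⟩ := D.hρ.hypo C (by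
    rintro _ ⟨θ, _, rfl⟩
    exact ⟨exp_mem_Circ θ, rho_ne D.hρ (exp_mem_Circ θ) (D.f_ne θ)⟩) hC
  refine ⟨K0, hK0, ?_⟩
  have key : ∀ θ ∈ Icc (0 : ℝ) (2 * Real.pi), ∀ (u : Fin n → ℂ), (∑ j, D.gt θ j * u j) = 0 →
      K0 * euclNorm u ^ 2 ≤ 2 * (∑ j, u j * D.Dp θ u j).re := by
    intro θ hθ u hu
    have h1 := h _ ⟨θ, hθ, rfl⟩ u (by
      simp only [D.pd]
      have : ∑ j, u j * (D.r θ * D.X θ * D.g θ j) = D.r θ * ∑ j, D.gt θ j * u j := by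
        rw [Finset.mul_sum]; exact Finset.sum_congr rfl fun j _ => by simp only [gt]; ring
      rw [this, hu, mul_zero])
    rw [iteratedFDeriv_two_apply] at h1
    have h2 := hess_wderiv D.hρ (exp_mem_Circ θ) (D.f_ne θ) u u
      (fun j => (ContinuousLinearMap.proj j).comp (D.Dp θ)) (fun j => hasFDerivAt_pi'.1 (D.Dp_has θ) j)
    simp only [ContinuousLinearMap.comp_apply, ContinuousLinearMap.proj_apply] at h2
    rw [h2]
    simp only [Matrix.cons_val_zero, Matrix.cons_val_one] at h1
    linarith
  intro θ
  have hper : Function.Periodic (fun θ => ∀ (u : Fin n → ℂ), (∑ j, D.gt θ j * u j) = 0 →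
      K0 * euclNorm u ^ 2 ≤ 2 * (∑ j, u j * D.Dp θ u j).re) (2 * Real.pi) := by
    intro θ; simp only [D.pgt θ, D.pDp θ]
  obtain ⟨φ, hφ, he⟩ := hper.exists_mem_Ico₀ Real.two_pi_pos θ
  have := key φ ⟨hφ.1, hφ.2.le⟩
  exact (show (∀ (u : Fin n → ℂ), (∑ j, D.gt θ j * u j) = 0 →
      K0 * euclNorm u ^ 2 ≤ 2 * (∑ j, u j * D.Dp θ u j).re) = _ from he) ▸ this


lemma coer : ∃ N0 c c0 : ℝ, 0 < N0 ∧ 0 < c ∧ ∀ (θ : ℝ) (a : AA n) (dv : Option (Fin n) → ℂ),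
    (∀ i, HasDerivAt (fun t : ℝ => D.vv N0 (θ, ((0 : Fin n → ℂ), t • a)) i) (dv i) 0) →
    c * ‖a‖ ^ 2 + c0 * ((a none) ^ 2).re ≤ (∑ i, a i * dv i).re := by
  obtain ⟨K0, hK0, hK⟩ := D.hypo_unif
  obtain ⟨S1, hS1, h1⟩ := bdd_per (u := fun θ => (D.r θ)⁻¹) (D.hr.inv₀ fun θ => (D.r0 θ).ne')
    (fun θ => by simp only [D.pr θ])
  obtain ⟨S2, hS2, h2⟩ := bdd_per (u := D.r) D.hr D.pr
  obtain ⟨B, hB, hBB⟩ := bdd_per (u := fun θ => ‖D.ft θ‖) D.hft.continuous.norm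
    (fun θ => by simp only [D.pft θ])
  obtain ⟨M, hM, hMM⟩ := bdd_per (u := fun θ => ‖D.Dp θ‖) D.Dp_cont.norm
    (fun θ => by simp only [D.pDp θ])
  set Q : ℝ := S1 * (n * (M * B)) with hQ
  have hQ0 : 0 ≤ Q := by positivity
  set k : ℝ := K0 / (2 * S2) with hk
  have hk0 : 0 < k := by positivity
  set c0 : ℝ := 1 + Q ^ 2 / (2 * k) with hc0
  have hc00 : 0 < c0 := by positivity
  set c : ℝ := min 1 (min (k / 4) (1 / (2 * n * B ^ 2 + 1))) with hc
  have hcpos : 0 < c := by positivity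
  refine ⟨c0 * S1, c, c0, by positivity, hcpos, fun θ a dv hdv => ?_⟩
  rw [D.sum_line _ θ a dv hdv]
  set w := ‖∑ j, D.gt θ j * a (some j)‖ with hw
  set b := ‖a none‖ with hb
  set E := euclNorm (D.pk θ a) with hE
  have hE0 : 0 ≤ E := euclNorm_nonneg _
  have hb0 : 0 ≤ b := norm_nonneg _
  have hw0 : 0 ≤ w := norm_nonneg _
  have hri := inv_pos.2 (D.r0 θ)
  have hft : ∀ j, ‖D.ft θ j‖ ≤ B := fun j => (norm_le_pi_norm _ j).trans (hBB θ)
  -- norm of a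
  have hna : ‖a‖ ^ 2 ≤ b ^ 2 + 2 * E ^ 2 + 2 * n * B ^ 2 * w ^ 2 := by
    rw [EuclideanSpace.norm_sq_eq, Fintype.sum_option, hE, euclNorm_sq, Finset.mul_sum]
    have : ∑ j : Fin n, ‖a (some j)‖ ^ 2 ≤ ∑ j, (2 * ‖D.pk θ a j‖ ^ 2 + 2 * B ^ 2 * w ^ 2) := by
      refine Finset.sum_le_sum fun j _ => ?_
      have e : a (some j) = D.pk θ a j + (∑ i, D.gt θ i * a (some i)) * D.ft θ j := by
        simp only [pk]; ring
      have h3 : ‖a (some j)‖ ≤ ‖D.pk θ a j‖ + w * B := by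
        calc ‖a (some j)‖ = ‖D.pk θ a j + (∑ i, D.gt θ i * a (some i)) * D.ft θ j‖ := by rw [← e]
          _ ≤ ‖D.pk θ a j‖ + ‖(∑ i, D.gt θ i * a (some i)) * D.ft θ j‖ := norm_add_le _ _
          _ ≤ _ := by
            rw [norm_mul]
            have := mul_le_mul_of_nonneg_left (hft j) hw0
            linarith
      have h4 := pow_le_pow_left₀ (norm_nonneg _) h3 2
      have h5 := sq_nonneg (‖D.pk θ a j‖ - w * B)
      nlinarith
    rw [Finset.sum_add_distrib] at this
    simp only [Finset.sum_const, Finset.card_univ, Fintype.card_fin, nsmul_eq_mul] at this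
    linarith
  -- cross term
  have hdec : D.hh θ a = (fun j => a none * D.ft θ j) + D.pk θ a := rfl
  have hsum : ∑ j, D.pk θ a j * D.Dp θ (D.hh θ a) j =
      ∑ j, D.pk θ a j * D.Dp θ (fun j => a none * D.ft θ j) j + ∑ j, D.pk θ a j * D.Dp θ (D.pk θ a) j := by
    rw [hdec, map_add, ← Finset.sum_add_distrib]
    exact Finset.sum_congr rfl fun j _ => by rw [Pi.add_apply]; ring
  have hmain := hK θ (D.pk θ a) (D.g_pk θ a)
  have hcross : ‖∑ j, D.pk θ a j * D.Dp θ (fun j => a none * D.ft θ j) j‖ ≤ n * (M * B) * (b * E) := by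
    refine (norm_sum_le _ _).trans ?_
    have : ∀ j ∈ Finset.univ, ‖D.pk θ a j * D.Dp θ (fun j => a none * D.ft θ j) j‖ ≤ E * (M * (b * B)) := by
      intro j _
      rw [norm_mul]
      refine mul_le_mul (euclNorm_le_of _ j) ?_ (norm_nonneg _) hE0
      refine (norm_le_pi_norm _ j).trans ((ContinuousLinearMap.le_opNorm _ _).trans ?_)
      refine mul_le_mul (hMM θ) ?_ (norm_nonneg _) hM.le
      rw [pi_norm_le_iff_of_nonneg (by positivity)]
      intro j
      rw [norm_mul]
      exact mul_le_mul_of_nonneg_left (hft j) hb0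
    refine (Finset.sum_le_card_nsmul _ _ _ this).trans_eq ?_
    simp only [Finset.card_univ, Fintype.card_fin, nsmul_eq_mul]
    ring
  have hcr := (Complex.abs_re_le_norm _).trans hcross
  have hcr' := (abs_le.1 hcr).1
  have hlow : k * E ^ 2 - Q * (b * E) ≤ (D.r θ)⁻¹ * (∑ j, D.pk θ a j * D.Dp θ (D.hh θ a) j).re := by
    rw [hsum, Complex.add_re, mul_add]
    have i1 : k * E ^ 2 ≤ (D.r θ)⁻¹ * (∑ j, D.pk θ a j * D.Dp θ (D.pk θ a) j).re := by
      have : k * E ^ 2 = S2⁻¹ * (K0 * E ^ 2 / 2) := by rw [hk]; field_simp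
      rw [this]
      refine mul_le_mul ?_ (by linarith) (by positivity) hri.le
      exact inv_anti₀ (D.r0 θ) (h2 θ)
    have i2 : -(Q * (b * E)) ≤ (D.r θ)⁻¹ * (∑ j, D.pk θ a j * D.Dp θ (fun j => a none * D.ft θ j) j).re := by
      have j1 := mul_le_mul_of_nonneg_left hcr' hri.le
      have j2 := mul_le_mul_of_nonneg_right (h1 θ) (by positivity : 0 ≤ n * (M * B) * (b * E))
      rw [hQ]
      nlinarith
    linarith
  have hyoung : Q * (b * E) ≤ k / 2 * E ^ 2 + Q ^ 2 / (2 * k) * b ^ 2 := by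
    have : 0 ≤ (k * E - Q * b) ^ 2 / (2 * k) := by positivity
    have e : (k * E - Q * b) ^ 2 / (2 * k) = k / 2 * E ^ 2 + Q ^ 2 / (2 * k) * b ^ 2 - Q * (b * E) := by
      field_simp; ring
    linarith
  have hre : 2 * (a none).re ^ 2 = b ^ 2 + ((a none) ^ 2).re := by
    rw [hb, ← Complex.normSq_eq_norm_sq, Complex.normSq_apply, sq (a none), Complex.mul_re]; ring
  have hN : c0 * (b ^ 2 + ((a none) ^ 2).re) ≤ 2 * (c0 * S1) * D.r θ * (a none).re ^ 2 := by
    have : 1 ≤ S1 * D.r θ := by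
      have := h1 θ
      rw [inv_le_iff_one_le_mul₀ (D.r0 θ)] at this
      exact this
    have h5 : 0 ≤ c0 * (2 * (a none).re ^ 2) := by positivity
    rw [← hre]
    nlinarith [mul_le_mul_of_nonneg_left this h5]
  have hc1 : c ≤ 1 := min_le_left _ _
  have hc2 : c ≤ k / 4 := (min_le_right _ _).trans (min_le_left _ _)
  have hc3 : c * (2 * n * B ^ 2) ≤ 1 := by
    have h6 : c ≤ 1 / (2 * n * B ^ 2 + 1) := (min_le_right _ _).trans (min_le_right _ _)
    rw [le_div_iff₀ (by positivity)] at h6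
    linarith
  have hfin : c * ‖a‖ ^ 2 ≤ b ^ 2 + k / 2 * E ^ 2 + w ^ 2 := by
    have j0 := mul_le_mul_of_nonneg_left hna hcpos.le
    have j1 := mul_le_mul_of_nonneg_right hc1 (sq_nonneg b)
    have j2 := mul_le_mul_of_nonneg_right hc2 (sq_nonneg E)
    have j3 := mul_le_mul_of_nonneg_right hc3 (sq_nonneg w)
    linarith
  have e1 : c0 * b ^ 2 = b ^ 2 + Q ^ 2 / (2 * k) * b ^ 2 := by rw [hc0]; ring
  linarith

end Dat
end Coercive

/-! part 15 -/
set_option linter.unusedSectionVars false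
open Complex Metric MeasureTheory Filter Set

section Solve

lemma coefInner {n : ℕ} (w : C(TT, AA n)) (u : Option (Fin n) → C(TT, ℂ))
    (hw : ∀ t i, w t i = (starRingEnd ℂ) (u i t)) (k : ℕ) (b : AA n) :
    inner ℂ (toL2 (fA ((k : ℤ) + 1) b)) (toL2 w) =
      ∑ i, (starRingEnd ℂ) (b i) * (starRingEnd ℂ) (fourierCoeff (u i) (-((k : ℤ) + 1))) := by
  rw [inner_toL2]
  have h : ∀ t, (inner ℂ (fA ((k : ℤ) + 1) b t) (w t) : ℂ) =
      ∑ i, (starRingEnd ℂ) (b i) * (starRingEnd ℂ) (fourier ((k : ℤ) + 1) t * u i t) := by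
    intro t
    rw [PiLp.inner_apply]
    refine Finset.sum_congr rfl fun i _ => ?_
    rw [hw]
    simp only [fA_apply, PiLp.smul_apply, smul_eq_mul, RCLike.inner_apply, map_mul]
    ring
  simp_rw [h]
  rw [integral_finsetSum]
  · refine Finset.sum_congr rfl fun i _ => ?_
    rw [integral_const_mul, integral_conj, fourierCoeff]
    simp only [neg_neg, smul_eq_mul]
  · intro i _
    apply Continuous.integrable_of_hasCompactSupport ?_ (HasCompactSupport.of_compactSpace _)
    fun_prop

lemma neg_coeff_of_memA (h : ℂ → ℂ) (hh : MemA h) (u : C(TT, ℂ))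
    (hu : ∀ θ : ℝ, h (Complex.exp (θ * I)) = u (θ : TT)) (k : ℕ) :
    fourierCoeff u (-((k : ℤ) + 1)) = 0 := by
  have hm : MemA (fun z => z ^ (k + 1) * h z) := MemA.mul ⟨by fun_prop, by fun_prop⟩ hh
  have h1 := hm.mean
  rw [fourierCoeff, integral_TT]
  have h2 : ∀ θ : ℝ, (fourier (-(-((k : ℤ) + 1))) (θ : TT) : ℂ) • u (θ : TT) =
      Complex.exp (θ * I) ^ (k + 1) * h (Complex.exp (θ * I)) := by
    intro θ
    rw [neg_neg, fourier_exp, hu, smul_eq_mul]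
    norm_cast
  simp_rw [h2]
  rw [h1]
  simp

variable {n : ℕ} {ρ : ℂ → (Fin n → ℂ) → ℝ} {R : ℝ} (D : Dat n ρ R)
namespace Dat

/-- the cut off map -/
noncomputable def vT (N0 : ℝ) (T : (Fin n → ℂ) × AA n → (Fin n → ℂ) × AA n) (i : Option (Fin n))
    (p : ℝ × ((Fin n → ℂ) × AA n)) : ℂ := D.vv N0 (p.1, T p.2) i

noncomputable def PhiT (N0 : ℝ) (T : (Fin n → ℂ) × AA n → (Fin n → ℂ) × AA n)
    (p : ℝ × ((Fin n → ℂ) × AA n)) : AA n :=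
  WithLp.toLp 2 (fun i => (starRingEnd ℂ) (D.vT N0 T i p))

lemma vT_contDiff (N0 : ℝ) {T : (Fin n → ℂ) × AA n → (Fin n → ℂ) × AA n} (hT : ContDiff ℝ 2 T)
    (hg : ∀ θ y, D.good (θ, T y)) (i : Option (Fin n)) : ContDiff ℝ 2 (D.vT N0 T i) := by
  rw [contDiff_iff_contDiffAt]
  intro p
  exact ContDiffAt.comp (g := fun p => D.vv N0 p i)
    (f := fun p : ℝ × ((Fin n → ℂ) × AA n) => (p.1, T p.2)) p
    (D.vv_contDiffAt N0 (hg p.1 p.2).1 (hg p.1 p.2).2.1 i)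
    (contDiff_fst.prodMk (hT.comp contDiff_snd)).contDiffAt

lemma vT_per (N0 : ℝ) (T : (Fin n → ℂ) × AA n → (Fin n → ℂ) × AA n) (i : Option (Fin n)) :
    PerT (D.vT N0 T i) := by
  intro y θ
  simp only [vT, vv_per]

lemma PhiT_contDiff (N0 : ℝ) {T : (Fin n → ℂ) × AA n → (Fin n → ℂ) × AA n} (hT : ContDiff ℝ 2 T)
    (hg : ∀ θ y, D.good (θ, T y)) : ContDiff ℝ 2 (D.PhiT N0 T) := by
  have h : ContDiff ℝ 2 (fun p => fun i => (starRingEnd ℂ) (D.vT N0 T i p)) := by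
    rw [contDiff_pi]
    intro i
    exact Complex.conjCLE.contDiff.comp (D.vT_contDiff N0 hT hg i)
  exact (((EuclideanSpace.equiv (Option (Fin n)) ℂ).symm.toContinuousLinearMap).restrictScalars ℝ).contDiff.comp h

lemma PhiT_per (N0 : ℝ) (T : (Fin n → ℂ) × AA n → (Fin n → ℂ) × AA n) : PerT (D.PhiT N0 T) := by
  intro y θ
  simp only [PhiT]
  congr 1
  funext i
  have := D.vT_per N0 T i y θ
  simp only at this
  rw [this]

lemma solve (hhol : ∀ i, ∃ h, MemA h ∧ ∀ θ : ℝ, h (Complex.exp (θ * I)) = D.X θ * D.g θ i)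
    (h1 : ∀ θ, rt ρ (θ, D.f θ) = 1) :
    ∃ (N0 : ℝ) (T : (Fin n → ℂ) × AA n → (Fin n → ℂ) × AA n) (ε : ℝ) (Xs : (Fin n → ℂ) → XSp (AA n)),
      N0 ≠ 0 ∧ ContDiff ℝ 2 T ∧ (∀ θ y, D.good (θ, T y)) ∧ 0 < ε ∧ (∀ y, ‖y‖ < ε → T y = y) ∧
      Xs 0 = 0 ∧ ContDiffAt ℝ 1 Xs 0 ∧ ∀ᶠ δ in nhds 0, ∀ i, ∃ V, MemA V ∧ ∀ θ : ℝ,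
        V (Complex.exp (θ * I)) = D.vT N0 T i (θ, (δ, iR (Xs δ) (θ : TT))) := by
  obtain ⟨N0, c, c0, hN0, hc, hco⟩ := D.coer
  obtain ⟨ε, hε, hgood⟩ := D.good_tube
  obtain ⟨T, hT, hTε, hTid⟩ := exists_cutoff (E := (Fin n → ℂ) × AA n) hε
  have hg : ∀ θ y, D.good (θ, T y) := fun θ y => hgood θ _ (hTε y)
  have hT0 : T 0 = 0 := hTid 0 (by simpa using hε)
  have hw : ∀ q t i, NN0 (D.PhiT N0 T) (D.PhiT_contDiff N0 hT hg) (D.PhiT_per N0 T) q t i =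
      (starRingEnd ℂ) (NN0 (D.vT N0 T i) (D.vT_contDiff N0 hT hg i) (D.vT_per N0 T i) q t) := by
    intro q t i
    induction t using QuotientAddGroup.induction_on with
    | H θ => rfl
  have H1 : ∀ (θ : ℝ) (a : AA n), c * ‖a‖ ^ 2 + c0 * (((EuclideanSpace.proj none : AA n →L[ℂ] ℂ) a) ^ 2).re ≤
      (inner ℂ (dA (D.PhiT N0 T) (θ, 0) a) a : ℂ).re := by
    intro θ a
    have hd : HasDerivAt (fun t : ℝ => D.PhiT N0 T (θ, ((0 : Fin n → ℂ), t • a)))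
        (dA (D.PhiT N0 T) (θ, 0) a) 0 := by
      have hF := ((D.PhiT_contDiff N0 hT hg).differentiable (by norm_num) (θ, 0)).hasFDerivAt
      have e : ((θ, 0) : ℝ × ((Fin n → ℂ) × AA n)) = (θ, ((0 : Fin n → ℂ), (0 : ℝ) • a)) := by
        rw [zero_smul]; rfl
      have hl : HasDerivAt (fun t : ℝ => ((θ, ((0 : Fin n → ℂ), t • a)) : ℝ × ((Fin n → ℂ) × AA n)))
          (0, (0, a)) 0 := by
        have := (hasDerivAt_id (0 : ℝ)).smul_const a
        simp only [one_smul] at this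
        exact (hasDerivAt_const _ _).prodMk ((hasDerivAt_const _ _).prodMk this)
      have hF' := hF
      rw [e] at hF'
      have := HasFDerivAt.comp_hasDerivAt (0 : ℝ) hF' hl
      rw [← e] at this
      exact this
    set q := dA (D.PhiT N0 T) (θ, 0) a with hq
    have hdi : ∀ i, HasDerivAt (fun t : ℝ => D.vv N0 (θ, ((0 : Fin n → ℂ), t • a)) i) ((starRingEnd ℂ) (q i)) 0 := by
      intro i
      have h2 := ((EuclideanSpace.proj i : AA n →L[ℂ] ℂ).restrictScalars ℝ).hasFDerivAt.comp_hasDerivAt (0 : ℝ) hd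
      have h3 := (Complex.conjCLE : ℂ →L[ℝ] ℂ).hasFDerivAt.comp_hasDerivAt (0 : ℝ) h2
      refine h3.congr_of_eventuallyEq ?_
      have hcn : Continuous (fun t : ℝ => ((0 : Fin n → ℂ), t • a)) := by fun_prop
      have hsm : ∀ᶠ t : ℝ in nhds 0, ‖((0 : Fin n → ℂ), t • a)‖ < ε / 4 := by
        refine hcn.norm.continuousAt.eventually_lt continuousAt_const ?_
        simp; exact hε
      filter_upwards [hsm] with t ht
      simp only [Function.comp, PhiT, vT, hTid _ ht]
      simp
    have := hco θ a _ hdi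
    refine this.trans_eq ?_
    rw [PiLp.inner_apply]
    simp [RCLike.inner_apply]
  have H2 : ∀ (k : ℕ) b, inner ℂ (toL2 (fA ((k : ℤ) + 1) b))
      (toL2 (NN0 (D.PhiT N0 T) (D.PhiT_contDiff N0 hT hg) (D.PhiT_per N0 T) 0)) = 0 := by
    intro k b
    rw [coefInner _ _ (hw 0)]
    refine Finset.sum_eq_zero fun i _ => ?_
    have : ∃ h, MemA h ∧ ∀ θ : ℝ, h (Complex.exp (θ * I)) = D.vv N0 (θ, 0) i := by
      cases i with
      | none => exact ⟨fun _ => (N0 : ℂ), MemA.const _, fun θ => by rw [vv_zero_none, h1]; simp⟩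
      | some i =>
        obtain ⟨h, hh, hhe⟩ := hhol i
        exact ⟨h, hh, fun θ => by rw [vv_zero_some, hhe]⟩
    obtain ⟨h, hh, hhe⟩ := this
    rw [neg_coeff_of_memA h hh, map_zero, mul_zero]
    intro θ
    rw [hhe, NN0_coe]
    simp only [vT]
    have e : (((0 : (Fin n → ℂ) × XSp (AA n)).1, iR (0 : (Fin n → ℂ) × XSp (AA n)).2 (θ : TT)) :
      (Fin n → ℂ) × AA n) = 0 := by simp
    rw [e, hT0]
  obtain ⟨Xs, hX0, hXc, hXs⟩ := thmA (D.PhiT N0 T) (D.PhiT_contDiff N0 hT hg) (D.PhiT_per N0 T) c c0 hc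
    (EuclideanSpace.proj none) H1 H2
  refine ⟨N0, T, ε / 4, Xs, hN0.ne', hT, hg, by positivity, hTid, hX0, hXc, ?_⟩
  filter_upwards [hXs] with δ hδ i
  have hz : ∀ k : ℕ, fourierCoeff (NN0 (D.vT N0 T i) (D.vT_contDiff N0 hT hg i) (D.vT_per N0 T i) (δ, Xs δ))
      (-((k : ℤ) + 1)) = 0 := by
    intro k
    have := hδ k (EuclideanSpace.single i 1)
    rw [coefInner _ _ (hw (δ, Xs δ))] at this
    rw [Finset.sum_eq_single i] at this
    · simpa using this
    · intro j _ hj; simp [hj]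
    · simp
  obtain ⟨V, hV, hV1, _⟩ := ext_of_coeff _ (summable_of_rep _ _ (SB_apply (D.vT N0 T i)
    (D.vT_contDiff N0 hT hg i) (D.vT_per N0 T i) (δ, Xs δ))) hz
  exact ⟨V, hV, hV1⟩

end Dat
end Solve

/-! part 16 -/
set_option linter.unusedSectionVars false
open Complex Metric MeasureTheory Filter Set

section Assemble
variable {n : ℕ} {ρ : ℂ → (Fin n → ℂ) → ℝ} {R : ℝ}

/-- holomorphic extension of a coordinate of the unknown -/
noncomputable def co (i : Option (Fin n)) (x : XSp (AA n)) : ℂ → ℂ :=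
  eX (EuclideanSpace.proj i : AA n →L[ℂ] ℂ) x

/-- holomorphic extension of `gk` -/
noncomputable def gkE (g : ℂ → Fin n → ℂ) (Y : ℂ → ℂ) (x : XSp (AA n)) (z : ℂ) : ℂ :=
  ∑ i, Complex.exp (Y z) * g z i * co (some i) x z

/-- holomorphic extension of `FF` -/
noncomputable def FE (f g : ℂ → Fin n → ℂ) (Y : ℂ → ℂ) (δ : Fin n → ℂ) (x : XSp (AA n)) (z : ℂ) (j : Fin n) : ℂ :=
  f z j + δ j + co none x z * (f z j / Complex.exp (Y z)) + co (some j) x z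
    - gkE g Y x z * (f z j / Complex.exp (Y z))

lemma co_exp (i : Option (Fin n)) (x : XSp (AA n)) (θ : ℝ) :
    co i x (Complex.exp (θ * I)) = (iR x (θ : TT)) i := by
  rw [co, eX_exp]; rfl

lemma gkE_memA {g : ℂ → Fin n → ℂ} {Y : ℂ → ℂ} (hg : MemAV g) (hY : MemA Y) (x : XSp (AA n)) :
    MemA (gkE g Y x) :=
  MemA.sum _ fun i _ => (hY.cexp.mul (hg i)).mul (eX_memA _ _)

lemma gkE_zero (g : ℂ → Fin n → ℂ) (Y : ℂ → ℂ) (x : XSp (AA n)) : gkE g Y x 0 = 0 := by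
  simp [gkE, co, eX_zero]

lemma FE_memA {f g : ℂ → Fin n → ℂ} {Y : ℂ → ℂ} (hf : MemAV f) (hg : MemAV g) (hY : MemA Y)
    (δ : Fin n → ℂ) (x : XSp (AA n)) (j : Fin n) : MemA (fun z => FE f g Y δ x z j) := by
  have h1 := (hf j).div hY.cexp (fun z _ => Complex.exp_ne_zero _)
  exact ((((hf j).add (MemA.const _)).add ((eX_memA _ _).mul h1)).add (eX_memA _ _)).sub
    ((gkE_memA hg hY x).mul h1)

lemma FE_zero (f g : ℂ → Fin n → ℂ) (Y : ℂ → ℂ) (δ : Fin n → ℂ) (x : XSp (AA n)) :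
    FE f g Y δ x 0 = f 0 + δ := by
  funext j
  simp [FE, gkE_zero, co, eX_zero]

namespace Dat
variable (D : Dat n ρ R)

lemma disc {f g : ℂ → Fin n → ℂ} {Y : ℂ → ℂ} (hf : MemAV f) (hg : MemAV g) (hY : MemA Y)
    (hDf : ∀ θ : ℝ, D.f θ = f (Complex.exp (θ * I))) (hDg : ∀ θ : ℝ, D.g θ = g (Complex.exp (θ * I)))
    (hDX : ∀ θ : ℝ, D.X θ = Complex.exp (Y (Complex.exp (θ * I)))) (δ : Fin n → ℂ) (x : XSp (AA n))
    {N0 : ℝ} (hN0 : N0 ≠ 0) (hgood : ∀ θ : ℝ, D.good (θ, (δ, iR x (θ : TT))))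
    (hV : ∀ i, ∃ V, MemA V ∧ ∀ θ : ℝ, V (Complex.exp (θ * I)) = D.vv N0 (θ, (δ, iR x (θ : TT))) i) :
    (∀ θ : ℝ, FE f g Y δ x (Complex.exp (θ * I)) = D.FF (θ, (δ, iR x (θ : TT)))) ∧
    (∃ c : ℝ, ∀ θ : ℝ, rt ρ (θ, D.FF (θ, (δ, iR x (θ : TT)))) = c) ∧
    ∃ G : ℂ → Fin n → ℂ, MemAV G ∧ ∀ (θ : ℝ) j, G (Complex.exp (θ * I)) j =
      D.pp (θ, (δ, iR x (θ : TT))) j / D.num (θ, (δ, iR x (θ : TT))) := by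
  choose V hVA hVe using hV
  have hgk : ∀ θ : ℝ, gkE g Y x (Complex.exp (θ * I)) = D.gk (θ, (δ, iR x (θ : TT))) := by
    intro θ
    simp only [gkE, Dat.gk, Dat.gt, co_exp, hDg, hDX]
  have hFE : ∀ θ : ℝ, FE f g Y δ x (Complex.exp (θ * I)) = D.FF (θ, (δ, iR x (θ : TT))) := by
    intro θ
    funext j
    simp only [FE, Dat.FF, Dat.ft, co_exp, hgk, hDf, hDX]
  have hft : ∀ i, MemA (fun z => f z i / Complex.exp (Y z)) := fun i =>
    (hf i).div hY.cexp (fun z _ => Complex.exp_ne_zero _)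
  refine ⟨hFE, ?_, ?_⟩
  · have h := real_const (hVA none) (by
      intro z hz
      obtain ⟨θ, rfl⟩ := exists_exp_of_mem_Circ hz
      rw [hVe]
      simp only [Dat.vv]
      exact Complex.ofReal_im _)
    refine ⟨(V none 0).re / N0, fun θ => ?_⟩
    have h1 := h _ (exp_mem_Circ θ)
    rw [hVe] at h1
    simp only [Dat.vv] at h1
    rw [← h1, Complex.ofReal_re]
    field_simp
  · have hk0 : ∀ z ∈ Circ, gkE g Y x z = 0 := by
      refine conj_zero (h1 := fun z => (∑ i, f z i / Complex.exp (Y z) * V (some i) z) - 1)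
        ((MemA.sum _ fun i _ => (hft i).mul (hVA (some i))).sub (MemA.const 1)) (gkE_memA hg hY x) ?_
        (gkE_zero g Y x)
      intro z hz
      obtain ⟨θ, rfl⟩ := exists_exp_of_mem_Circ hz
      simp only [hVe, hgk, Dat.vv]
      have e : ∀ i, f (Complex.exp (θ * I)) i / Complex.exp (Y (Complex.exp (θ * I))) = D.ft θ i := by
        intro i; simp only [Dat.ft, hDf, hDX]
      simp only [e]
      have e1 : ∑ i, D.ft θ i * (D.X θ * D.pp (θ, (δ, iR x (θ : TT))) i / D.den (θ, (δ, iR x (θ : TT)))) = 1 := by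
        have : ∀ i, D.ft θ i * (D.X θ * D.pp (θ, (δ, iR x (θ : TT))) i / D.den (θ, (δ, iR x (θ : TT)))) =
            (D.f θ i * D.pp (θ, (δ, iR x (θ : TT))) i) / D.den (θ, (δ, iR x (θ : TT))) := by
          intro i
          have := D.X0 θ
          simp only [Dat.ft]
          field_simp
        simp only [this]
        rw [← Finset.sum_div]
        exact div_self (hgood θ).2.1
      have e2 := D.gtft θ
      simp only [mul_add, Finset.sum_add_distrib, e1]
      have e3 : ∑ i, D.ft θ i * (D.gt θ i * (starRingEnd ℂ) (D.gk (θ, (δ, iR x (θ : TT))))) =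
          (∑ i, D.gt θ i * D.ft θ i) * (starRingEnd ℂ) (D.gk (θ, (δ, iR x (θ : TT)))) := by
        rw [Finset.sum_mul]
        exact Finset.sum_congr rfl fun i _ => by ring
      rw [e3, e2]; ring
    have hq : ∀ (θ : ℝ) i, V (some i) (Complex.exp (θ * I)) =
        D.X θ * D.pp (θ, (δ, iR x (θ : TT))) i / D.den (θ, (δ, iR x (θ : TT))) := by
      intro θ i
      rw [hVe]
      simp only [Dat.vv]
      rw [← hgk, hk0 _ (exp_mem_Circ θ)]
      simp
    set Q : ℂ → ℂ := fun z => ∑ j, FE f g Y δ x z j * V (some j) z with hQ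
    have hQA : MemA Q := MemA.sum _ fun j _ => (FE_memA hf hg hY δ x j).mul (hVA _)
    have hQe : ∀ θ : ℝ, Q (Complex.exp (θ * I)) =
        D.X θ * (D.num (θ, (δ, iR x (θ : TT))) / D.den (θ, (δ, iR x (θ : TT)))) := by
      intro θ
      simp only [hQ, hq, hFE]
      rw [Dat.num, Finset.sum_div, Finset.mul_sum]
      exact Finset.sum_congr rfl fun i _ => by ring
    have hQn := ((hQA.div hY.cexp (fun z _ => Complex.exp_ne_zero _)).sub (MemA.const 1)).norm_le
      (C := 1 / 2) (by
        intro z hz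
        obtain ⟨θ, rfl⟩ := exists_exp_of_mem_Circ hz
        simp only [hQe, ← hDX]
        rw [mul_div_cancel_left₀ _ (D.X0 θ)]
        exact (hgood θ).2.2.2.le)
    have hQ0 : ∀ z ∈ Disk, Q z ≠ 0 := by
      intro z hz h0
      have := hQn z hz
      rw [h0] at this
      norm_num at this
    refine ⟨fun z j => V (some j) z / Q z, fun j => (hVA _).div hQA hQ0, fun θ j => ?_⟩
    simp only [hq, hQe]
    have h1 := D.X0 θ
    have h2 := (hgood θ).2.1
    have h3 := (hgood θ).2.2.1
    field_simp

end Dat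

/-- gradient identity from the tangent plane hypothesis -/
lemma grad_of_tan {ρz : (Fin n → ℂ) → ℝ} {p g : Fin n → ℂ} (hfg : ∑ j, p j * g j = 1)
    (htan : {w : Fin n → ℂ | ∑ j, g j * w j = 1} = TangentPlane ρz p) (j : Fin n) :
    wderiv ρz p j = (∑ i, p i * wderiv ρz p i) * g j := by
  have h : (fun i => p i + ((Pi.single j 1 : Fin n → ℂ) i - g j * p i)) ∈ TangentPlane ρz p := by
    rw [← htan]
    simp only [Set.mem_ofPred_eq, mul_add, mul_sub, Finset.sum_add_distrib, Finset.sum_sub_distrib]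
    have e1 : ∑ i, g i * p i = 1 := by rw [← hfg]; exact Finset.sum_congr rfl fun i _ => mul_comm _ _
    have e2 : ∑ i, g i * (Pi.single j 1 : Fin n → ℂ) i = g j := by
      simp [Pi.single_apply]
    have e3 : ∑ i, g i * (g j * p i) = g j := by
      have e4 : ∑ i, g i * (g j * p i) = g j * ∑ i, g i * p i := by
        rw [Finset.mul_sum]
        exact Finset.sum_congr rfl fun i _ => by ring
      rw [e4, e1, mul_one]
    rw [e1, e2, e3]; ring
  simp only [TangentPlane, Set.mem_ofPred_eq, add_sub_cancel_left] at h
  simp only [sub_mul, Finset.sum_sub_distrib] at h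
  have e2 : ∑ i, (Pi.single j 1 : Fin n → ℂ) i * wderiv ρz p i = wderiv ρz p j := by
    simp [Pi.single_apply]
  rw [e2, sub_eq_zero] at h
  rw [h, Finset.sum_mul]
  exact Finset.sum_congr rfl fun i _ => by ring

/-- conclusion: the tangent plane from the gradient -/
lemma tan_of_grad {ρz : (Fin n → ℂ) → ℝ} {p g : Fin n → ℂ} (h0 : ∑ j, p j * wderiv ρz p j ≠ 0)
    (hg : ∀ j, g j = wderiv ρz p j / ∑ j, p j * wderiv ρz p j) :
    ∑ j, p j * g j = 1 ∧ {w : Fin n → ℂ | ∑ j, g j * w j = 1} = TangentPlane ρz p := by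
  constructor
  · simp only [hg, ← mul_div_assoc]
    rw [← Finset.sum_div, div_self h0]
  · ext w
    simp only [TangentPlane, Set.mem_ofPred_eq, hg, div_mul_eq_mul_div, sub_mul, Finset.sum_sub_distrib]
    rw [← Finset.sum_div, div_eq_one_iff_eq h0, sub_eq_zero]
    simp only [mul_comm]

lemma exists_dat (hρ : Cond3 n ρ R (fun _ => 0)) {f g : ℂ → Fin n → ℂ}
    (hf12 : MemAV f) (hg12 : MemAV g) (hf4 : C4CircV f) (hg4 : C4CircV g)
    (hρf : ∀ z ∈ Circ, ρ z (f z) = 1)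
    (hfg : ∀ z ∈ Circ, ∑ j, f z j * g z j = 1)
    (htan : ∀ z ∈ Circ, {w : Fin n → ℂ | ∑ j, g z j * w j = 1} = TangentPlane (ρ z) (f z)) :
    ∃ (D : Dat n ρ R) (Y : ℂ → ℂ), MemA Y ∧ (∀ θ : ℝ, D.f θ = f (Complex.exp (θ * I))) ∧
      (∀ θ : ℝ, D.g θ = g (Complex.exp (θ * I))) ∧
      (∀ θ : ℝ, D.X θ = Complex.exp (Y (Complex.exp (θ * I)))) := by
  have hf0 : ∀ θ : ℝ, f (Complex.exp (θ * I)) ≠ 0 := by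
    intro θ h
    have := hfg _ (exp_mem_Circ θ)
    simp [h] at this
  have hfc : ContDiff ℝ 4 (fun θ : ℝ => f (Complex.exp (θ * I))) := contDiff_pi.2 fun j => hf4 j
  have hgc : ContDiff ℝ 4 (fun θ : ℝ => g (Complex.exp (θ * I))) := contDiff_pi.2 fun j => hg4 j
  have hu : ContDiff ℝ 4 (fun θ : ℝ => lam ρ (Complex.exp (θ * I)) (f (Complex.exp (θ * I)))) := by
    rw [contDiff_iff_contDiffAt]
    intro θ
    have h1 := (lam_contAt hρ (θ, f (Complex.exp (θ * I))) (hf0 θ)).of_le (m := 4) (by norm_num)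
    exact ContDiffAt.comp (g := fun q : ℝ × (Fin n → ℂ) => lam ρ (Complex.exp (q.1 * I)) q.2)
      (f := fun θ : ℝ => (θ, f (Complex.exp (θ * I)))) θ h1 (contDiff_id.prodMk hfc).contDiffAt
  have hL := lam_hasLog hρ hf12 hg12 (fun z hz => by rw [hρf z hz]; exact hρ.hR.le) hfg
  obtain ⟨Y, hY, hYc, r, hr, pr, r0, hur⟩ := exists_X _ hu hL
  have pe := periodic_exp
  refine ⟨{ f := fun θ => f (Complex.exp (θ * I))
            g := fun θ => g (Complex.exp (θ * I))
            X := fun θ => Complex.exp (Y (Complex.exp (θ * I)))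
            r := r
            hρ := hρ
            hf := hfc.of_le (by norm_num)
            hg := hgc.of_le (by norm_num)
            hX := hYc.cexp
            hr := hr
            pf := fun θ => by have := pe θ; simp only at this; simp only [this]
            pg := fun θ => by have := pe θ; simp only at this; simp only [this]
            pX := fun θ => by have := pe θ; simp only at this; simp only [this]
            pr := pr
            X0 := fun θ => Complex.exp_ne_zero _
            r0 := r0
            fg := fun θ => hfg _ (exp_mem_Circ θ)
            pd := fun θ j => by
              rw [grad_of_tan (hfg _ (exp_mem_Circ θ)) (htan _ (exp_mem_Circ θ)) j, ← hur θ, lam] },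
    Y, hY, fun _ => rfl, fun _ => rfl, fun _ => rfl⟩

theorem final_thm (hρ : Cond3 n ρ R (fun _ => 0)) {f g : ℂ → Fin n → ℂ}
    (hf12 : MemAV f) (hg12 : MemAV g) (hf4 : C4CircV f) (hg4 : C4CircV g)
    (hρf : ∀ z ∈ Circ, ρ z (f z) = 1)
    (hfg : ∀ z ∈ Circ, ∑ j, f z j * g z j = 1)
    (htan : ∀ z ∈ Circ, {w : Fin n → ℂ | ∑ j, g z j * w j = 1} = TangentPlane (ρ z) (f z)) :
    ∃ N : Set (Fin n → ℂ), IsOpen N ∧ f 0 ∈ N ∧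
      ∃ (F G : (Fin n → ℂ) → ℂ → (Fin n → ℂ))
        (Fc Gc : (Fin n → ℂ) → Fin n → Seq2),
        ContDiffOn ℝ 1 Fc N ∧ ContDiffOn ℝ 1 Gc N ∧
        (∀ w ∈ N, ∀ j, MemH12 (fun z => F w z j) ∧ RepOf (Fc w j) (fun z => F w z j)) ∧
        (∀ w ∈ N, ∀ j, MemH12 (fun z => G w z j) ∧ RepOf (Gc w j) (fun z => G w z j)) ∧
        (∀ w ∈ N, ∃ c : ℝ, ∀ z ∈ Circ, ρ z (F w z) = c) ∧
        (∀ w ∈ N, F w 0 = w) ∧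
        (∀ w ∈ N, ∀ z ∈ Circ, ∑ j, F w z j * G w z j = 1) ∧
        (∀ w ∈ N, ∀ z ∈ Circ,
          {v : Fin n → ℂ | ∑ j, G w z j * v j = 1} = TangentPlane (ρ z) (F w z)) := by
  obtain ⟨D, Y, hY, hDf, hDg, hDX⟩ := exists_dat hρ hf12 hg12 hf4 hg4 hρf hfg htan
  have HH1 : ∀ i, ∃ h, MemA h ∧ ∀ θ : ℝ, h (Complex.exp (θ * I)) = D.X θ * D.g θ i := fun i =>
    ⟨_, hY.cexp.mul (hg12 i), fun θ => by simp only [hDX, hDg]⟩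
  have HH2 : ∀ θ, rt ρ (θ, D.f θ) = 1 := fun θ => by
    simp only [rt, hDf]; exact hρf _ (exp_mem_Circ θ)
  obtain ⟨N0, T, ε, Xs, hN0, hT, hg, hε, hTid, hX0, hXc, hXs⟩ := D.solve HH1 HH2
  -- the neighbourhood
  have hsm : ∀ᶠ δ in nhds (0 : Fin n → ℂ), ‖(δ, iR (Xs δ))‖ < ε := by
    have hc : ContinuousAt (fun δ : Fin n → ℂ => ‖(δ, iR (Xs δ))‖) 0 :=
      (continuousAt_id.prodMk ((iR (A := AA n)).continuous.continuousAt.comp hXc.continuousAt)).norm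
    refine hc.eventually_lt continuousAt_const ?_
    simp only [hX0, map_zero]
    simpa using hε
  have hcd : ∀ᶠ δ in nhds (0 : Fin n → ℂ), ContDiffAt ℝ 1 Xs δ := hXc.eventually (by simp)
  obtain ⟨N', hN', hN'o, h0N'⟩ := _root_.eventually_nhds_iff.1 ((hsm.and hcd).and hXs)
  set sh : (Fin n → ℂ) → (Fin n → ℂ) := fun w => w - f 0 with hsh
  have hshc : ContDiff ℝ 1 sh := contDiff_id.sub contDiff_const
  -- the smooth representatives
  have hFcd : ∀ j, ContDiff ℝ 2 (fun p : ℝ × ((Fin n → ℂ) × AA n) => D.FF (p.1, T p.2) j) := fun j =>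
    (contDiff_pi.1 D.FF_contDiff j).comp (contDiff_fst.prodMk (hT.comp contDiff_snd))
  have hFper : ∀ j, PerT (fun p : ℝ × ((Fin n → ℂ) × AA n) => D.FF (p.1, T p.2) j) := fun j y θ => by
    simp only [D.FF_per]
  have hGcd : ∀ j, ContDiff ℝ 2 (fun p : ℝ × ((Fin n → ℂ) × AA n) =>
      D.pp (p.1, T p.2) j / D.num (p.1, T p.2)) := fun j => by
    simp only [div_eq_mul_inv]
    rw [contDiff_iff_contDiffAt]
    intro p
    have hm : ContDiffAt ℝ 2 (fun p : ℝ × ((Fin n → ℂ) × AA n) => (p.1, T p.2)) p :=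
      (contDiff_fst.prodMk (hT.comp contDiff_snd)).contDiffAt
    have hgp := hg p.1 p.2
    have h1 := ContDiffAt.comp (g := fun q => D.pp q j)
      (f := fun p : ℝ × ((Fin n → ℂ) × AA n) => (p.1, T p.2)) p
      (contDiffAt_pi.1 (D.pp_contDiffAt hgp.1) j) hm
    have h2 := ContDiffAt.comp (g := D.num)
      (f := fun p : ℝ × ((Fin n → ℂ) × AA n) => (p.1, T p.2)) p (D.num_contDiffAt hgp.1) hm
    exact h1.mul (h2.inv hgp.2.2.1)
  have hGper : ∀ j, PerT (fun p : ℝ × ((Fin n → ℂ) × AA n) =>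
      D.pp (p.1, T p.2) j / D.num (p.1, T p.2)) := fun j y θ => by
    simp only [D.pp_per, D.num_per]
  have hTw : ∀ w ∈ sh ⁻¹' N', ∀ θ : ℝ, T (sh w, iR (Xs (sh w)) (θ : TT)) = (sh w, iR (Xs (sh w)) (θ : TT)) := by
    intro w hw θ
    refine hTid _ (lt_of_le_of_lt ?_ (hN' _ hw).1.1)
    rw [Prod.norm_def, Prod.norm_def]
    exact max_le_max le_rfl (ContinuousMap.norm_coe_le_norm _ _)
  have hdisc : ∀ w ∈ sh ⁻¹' N', _ := fun w hw => D.disc hf12 hg12 hY hDf hDg hDX (sh w) (Xs (sh w)) hN0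
    (fun θ => by rw [← hTw w hw θ]; exact hg _ _)
    (fun i => by
      obtain ⟨V, hV, hVe⟩ := (hN' _ hw).2 i
      refine ⟨V, hV, fun θ => ?_⟩
      rw [hVe]
      simp only [Dat.vT, hTw w hw θ])
  choose! hFE hcst G hGA hGe using hdisc
  have hcm : ContDiffOn ℝ 1 (fun w => (sh w, Xs (sh w))) (sh ⁻¹' N') := by
    intro w hw
    exact (hshc.contDiffAt.prodMk ((hN' _ hw).1.2.comp w hshc.contDiffAt)).contDiffWithinAt
  refine ⟨sh ⁻¹' N', hN'o.preimage hshc.continuous, by simpa [hsh] using h0N',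
    fun w => FE f g Y (sh w) (Xs (sh w)), G,
    fun w j => SB _ (hFcd j) (hFper j) (sh w, Xs (sh w)),
    fun w j => SB _ (hGcd j) (hGper j) (sh w, Xs (sh w)), ?_, ?_, ?_, ?_, ?_, ?_, ?_, ?_⟩
  · exact contDiffOn_pi.2 fun j => (SB_contDiff _ (hFcd j) (hFper j)).comp_contDiffOn hcm
  · exact contDiffOn_pi.2 fun j => (SB_contDiff _ (hGcd j) (hGper j)).comp_contDiffOn hcm
  · intro w hw j
    have hr : RepOf (SB _ (hFcd j) (hFper j) (sh w, Xs (sh w)))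
        (fun z => FE f g Y (sh w) (Xs (sh w)) z j) := by
      refine repOf_SB _ _ _ _ _ fun θ => ?_
      simp only [hFE w hw, hTw w hw θ]
    have hA := FE_memA hf12 hg12 hY (sh w) (Xs (sh w)) j
    exact ⟨⟨hA.1, hA.2, _, hr⟩, hr⟩
  · intro w hw j
    have hr : RepOf (SB _ (hGcd j) (hGper j) (sh w, Xs (sh w))) (fun z => G w z j) := by
      refine repOf_SB _ _ _ _ _ fun θ => ?_
      simp only [hGe w hw, hTw w hw θ]
    have hA := hGA w hw j
    exact ⟨⟨hA.1, hA.2, _, hr⟩, hr⟩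
  · intro w hw
    obtain ⟨c, hc⟩ := hcst w hw
    refine ⟨c, fun z hz => ?_⟩
    obtain ⟨θ, rfl⟩ := exists_exp_of_mem_Circ hz
    have := hc θ
    rw [← hFE w hw θ] at this
    exact this
  · intro w hw
    simp only [FE_zero, hsh]
    abel
  all_goals
    intro w hw z hz
    obtain ⟨θ, rfl⟩ := exists_exp_of_mem_Circ hz
    have hgd := hg θ (sh w, iR (Xs (sh w)) (θ : TT))
    rw [hTw w hw θ] at hgd
    have hK := tan_of_grad (ρz := ρ (Complex.exp (θ * I))) (p := FE f g Y (sh w) (Xs (sh w)) (Complex.exp (θ * I)))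
      (g := G w (Complex.exp (θ * I))) (by rw [hFE w hw θ]; exact hgd.2.2.1)
      (fun j => by rw [hGe w hw θ j, hFE w hw θ]; rfl)
  · exact hK.1
  · exact hK.2

end Assemble

/-- Theorem 1 (perturbation theorem). -/
theorem statement0 {n : ℕ} (ρ : ℂ → (Fin n → ℂ) → ℝ) (R : ℝ)
    (hρ : Cond3 n ρ R (fun _ => 0))
    (f g : ℂ → Fin n → ℂ)
    (hf12 : MemH12V f) (hg12 : MemH12V g)
    (hf4 : C4CircV f) (hg4 : C4CircV g)
    (hρf : ∀ z ∈ Circ, ρ z (f z) = 1)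
    (hfg : ∀ z ∈ Circ, ∑ j, f z j * g z j = 1)
    (htan : ∀ z ∈ Circ, {w : Fin n → ℂ | ∑ j, g z j * w j = 1} = TangentPlane (ρ z) (f z)) :
    ∃ N : Set (Fin n → ℂ), IsOpen N ∧ f 0 ∈ N ∧
      ∃ (F G : (Fin n → ℂ) → ℂ → (Fin n → ℂ))
        (Fc Gc : (Fin n → ℂ) → Fin n → Seq2),
        ContDiffOn ℝ 1 Fc N ∧ ContDiffOn ℝ 1 Gc N ∧
        (∀ w ∈ N, ∀ j, MemH12 (fun z => F w z j) ∧ RepOf (Fc w j) (fun z => F w z j)) ∧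
        (∀ w ∈ N, ∀ j, MemH12 (fun z => G w z j) ∧ RepOf (Gc w j) (fun z => G w z j)) ∧
        (∀ w ∈ N, ∃ c : ℝ, ∀ z ∈ Circ, ρ z (F w z) = c) ∧
        (∀ w ∈ N, F w 0 = w) ∧
        (∀ w ∈ N, ∀ z ∈ Circ, ∑ j, F w z j * G w z j = 1) ∧
        (∀ w ∈ N, ∀ z ∈ Circ,
          {v : Fin n → ℂ | ∑ j, G w z j * v j = 1} = TangentPlane (ρ z) (F w z)) := by
  exact final_thm hρ (fun j => (hf12 j).memA) (fun j => (hg12 j).memA) hf4 hg4 hρf hfg htan
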